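/- For every function f : ℕ → (0,∞) with f(n) → ∞ and f(n)/log n → 0 as n → ∞, there exist D ∈ ℕ and a sequence of finite connected simple graphs G_n = (V_n, E_n) with maximal degree at most D and |V_n| → ∞ such that: there are constants c,C > 0 with c·t_mix(G_n) ≤ t_rel(G_n) ≤ C·t_mix(G_n) for all n, and there exist edge weights c_e^{(n)} ≥ 1 on E_n with max_{e∈E_n} c_e^{(n)} → 1 as n → ∞ (an o(1)-perturbation) such that c'·f(|V_n|) ≤ t_mix(G_n,(c_e^{(n)}))/t_mix(G_n) ≤ C'·f(|V_n|) for all n, for some constants c',C' > 0; moreover the sequence of lazy random walks on the weighted networks exhibits total variation cutoff. -/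

import Mathlib

open Filter Finset

noncomputable section

variable {V : Type} [Fintype V] [DecidableEq V]

/-- `P` is a row-stochastic matrix. -/
def IsStoch (P : Matrix V V ℝ) : Prop :=
  (∀ i j, 0 ≤ P i j) ∧ ∀ i, ∑ j, P i j = 1

/-- `π` is a probability vector with full support. -/
def IsProb (π : V → ℝ) : Prop := (∀ i, 0 < π i) ∧ ∑ i, π i = 1

/-- reversibility: `π x * P x y = π y * P y x`. -/
def Rev (P : Matrix V V ℝ) (π : V → ℝ) : Prop := ∀ i j, π i * P i j = π j * P j i

/-- irreducibility -/
def Irred (P : Matrix V V ℝ) : Prop := ∀ i j, ∃ t : ℕ, 0 < (P ^ t) i j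

/-- the lazy version `(I + P)/2` of a chain -/
def lazyM (P : Matrix V V ℝ) : Matrix V V ℝ := (2 : ℝ)⁻¹ • (1 + P)

/-- total variation distance -/
def tvDist (μ ν : V → ℝ) : ℝ := (∑ x, |μ x - ν x|) / 2

/-- worst-case total variation distance from stationarity at time `t` -/
def dTV (P : Matrix V V ℝ) (π : V → ℝ) (t : ℕ) : ℝ := ⨆ x, tvDist ((P ^ t) x) π

/-- the `ε` total-variation mixing time -/
def mixTime (P : Matrix V V ℝ) (π : V → ℝ) (ε : ℝ) : ℕ := sInf {t : ℕ | dTV P π t ≤ ε}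

/-- worst-case separation distance at time `t` -/
def dSep (P : Matrix V V ℝ) (π : V → ℝ) (t : ℕ) : ℝ := 1 - ⨅ x, ⨅ y, ((P ^ t) x y) / π y

/-- the `ε` separation time -/
def sepTime (P : Matrix V V ℝ) (π : V → ℝ) (ε : ℝ) : ℕ := sInf {t : ℕ | dSep P π t ≤ ε}

/-- the heat kernel `H_t = exp (t (P - I))` of the associated continuous-time chain -/
def heatKer (P : Matrix V V ℝ) (t : ℝ) : Matrix V V ℝ :=
  ∑' k : ℕ, (t ^ k / (Nat.factorial k : ℝ)) • ((P - 1) ^ k)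

/-- separation distance of the continuous-time chain -/
def dSepC (P : Matrix V V ℝ) (π : V → ℝ) (t : ℝ) : ℝ := 1 - ⨅ x, ⨅ y, (heatKer P t) x y / π y

/-- the `ε` separation time of the continuous-time chain -/
def sepTimeC (P : Matrix V V ℝ) (π : V → ℝ) (ε : ℝ) : ℝ := sInf {t : ℝ | 0 ≤ t ∧ dSepC P π t ≤ ε}

/-- degree of a vertex -/
def deg (G : SimpleGraph V) (v : V) : ℕ := Nat.card {u // G.Adj v u}

open Classical in
/-- transition matrix of the lazy simple random walk on `G` -/
def walkMat (G : SimpleGraph V) : Matrix V V ℝ :=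
  Matrix.of fun v u => if v = u then 1/2 else if G.Adj v u then 1 / (2 * (deg G v : ℝ)) else 0

/-- stationary distribution of the (lazy) simple random walk on `G` -/
def degSta (G : SimpleGraph V) (v : V) : ℝ := (deg G v : ℝ) / ∑ u, (deg G u : ℝ)

/-- the `ε` total-variation mixing time of the lazy simple random walk on `G` -/
def tmixG (G : SimpleGraph V) (ε : ℝ) : ℕ := mixTime (walkMat G) (degSta G) ε

/-- the second largest eigenvalue of a reversible transition matrix -/
def lam2 (P : Matrix V V ℝ) : ℝ :=
  sSup {μ : ℝ | μ ≠ 1 ∧ ∃ f : V → ℝ, f ≠ 0 ∧ P.mulVec f = μ • f}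

/-- the relaxation time `1/(1-λ₂)` -/
def trel (P : Matrix V V ℝ) : ℝ := 1 / (1 - lam2 P)

/-- the relaxation time of the lazy simple random walk on `G` -/
def trelG (G : SimpleGraph V) : ℝ := trel (walkMat G)

/-- transition matrix of the lazy random walk on the network with edge weights `w` -/
def wMat (w : V → V → ℝ) : Matrix V V ℝ :=
  Matrix.of fun v u => if v = u then 1/2 else w v u / (2 * ∑ x, w v x)

/-- stationary distribution of the lazy random walk on the network with edge weights `w` -/
def wSta (w : V → V → ℝ) (v : V) : ℝ := (∑ x, w v x) / ∑ u, ∑ x, w u x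

/-- `w` is a valid system of edge weights on the graph `G`: symmetric, positive on edges
and vanishing off the edges. -/
def GoodWeights (G : SimpleGraph V) (w : V → V → ℝ) : Prop :=
  (∀ u v, w u v = w v u) ∧ (∀ u v, G.Adj u v → 0 < w u v) ∧ ∀ u v, ¬ G.Adj u v → w u v = 0

/-- the `ε` total-variation mixing time of the lazy random walk on the weighted network -/
def tmixW (w : V → V → ℝ) (ε : ℝ) : ℕ := mixTime (wMat w) (wSta w) ε

/-- the probability of a discrete trajectory -/
def pathProb (P : Matrix V V ℝ) {k : ℕ} (w : Fin (k+1) → V) : ℝ :=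
  ∏ i : Fin k, P (w i.castSucc) (w i.succ)

/-- `P_x[T_y = k]`: probability that the chain started at `x` first hits `y` at time `k` -/
def firstHit (P : Matrix V V ℝ) (x y : V) (k : ℕ) : ℝ :=
  ∑ w : Fin (k+1) → V,
    if w 0 = x ∧ w (Fin.last k) = y ∧ ∀ i : Fin k, w i.castSucc ≠ y then pathProb P w else 0

/-- the restriction of `P - I` to the complement of `y` -/
def restrQ (P : Matrix V V ℝ) (y : V) : Matrix {w : V // w ≠ y} {w : V // w ≠ y} ℝ :=
  Matrix.of fun a b => P a.1 b.1 - if a = b then 1 else 0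

/-- `exp (t A)` where `A` is the restriction of `P - I` to the complement of `y` -/
def heatRestr (P : Matrix V V ℝ) (y : V) (t : ℝ) :
    Matrix {w : V // w ≠ y} {w : V // w ≠ y} ℝ :=
  ∑' k : ℕ, (t ^ k / (Nat.factorial k : ℝ)) • (restrQ P y ^ k)

/-- `P_x[T_B < r]` for the chain `P`: the probability that the set `B` is hit before time `r` -/
def hitByTime (P : Matrix V V ℝ) (B : Finset V) (x : V) (r : ℕ) : ℝ :=
  ∑ k ∈ Finset.range r, ∑ w : Fin (k+1) → V,
    if w 0 = x ∧ w (Fin.last k) ∈ B ∧ ∀ i : Fin k, w i.castSucc ∉ B then pathProb P w else 0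



/-! ### Lazy reversible chains -/

set_option linter.unusedSectionVars false

section Chains

open scoped Matrix

/-- `P` is a lazy Markov chain, reversible with respect to the probability vector `π`. -/
structure LazyRev (P : Matrix V V ℝ) (π : V → ℝ) : Prop where
  stoch : IsStoch P
  prob : IsProb π
  rev : Rev P π
  lazy : ∀ x, 1 / 2 ≤ P x x

/-- the weighted inner product `∑ π f g` -/
def ip (π f g : V → ℝ) : ℝ := ∑ x, π x * f x * g x


lemma IsStoch.mulVec_const {P : Matrix V V ℝ} (h : IsStoch P) (c : ℝ) (x : V) :
    (P *ᵥ fun _ => c) x = c := by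
  simp [Matrix.mulVec, dotProduct, ← Finset.sum_mul, h.2 x]

lemma IsStoch.pow {P : Matrix V V ℝ} (h : IsStoch P) (t : ℕ) : IsStoch (P ^ t) := by
  induction t with
  | zero =>
    refine ⟨fun i j => ?_, fun i => ?_⟩
    · rw [pow_zero, Matrix.one_apply]; split_ifs <;> norm_num
    · simp [Matrix.one_apply]
  | succ n ih =>
    refine ⟨fun i j => ?_, fun i => ?_⟩
    · rw [pow_succ, Matrix.mul_apply]
      exact Finset.sum_nonneg fun k _ => mul_nonneg (ih.1 _ _) (h.1 _ _)
    · simp only [pow_succ, Matrix.mul_apply]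
      rw [Finset.sum_comm]
      simp [← Finset.mul_sum, h.2, ih.2]

lemma Rev.pow {P : Matrix V V ℝ} {π : V → ℝ} (h : Rev P π) (t : ℕ) : Rev (P ^ t) π := by
  induction t with
  | zero =>
    intro i j
    rcases eq_or_ne i j with rfl | hij
    · rfl
    · simp [hij, hij.symm]
  | succ n ih =>
    intro i j
    rw [pow_succ, Matrix.mul_apply, ← pow_succ, pow_succ', Matrix.mul_apply, Finset.mul_sum,
      Finset.mul_sum]
    refine Finset.sum_congr rfl fun k _ => ?_
    rw [← mul_assoc, ih i k, mul_assoc, mul_comm _ (P k j), ← mul_assoc, h k j, mul_assoc]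

lemma IsStoch.mulVec_mono {P : Matrix V V ℝ} (h : IsStoch P) {f g : V → ℝ} (hfg : ∀ x, f x ≤ g x)
    (x : V) : (P *ᵥ f) x ≤ (P *ᵥ g) x :=
  Finset.sum_le_sum fun y _ => mul_le_mul_of_nonneg_left (hfg y) (h.1 x y)

lemma Rev.stationary {P : Matrix V V ℝ} {π : V → ℝ} (h : Rev P π) (hs : IsStoch P) (y : V) :
    ∑ x, π x * P x y = π y := by
  simp_rw [h _ y, ← Finset.mul_sum, hs.2 y, mul_one]

lemma ip_comm (π f g : V → ℝ) : ip π f g = ip π g f :=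
  Finset.sum_congr rfl fun x _ => by ring

lemma ip_mulVec {P : Matrix V V ℝ} {π : V → ℝ} (h : Rev P π) (f g : V → ℝ) :
    ip π (P *ᵥ f) g = ip π f (P *ᵥ g) := by
  simp only [ip, Matrix.mulVec, dotProduct, Finset.mul_sum, Finset.sum_mul]
  rw [Finset.sum_comm]
  refine Finset.sum_congr rfl fun x _ => Finset.sum_congr rfl fun y _ => ?_
  linear_combination f x * g y * h y x

lemma ip_pow_mulVec {P : Matrix V V ℝ} {π : V → ℝ} (h : Rev P π) (t : ℕ) (f g : V → ℝ) :
    ip π (P ^ t *ᵥ f) g = ip π f (P ^ t *ᵥ g) := ip_mulVec (h.pow t) f g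

lemma ip_self_nonneg {π : V → ℝ} (h : IsProb π) (f : V → ℝ) : 0 ≤ ip π f f :=
  Finset.sum_nonneg fun x _ => by
    rw [mul_assoc]; exact mul_nonneg (h.1 x).le (mul_self_nonneg _)

lemma sum_pi_mulVec {P : Matrix V V ℝ} {π : V → ℝ} (h : Rev P π) (hs : IsStoch P) (f : V → ℝ) :
    ∑ x, π x * (P *ᵥ f) x = ∑ x, π x * f x := by
  simp only [Matrix.mulVec, dotProduct, Finset.mul_sum]
  rw [Finset.sum_comm]
  refine Finset.sum_congr rfl fun y _ => ?_
  simp_rw [← mul_assoc, ← Finset.sum_mul, h.stationary hs y]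

lemma IsStoch.sq_mulVec_le {P : Matrix V V ℝ} (h : IsStoch P) (f : V → ℝ) (x : V) :
    (P *ᵥ f) x ^ 2 ≤ (P *ᵥ fun y => f y ^ 2) x := by
  set m := (P *ᵥ f) x with hm
  have h0 : 0 ≤ ∑ y, P x y * (f y - m) ^ 2 :=
    Finset.sum_nonneg fun y _ => mul_nonneg (h.1 x y) (sq_nonneg _)
  have h1 : ∑ y, P x y * (f y - m) ^ 2 =
      ∑ y, P x y * f y ^ 2 - 2 * m * ∑ y, P x y * f y + m ^ 2 * ∑ y, P x y := by
    simp only [Finset.mul_sum, ← Finset.sum_sub_distrib, ← Finset.sum_add_distrib]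
    exact Finset.sum_congr rfl fun y _ => by ring
  have h2 : ∑ y, P x y * f y = m := rfl
  have h3 : (P *ᵥ fun y => f y ^ 2) x = ∑ y, P x y * f y ^ 2 := rfl
  rw [h1, h2, h.2 x] at h0
  rw [h3]; nlinarith

lemma LazyRev.ip_contract {P : Matrix V V ℝ} {π : V → ℝ} (h : LazyRev P π) (f : V → ℝ) :
    ip π (P *ᵥ f) (P *ᵥ f) ≤ ip π f f := by
  have h1 : ip π f f = ∑ x, π x * (P *ᵥ fun y => f y ^ 2) x := by
    rw [sum_pi_mulVec h.rev h.stoch]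
    exact Finset.sum_congr rfl fun x _ => by ring
  rw [h1]
  refine Finset.sum_le_sum fun x _ => ?_
  rw [mul_assoc, ← pow_two]
  exact mul_le_mul_of_nonneg_left (h.stoch.sq_mulVec_le f x) (h.prob.1 x).le

/-- the Dirichlet form -/
lemma LazyRev.energy {P : Matrix V V ℝ} {π : V → ℝ} (h : LazyRev P π) (f : V → ℝ) :
    ip π f f - ip π f (P *ᵥ f) = (∑ x, ∑ y, π x * P x y * (f x - f y) ^ 2) / 2 := by
  have h1 : ∑ x, ∑ y, π x * P x y * f x ^ 2 = ip π f f := by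
    refine Finset.sum_congr rfl fun x _ => ?_
    rw [← Finset.sum_mul, ← Finset.mul_sum, h.stoch.2 x]; ring
  have h2 : ∑ x, ∑ y, π x * P x y * f y ^ 2 = ip π f f := by
    rw [Finset.sum_comm]
    refine Finset.sum_congr rfl fun x _ => ?_
    rw [← Finset.sum_mul, h.rev.stationary h.stoch]; ring
  have h3 : ∑ x, ∑ y, π x * P x y * (f x * f y) = ip π f (P *ᵥ f) := by
    refine Finset.sum_congr rfl fun x _ => ?_
    rw [Matrix.mulVec, dotProduct, Finset.mul_sum]
    exact Finset.sum_congr rfl fun y _ => by ring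
  have h4 : ∑ x, ∑ y, π x * P x y * (f x - f y) ^ 2 = ∑ x, ∑ y, π x * P x y * f x ^ 2
      + ∑ x, ∑ y, π x * P x y * f y ^ 2 - 2 * ∑ x, ∑ y, π x * P x y * (f x * f y) := by
    simp only [Finset.mul_sum, ← Finset.sum_sub_distrib, ← Finset.sum_add_distrib]
    exact Finset.sum_congr rfl fun x _ => Finset.sum_congr rfl fun y _ => by ring
  rw [h4, h1, h2, h3]; ring

lemma LazyRev.ip_mulVec_nonneg {P : Matrix V V ℝ} {π : V → ℝ} (h : LazyRev P π) (f : V → ℝ) :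
    0 ≤ ip π f (P *ᵥ f) := by
  have h1 : ∑ x, ∑ y, π x * P x y * f x ^ 2 = ip π f f := by
    refine Finset.sum_congr rfl fun x _ => ?_
    rw [← Finset.sum_mul, ← Finset.mul_sum, h.stoch.2 x]; ring
  have h2 : ∑ x, ∑ y, π x * P x y * f y ^ 2 = ip π f f := by
    rw [Finset.sum_comm]
    refine Finset.sum_congr rfl fun x _ => ?_
    rw [← Finset.sum_mul, h.rev.stationary h.stoch]; ring
  have h3 : ∑ x, ∑ y, π x * P x y * (f x * f y) = ip π f (P *ᵥ f) := by
    refine Finset.sum_congr rfl fun x _ => ?_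
    rw [Matrix.mulVec, dotProduct, Finset.mul_sum]
    exact Finset.sum_congr rfl fun y _ => by ring
  have h4 : ∑ x, ∑ y, π x * P x y * (f x + f y) ^ 2 = ∑ x, ∑ y, π x * P x y * f x ^ 2
      + ∑ x, ∑ y, π x * P x y * f y ^ 2 + 2 * ∑ x, ∑ y, π x * P x y * (f x * f y) := by
    simp only [Finset.mul_sum, ← Finset.sum_add_distrib]
    exact Finset.sum_congr rfl fun x _ => Finset.sum_congr rfl fun y _ => by ring
  have h5 : 2 * ip π f f ≤ ∑ x, ∑ y, π x * P x y * (f x + f y) ^ 2 := by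
    rw [ip, Finset.mul_sum]
    refine Finset.sum_le_sum fun x _ => ?_
    have hle : π x * P x x * (f x + f x) ^ 2 ≤ ∑ y, π x * P x y * (f x + f y) ^ 2 :=
      Finset.single_le_sum (f := fun y => π x * P x y * (f x + f y) ^ 2)
        (fun y _ => mul_nonneg (mul_nonneg (h.prob.1 x).le (h.stoch.1 x y)) (sq_nonneg _))
        (Finset.mem_univ x)
    refine le_trans ?_ hle
    have := mul_le_mul_of_nonneg_left (h.lazy x)
      (mul_nonneg (h.prob.1 x).le (sq_nonneg (f x + f x)))
    nlinarith
  rw [h4, h1, h2, h3] at h5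
  linarith

lemma tvDist_nonneg (μ ν : V → ℝ) : 0 ≤ tvDist μ ν :=
  div_nonneg (Finset.sum_nonneg fun _ _ => abs_nonneg _) (by norm_num)

lemma tvDist_le_dTV (P : Matrix V V ℝ) (π : V → ℝ) (t : ℕ) (x : V) :
    tvDist ((P ^ t) x) π ≤ dTV P π t :=
  le_ciSup (f := fun x => tvDist ((P ^ t) x) π) (Set.finite_range _).bddAbove x

lemma LazyRev.nonempty {P : Matrix V V ℝ} {π : V → ℝ} (h : LazyRev P π) : Nonempty V := by
  by_contra hV
  rw [not_nonempty_iff] at hV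
  simpa using h.prob.2

lemma LazyRev.tvDist_le_one {P : Matrix V V ℝ} {π : V → ℝ} (h : LazyRev P π) (t : ℕ) (x : V) :
    tvDist ((P ^ t) x) π ≤ 1 := by
  have h1 : ∑ y, |(P ^ t) x y - π y| ≤ ∑ y, ((P ^ t) x y + π y) :=
    Finset.sum_le_sum fun y _ => by
      have := (h.stoch.pow t).1 x y
      have := h.prob.1 y
      rw [abs_le]; constructor <;> linarith
  rw [Finset.sum_add_distrib, (h.stoch.pow t).2 x, h.prob.2] at h1
  rw [tvDist]; linarith

lemma LazyRev.tvDist_succ_le {P : Matrix V V ℝ} {π : V → ℝ} (h : LazyRev P π) (t : ℕ) (x : V) :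
    tvDist ((P ^ (t + 1)) x) π ≤ ∑ y, P x y * tvDist ((P ^ t) y) π := by
  have h1 : ∀ v, |(P ^ (t + 1)) x v - π v| ≤ ∑ y, P x y * |(P ^ t) y v - π v| := by
    intro v
    have : (P ^ (t + 1)) x v - π v = ∑ y, P x y * ((P ^ t) y v - π v) := by
      simp only [mul_sub, Finset.sum_sub_distrib, ← Finset.sum_mul, h.stoch.2 x, one_mul]
      rw [pow_succ', Matrix.mul_apply]
    rw [this]
    refine (Finset.abs_sum_le_sum_abs _ _).trans (le_of_eq ?_)
    exact Finset.sum_congr rfl fun y _ => by rw [abs_mul, abs_of_nonneg (h.stoch.1 x y)]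
  simp only [tvDist, mul_div_assoc', ← Finset.sum_div]
  refine div_le_div_of_nonneg_right ?_ (by norm_num)
  refine (Finset.sum_le_sum fun v _ => h1 v).trans (le_of_eq ?_)
  rw [Finset.sum_comm]
  simp only [Finset.mul_sum]

lemma LazyRev.dTV_le {P : Matrix V V ℝ} {π : V → ℝ} (h : LazyRev P π) {t : ℕ} {c : ℝ}
    (hc : ∀ x, tvDist ((P ^ t) x) π ≤ c) : dTV P π t ≤ c := by
  have := h.nonempty
  exact ciSup_le hc

lemma LazyRev.dTV_antitone {P : Matrix V V ℝ} {π : V → ℝ} (h : LazyRev P π) :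
    Antitone (dTV P π) := by
  refine antitone_nat_of_succ_le fun t => h.dTV_le fun x => ?_
  refine (h.tvDist_succ_le t x).trans ?_
  calc _ ≤ ∑ y, P x y * dTV P π t := Finset.sum_le_sum fun y _ =>
        mul_le_mul_of_nonneg_left (tvDist_le_dTV P π t y) (h.stoch.1 x y)
    _ = _ := by rw [← Finset.sum_mul, h.stoch.2 x, one_mul]

/-- mass of a set where a slowly growing function exceeds one -/
lemma LazyRev.lower {P : Matrix V V ℝ} {π : V → ℝ} (h : LazyRev P π) {ψ : V → ℝ} {lam : ℝ}
    (hlam : 0 ≤ 1 + lam) (A : Finset V) (h0 : ∀ x, 0 ≤ ψ x) (hA : ∀ x ∈ A, 1 ≤ ψ x)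
    (hP : ∀ x, (P *ᵥ ψ) x ≤ (1 + lam) * ψ x) (t : ℕ) (x : V) :
    ∑ y ∈ A, π y - (1 + lam) ^ t * ψ x ≤ dTV P π t := by
  have h1 : ∀ t x, (P ^ t *ᵥ ψ) x ≤ (1 + lam) ^ t * ψ x := by
    intro t
    induction t with
    | zero => intro x; simp
    | succ n ih =>
      intro x
      rw [pow_succ', ← Matrix.mulVec_mulVec]
      refine (h.stoch.mulVec_mono ih x).trans ?_
      have : (P *ᵥ fun x => (1 + lam) ^ n * ψ x) x = (1 + lam) ^ n * (P *ᵥ ψ) x := by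
        simp only [Matrix.mulVec, dotProduct, Finset.mul_sum]
        exact Finset.sum_congr rfl fun y _ => by ring
      rw [this, pow_succ, mul_assoc]
      exact mul_le_mul_of_nonneg_left (hP x) (pow_nonneg hlam n)
  have h2 : ∑ y ∈ A, (P ^ t) x y ≤ (P ^ t *ᵥ ψ) x := by
    calc ∑ y ∈ A, (P ^ t) x y ≤ ∑ y ∈ A, (P ^ t) x y * ψ y := Finset.sum_le_sum fun y hy => by
          have := (h.stoch.pow t).1 x y
          nlinarith [hA y hy]
      _ ≤ _ := Finset.sum_le_sum_of_subset_of_nonneg (Finset.subset_univ _)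
          fun y _ _ => mul_nonneg ((h.stoch.pow t).1 x y) (h0 y)
  have h3 : ∑ y ∈ A, π y - ∑ y ∈ A, (P ^ t) x y ≤ tvDist ((P ^ t) x) π := by
    have e1 : ∑ y, ((P ^ t) x y - π y) = 0 := by
      rw [Finset.sum_sub_distrib, (h.stoch.pow t).2 x, h.prob.2]; ring
    have e2 : ∑ y ∈ A, ((P ^ t) x y - π y) + ∑ y ∈ Aᶜ, ((P ^ t) x y - π y) = 0 := by
      rw [Finset.sum_add_sum_compl, e1]
    have e3 : ∑ y ∈ A, |(P ^ t) x y - π y| + ∑ y ∈ Aᶜ, |(P ^ t) x y - π y| =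
      ∑ y, |(P ^ t) x y - π y| := Finset.sum_add_sum_compl _ _
    have e4 : -∑ y ∈ A, ((P ^ t) x y - π y) ≤ ∑ y ∈ A, |(P ^ t) x y - π y| := by
      rw [← Finset.sum_neg_distrib]; exact Finset.sum_le_sum fun y _ => neg_le_abs _
    have e5 : ∑ y ∈ Aᶜ, ((P ^ t) x y - π y) ≤ ∑ y ∈ Aᶜ, |(P ^ t) x y - π y| :=
      Finset.sum_le_sum fun y _ => le_abs_self _
    have e6 : ∑ y ∈ A, ((P ^ t) x y - π y) = ∑ y ∈ A, (P ^ t) x y - ∑ y ∈ A, π y :=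
      Finset.sum_sub_distrib _ _
    rw [tvDist, ← e3]
    linarith
  linarith [h1 t x, tvDist_le_dTV P π t x]
end Chains


/-! ### Upper bound on the mixing time through a hitting-time potential -/

section Upper

open scoped Matrix

/-- survival function: the probability that the chain avoids `z` up to time `t` -/
def survive (P : Matrix V V ℝ) (z : V) : ℕ → V → ℝ
  | 0 => fun x => if x = z then 0 else 1
  | t + 1 => fun x => if x = z then 0 else (P *ᵥ survive P z t) x

lemma survive_self (P : Matrix V V ℝ) (z : V) (t : ℕ) : survive P z t z = 0 := by
  cases t <;> simp [survive]

lemma IsStoch.survive_nonneg {P : Matrix V V ℝ} (h : IsStoch P) (z : V) (t : ℕ) (x : V) :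
    0 ≤ survive P z t x := by
  induction t generalizing x with
  | zero => simp only [survive]; split_ifs <;> norm_num
  | succ t ih =>
    simp only [survive]; split_ifs
    · exact le_rfl
    · exact Finset.sum_nonneg fun y _ => mul_nonneg (h.1 x y) (ih y)

lemma IsStoch.survive_le {P : Matrix V V ℝ} (h : IsStoch P) {z : V} {φ : V → ℝ} {lam : ℝ}
    (h1 : ∀ x, 1 ≤ φ x) (hlam : lam ≤ 1) (hP : ∀ x, x ≠ z → (P *ᵥ φ) x ≤ (1 - lam) * φ x)
    (t : ℕ) (x : V) : survive P z t x ≤ (1 - lam) ^ t * φ x := by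
  have hp : ∀ t : ℕ, 0 ≤ (1 - lam) ^ t := fun t => pow_nonneg (by linarith) t
  have h0 : ∀ x, 0 ≤ φ x := fun x => zero_le_one.trans (h1 x)
  induction t generalizing x with
  | zero => simp only [survive, pow_zero, one_mul]; split_ifs; exacts [h0 x, h1 x]
  | succ t ih =>
    simp only [survive]; split_ifs with hx
    · exact mul_nonneg (hp _) (h0 x)
    · refine (h.mulVec_mono ih x).trans ?_
      have : (P *ᵥ fun x => (1 - lam) ^ t * φ x) x = (1 - lam) ^ t * (P *ᵥ φ) x := by
        simp only [Matrix.mulVec, dotProduct, Finset.mul_sum]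
        exact Finset.sum_congr rfl fun y _ => by ring
      rw [this, pow_succ, mul_assoc]
      exact mul_le_mul_of_nonneg_left (hP x hx) (hp t)

/-- existence of the mean hitting time function of `z` -/
lemma IsStoch.exists_hitting {P : Matrix V V ℝ} (h : IsStoch P) {z : V} {φ : V → ℝ} {lam : ℝ}
    (h1 : ∀ x, 1 ≤ φ x) (hl0 : 0 < lam) (hlam : lam ≤ 1)
    (hP : ∀ x, x ≠ z → (P *ᵥ φ) x ≤ (1 - lam) * φ x) :
    ∃ k : V → ℝ, k z = 0 ∧ (∀ x, 0 ≤ k x) ∧ (∀ x, k x ≤ φ x / lam) ∧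
      ∀ x, x ≠ z → k x - (P *ᵥ k) x = 1 := by
  have hg : Summable fun t : ℕ => (1 - lam) ^ t :=
    summable_geometric_of_lt_one (by linarith) (by linarith)
  have hs : ∀ x, Summable fun t => survive P z t x := fun x =>
    Summable.of_nonneg_of_le (fun t => h.survive_nonneg z t x)
      (fun t => h.survive_le h1 hlam hP t x) (hg.mul_right _)
  refine ⟨fun x => ∑' t, survive P z t x, ?_, ?_, ?_, ?_⟩
  · simp [survive_self]
  · exact fun x => tsum_nonneg fun t => h.survive_nonneg z t x
  · intro x
    refine ((hs x).tsum_le_tsum (fun t => h.survive_le h1 hlam hP t x) (hg.mul_right _)).trans ?_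
    rw [tsum_mul_right, tsum_geometric_of_lt_one (by linarith) (by linarith)]
    rw [sub_sub_cancel, div_eq_mul_inv, mul_comm]
  · intro x hx
    have e1 : ∀ t, survive P z (t + 1) x = ∑ y, P x y * survive P z t y := fun t => by
      simp [survive, hx, Matrix.mulVec, dotProduct]
    have e2 : (P *ᵥ fun x => ∑' t, survive P z t x) x
        = ∑' t, ∑ y, P x y * survive P z t y := by
      rw [Summable.tsum_finsetSum fun y _ => (hs y).mul_left _]
      simp only [Matrix.mulVec, dotProduct, tsum_mul_left]
    rw [e2]
    simp only [(hs x).tsum_eq_zero_add, e1]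
    simp [survive, hx]

/-- distance to stationarity from a point with small mean hitting time -/
lemma LazyRev.tvDist_le_sqrt {P : Matrix V V ℝ} {π : V → ℝ} (h : LazyRev P π) {z : V}
    {k : V → ℝ} (hz : k z = 0) (hk : ∀ x, x ≠ z → k x - (P *ᵥ k) x = 1)
    {m : ℕ} (hm : 0 < m) :
    tvDist ((P ^ m) z) π ≤ √((∑ x, π x * k x) / m) / 2 := by
  have hpz := h.prob.1 z
  set U : V → ℝ := fun x => (if x = z then 1 / π z else 0) - 1 with hU
  have hkU : k - P *ᵥ k = -U := by
    funext x
    by_cases hx : x = z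
    · subst hx
      have e1 : ∑ y, π y * (k y - (P *ᵥ k) y) = 0 := by
        simp only [mul_sub, Finset.sum_sub_distrib, sum_pi_mulVec h.rev h.stoch, sub_self]
      rw [← Finset.add_sum_erase _ _ (Finset.mem_univ x)] at e1
      have e2 : ∑ y ∈ Finset.univ.erase x, π y * (k y - (P *ᵥ k) y)
          = ∑ y ∈ Finset.univ.erase x, π y :=
        Finset.sum_congr rfl fun y hy => by rw [hk y (Finset.ne_of_mem_erase hy), mul_one]
      have e3 := Finset.add_sum_erase Finset.univ π (Finset.mem_univ x)
      rw [h.prob.2] at e3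
      rw [e2] at e1
      simp only [hU, Pi.neg_apply, Pi.sub_apply, if_true]
      field_simp
      linarith
    · simp [hU, hx, hk x hx]
  set a : ℕ → ℝ := fun j => ip π U (P ^ j *ᵥ U) with ha
  have hUm : ∀ j x, (P ^ j *ᵥ U) x = (P ^ j) z x / π x - 1 := by
    intro j x
    have : (P ^ j *ᵥ U) x = (P ^ j) x z / π z - ∑ y, (P ^ j) x y := by
      simp only [Matrix.mulVec, dotProduct, hU, mul_sub, Finset.sum_sub_distrib, mul_one]
      simp [div_eq_mul_inv]
    rw [this, (h.stoch.pow j).2 x]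
    have := h.rev.pow j x z
    have hpx := h.prob.1 x
    field_simp
    linarith
  have haeven : ∀ i, a (2 * i) = ip π (P ^ i *ᵥ U) (P ^ i *ᵥ U) := by
    intro i
    rw [ha, ip_pow_mulVec h.rev, Matrix.mulVec_mulVec, ← pow_add, two_mul]
  have haodd : ∀ i, 0 ≤ a (2 * i + 1) := by
    intro i
    have : a (2 * i + 1) = ip π (P ^ i *ᵥ U) (P *ᵥ (P ^ i *ᵥ U)) := by
      have e : P ^ (2 * i + 1) *ᵥ U = P ^ i *ᵥ (P *ᵥ (P ^ i *ᵥ U)) := by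
        rw [Matrix.mulVec_mulVec, Matrix.mulVec_mulVec, ← pow_succ, ← pow_add]
        congr 2; omega
      rw [ip_pow_mulVec h.rev, ← e]
    rw [this]; exact h.ip_mulVec_nonneg _
  have hanti : Antitone fun i => a (2 * i) := by
    refine antitone_nat_of_succ_le fun i => ?_
    rw [haeven, haeven, pow_succ', ← Matrix.mulVec_mulVec]
    exact h.ip_contract _
  have htel : ∀ n : ℕ, ∑ j ∈ Finset.range n, a j = ip π U (P ^ n *ᵥ k) - ip π U k := by
    intro n
    induction n with
    | zero => simp
    | succ n ih =>
      rw [Finset.sum_range_succ, ih]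
      have : P ^ (n + 1) *ᵥ k = P ^ n *ᵥ k + P ^ n *ᵥ U := by
        rw [pow_succ, ← Matrix.mulVec_mulVec, ← Matrix.mulVec_add]
        congr 1
        rw [sub_eq_iff_eq_add] at hkU
        nth_rewrite 2 [hkU]
        abel
      rw [this]
      simp only [ha, ip, Pi.add_apply, mul_add, Finset.sum_add_distrib]
      ring
  have hUk : ip π U k = -∑ x, π x * k x := by
    have : ∀ x, π x * U x * k x = -(π x * k x) := fun x => by
      by_cases hx : x = z
      · subst hx; simp [hz]
      · simp [hU, hx]
    simp only [ip, this, Finset.sum_neg_distrib]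
  have hneg : ip π U (P ^ (2 * m) *ᵥ k) ≤ 0 := by
    have e : U = P *ᵥ k - k := by rw [← neg_sub, hkU, neg_neg]
    have e1 : ip π U (P ^ (2 * m) *ᵥ k) = ip π (P *ᵥ (P ^ m *ᵥ k)) (P ^ m *ᵥ k)
        - ip π (P ^ m *ᵥ k) (P ^ m *ᵥ k) := by
      have e2 : ip π U (P ^ (2 * m) *ᵥ k) = ip π (P ^ m *ᵥ U) (P ^ m *ᵥ k) := by
        rw [ip_pow_mulVec h.rev, Matrix.mulVec_mulVec, ← pow_add, two_mul]
      rw [e2, e, Matrix.mulVec_sub, Matrix.mulVec_mulVec, Matrix.mulVec_mulVec, ← pow_succ,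
        ← pow_succ']
      simp only [ip, Pi.sub_apply, mul_sub, sub_mul, Finset.sum_sub_distrib]
    rw [e1, ip_comm]
    have := h.energy (P ^ m *ᵥ k)
    have h0 : 0 ≤ (∑ x, ∑ y, π x * P x y * ((P ^ m *ᵥ k) x - (P ^ m *ᵥ k) y) ^ 2) / 2 :=
      div_nonneg (Finset.sum_nonneg fun x _ => Finset.sum_nonneg fun y _ =>
        mul_nonneg (mul_nonneg (h.prob.1 x).le (h.stoch.1 x y)) (sq_nonneg _)) (by norm_num)
    linarith
  have hsum : (m : ℝ) * a (2 * m) ≤ ∑ j ∈ Finset.range (2 * m), a j := by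
    have key : ∀ n ≤ m, (n : ℝ) * a (2 * m) ≤ ∑ j ∈ Finset.range (2 * n), a j := by
      intro n
      induction n with
      | zero => simp
      | succ n ih =>
        intro hn
        rw [show 2 * (n + 1) = 2 * n + 1 + 1 by ring, Finset.sum_range_succ, Finset.sum_range_succ]
        have i1 := ih (by omega)
        have i2 := haodd n
        have i3 : a (2 * m) ≤ a (2 * n) := hanti (by omega : n ≤ m)
        push_cast
        linarith
    exact key m le_rfl
  have hmain : a (2 * m) ≤ (∑ x, π x * k x) / m := by
    rw [le_div_iff₀ (by exact_mod_cast hm)]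
    rw [htel, hUk] at hsum
    linarith
  have htv : tvDist ((P ^ m) z) π ≤ √(a (2 * m)) / 2 := by
    rw [tvDist]
    refine div_le_div_of_nonneg_right (Real.le_sqrt_of_sq_le ?_) (by norm_num)
    have e1 : ∑ x, |(P ^ m) z x - π x| = ∑ x, π x * |(P ^ m *ᵥ U) x| := by
      refine Finset.sum_congr rfl fun x _ => ?_
      have hpx := h.prob.1 x
      rw [hUm, ← abs_of_pos hpx, ← abs_mul, abs_of_pos hpx]
      congr 1; field_simp
    rw [e1, haeven]
    have cs := Finset.sum_mul_sq_le_sq_mul_sq Finset.univ (fun x => √(π x))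
      (fun x => √(π x) * |(P ^ m *ᵥ U) x|)
    have s1 : ∀ x, √(π x) * (√(π x) * |(P ^ m *ᵥ U) x|) = π x * |(P ^ m *ᵥ U) x| := fun x => by
      rw [← mul_assoc, Real.mul_self_sqrt (h.prob.1 x).le]
    have s2 : ∀ x, √(π x) ^ 2 = π x := fun x => Real.sq_sqrt (h.prob.1 x).le
    have s3 : ∀ x, (√(π x) * |(P ^ m *ᵥ U) x|) ^ 2 = π x * (P ^ m *ᵥ U) x * (P ^ m *ᵥ U) x :=
      fun x => by rw [mul_pow, s2, sq_abs]; ring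
    simp only [s1, s2, s3, h.prob.2, one_mul] at cs
    exact cs
  refine htv.trans ?_
  gcongr

/-- **Upper bound.** A bounded potential contracting off `z` controls the distance to
stationarity. -/
lemma LazyRev.upper {P : Matrix V V ℝ} {π : V → ℝ} (h : LazyRev P π) {z : V} {φ : V → ℝ}
    {lam B M : ℝ} (h1 : ∀ x, 1 ≤ φ x) (hB : ∀ x, φ x ≤ B) (hM : ∑ x, π x * φ x ≤ M)
    (hl0 : 0 < lam) (hlam : lam ≤ 1)
    (hP : ∀ x, x ≠ z → (P *ᵥ φ) x ≤ (1 - lam) * φ x) (t : ℕ) {u : ℕ} (hu : 0 < u) :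
    dTV P π (t + u) ≤ B * (1 - lam) ^ t + √(M / (lam * u)) / 2 := by
  obtain ⟨k, hz, hk0, hkφ, hk⟩ := h.stoch.exists_hitting h1 hl0 hlam hP
  have hup : (0 : ℝ) < u := by exact_mod_cast hu
  set ε := √(M / (lam * u)) / 2 with hε
  have hzε : ∀ j, u ≤ j → tvDist ((P ^ j) z) π ≤ ε := by
    intro j hj
    have hj0 : 0 < j := by omega
    refine (h.tvDist_le_sqrt hz hk hj0).trans ?_
    rw [hε]
    refine div_le_div_of_nonneg_right (Real.sqrt_le_sqrt ?_) (by norm_num)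
    have e1 : ∑ x, π x * k x ≤ M / lam := by
      rw [le_div_iff₀ hl0, Finset.sum_mul]
      refine le_trans (Finset.sum_le_sum fun x _ => ?_) hM
      have := hkφ x
      rw [le_div_iff₀ hl0] at this
      rw [mul_assoc]
      exact mul_le_mul_of_nonneg_left this (h.prob.1 x).le
    have e2 : (u : ℝ) ≤ j := by exact_mod_cast hj
    have e0 : 0 ≤ ∑ x, π x * k x :=
      Finset.sum_nonneg fun x _ => mul_nonneg (h.prob.1 x).le (hk0 x)
    rw [← div_div]
    exact div_le_div₀ (e0.trans e1) e1 hup e2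
  have key : ∀ t x, tvDist ((P ^ (t + u)) x) π ≤ (1 - lam) ^ t * φ x + ε := by
    have hε0 : 0 ≤ ε := by positivity
    intro t
    induction t with
    | zero =>
      intro x
      have := h.tvDist_le_one (0 + u) x
      have := h1 x
      rw [pow_zero]; linarith
    | succ t ih =>
      intro x
      by_cases hx : x = z
      · subst hx
        have := hzε (t + 1 + u) (by omega)
        have : 0 ≤ (1 - lam) ^ (t + 1) * φ x :=
          mul_nonneg (pow_nonneg (by linarith) _) (zero_le_one.trans (h1 x))
        linarith
      · rw [show t + 1 + u = t + u + 1 by ring]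
        refine (h.tvDist_succ_le _ x).trans ?_
        calc _ ≤ ∑ y, P x y * ((1 - lam) ^ t * φ y + ε) := Finset.sum_le_sum fun y _ =>
              mul_le_mul_of_nonneg_left (ih y) (h.stoch.1 x y)
          _ = (1 - lam) ^ t * (P *ᵥ φ) x + ε := by
              simp only [mul_add, Finset.sum_add_distrib, ← Finset.sum_mul, h.stoch.2 x,
                Matrix.mulVec, dotProduct, Finset.mul_sum, one_mul]
              congr 1
              exact Finset.sum_congr rfl fun y _ => by ring
          _ ≤ (1 - lam) ^ t * ((1 - lam) * φ x) + ε := by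
              have := mul_le_mul_of_nonneg_left (hP x hx)
                (pow_nonneg (by linarith : (0:ℝ) ≤ 1 - lam) t)
              linarith
          _ = _ := by ring
  refine h.dTV_le fun x => (key t x).trans ?_
  have := mul_le_mul_of_nonneg_left (hB x) (pow_nonneg (by linarith : (0:ℝ) ≤ 1 - lam) t)
  linarith

end Upper


/-! ### Relaxation time -/

section Relaxation

open scoped Matrix

lemma LazyRev.abs_eigenvalue_pow_le {P : Matrix V V ℝ} {π : V → ℝ} (h : LazyRev P π) {μ : ℝ}
    (hμ : μ ≠ 1) {f : V → ℝ} (hf : f ≠ 0) (hPf : P *ᵥ f = μ • f) (t : ℕ) :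
    |μ| ^ t ≤ 2 * dTV P π t := by
  have h0 : ∑ x, π x * f x = 0 := by
    have e := sum_pi_mulVec h.rev h.stoch f
    rw [hPf] at e
    have e1 : ∑ x, π x * (μ • f) x = μ * ∑ x, π x * f x := by
      rw [Finset.mul_sum]
      exact Finset.sum_congr rfl fun x _ => by simp; ring
    rw [e1] at e
    have : (μ - 1) * ∑ x, π x * f x = 0 := by linarith
    exact (mul_eq_zero.1 this).resolve_left (sub_ne_zero.2 hμ)
  have hpow : ∀ x, (P ^ t *ᵥ f) x = μ ^ t * f x := by
    induction t with
    | zero => simp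
    | succ n ih =>
      intro x
      rw [pow_succ, ← Matrix.mulVec_mulVec, hPf, Matrix.mulVec_smul, Pi.smul_apply, ih]
      simp only [smul_eq_mul]; ring
  obtain ⟨x, -, hx⟩ := Finset.exists_max_image Finset.univ (fun x => |f x|)
    (by have := h.nonempty; exact Finset.univ_nonempty)
  have hfx : 0 < |f x| := by
    obtain ⟨y, hy⟩ := Function.ne_iff.1 hf
    exact lt_of_lt_of_le (abs_pos.2 hy) (hx y (Finset.mem_univ y))
  have e1 : μ ^ t * f x = ∑ y, ((P ^ t) x y - π y) * f y := by
    simp only [sub_mul, Finset.sum_sub_distrib, h0, sub_zero]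
    exact (hpow x).symm
  have e2 : |μ| ^ t * |f x| ≤ (∑ y, |(P ^ t) x y - π y|) * |f x| := by
    rw [← abs_pow, ← abs_mul, e1, Finset.sum_mul]
    refine (Finset.abs_sum_le_sum_abs _ _).trans (Finset.sum_le_sum fun y _ => ?_)
    rw [abs_mul]
    exact mul_le_mul_of_nonneg_left (hx y (Finset.mem_univ y)) (abs_nonneg _)
  have e3 := le_of_mul_le_mul_right e2 hfx
  have e4 := tvDist_le_dTV P π t x
  rw [tvDist] at e4
  linarith

/-- Rayleigh quotient bound on the second eigenvalue -/
lemma LazyRev.exists_eigenvalue_ge {P : Matrix V V ℝ} {π : V → ℝ} (h : LazyRev P π)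
    (hconn : ∀ f : V → ℝ, P *ᵥ f = f → ∀ x y, f x = f y) {g : V → ℝ}
    (hg0 : ∑ x, π x * g x = 0) (hg : 0 < ip π g g) {r : ℝ} (hr : r * ip π g g ≤ ip π g (P *ᵥ g)) :
    ∃ μ : ℝ, μ ≠ 1 ∧ r ≤ μ ∧ ∃ f : V → ℝ, f ≠ 0 ∧ P *ᵥ f = μ • f := by
  have hq : ∀ x, 0 < √(π x) := fun x => Real.sqrt_pos.2 (h.prob.1 x)
  have hqq : ∀ x, √(π x) * √(π x) = π x := fun x => Real.mul_self_sqrt (h.prob.1 x).le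
  set A : Matrix V V ℝ := Matrix.of fun x y => √(π x) * P x y / √(π y) with hAdef
  have hsym : ∀ x y, A x y = A y x := by
    intro x y
    simp only [hAdef, Matrix.of_apply]
    rw [div_eq_div_iff (hq y).ne' (hq x).ne', mul_right_comm, hqq, mul_right_comm, hqq]
    exact h.rev x y
  have hA : A.IsHermitian := by
    ext x y
    simp only [Matrix.conjTranspose_apply, star_trivial]
    exact hsym y x
  set b := hA.eigenvectorBasis with hb
  set G : EuclideanSpace ℝ V := WithLp.toLp 2 fun x => √(π x) * g x with hG
  set AG : EuclideanSpace ℝ V := WithLp.toLp 2 fun x => √(π x) * (P *ᵥ g) x with hAG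
  have hin : ∀ u v : EuclideanSpace ℝ V, inner ℝ u v = ∑ x, u x * v x := by
    intro u v
    simp [PiLp.inner_apply, mul_comm]
  have hbi : ∀ i x, ∑ y, A x y * b i y = hA.eigenvalues i * b i x := by
    intro i x
    have := congrFun (hA.mulVec_eigenvectorBasis i) x
    simpa [Matrix.mulVec, dotProduct] using this
  have hAGx : ∀ x, AG x = ∑ y, A x y * G y := by
    intro x
    simp only [hAG, hG, hAdef, Matrix.of_apply, Matrix.mulVec, dotProduct, Finset.mul_sum]
    refine Finset.sum_congr rfl fun y _ => ?_
    have := (hq y).ne'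
    field_simp
  have hcoef : ∀ i, inner ℝ (b i) AG = hA.eigenvalues i * inner ℝ (b i) G := by
    intro i
    rw [hin, hin, Finset.mul_sum]
    simp only [hAGx, Finset.mul_sum]
    rw [Finset.sum_comm]
    refine Finset.sum_congr rfl fun y _ => ?_
    rw [← mul_assoc, ← hbi, Finset.sum_mul]
    refine Finset.sum_congr rfl fun x _ => ?_
    rw [hsym y x]; ring
  have hGG : ip π g g = ∑ i, inner ℝ (b i) G ^ 2 := by
    have e1 : ip π g g = inner ℝ G G := by
      rw [hin]
      refine Finset.sum_congr rfl fun x _ => ?_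
      simp only [hG]
      linear_combination (- g x * g x) * hqq x
    rw [e1, ← b.sum_inner_mul_inner]
    refine Finset.sum_congr rfl fun i _ => ?_
    rw [real_inner_comm, pow_two]
  have hGAG : ip π g (P *ᵥ g) = ∑ i, hA.eigenvalues i * inner ℝ (b i) G ^ 2 := by
    have e1 : ip π g (P *ᵥ g) = inner ℝ G AG := by
      rw [hin]
      refine Finset.sum_congr rfl fun x _ => ?_
      simp only [hG, hAG]
      linear_combination (- g x * (P *ᵥ g) x) * hqq x
    rw [e1, ← b.sum_inner_mul_inner]
    refine Finset.sum_congr rfl fun i _ => ?_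
    rw [hcoef, real_inner_comm]; ring
  have hex : ∃ i, inner ℝ (b i) G ≠ 0 ∧ r ≤ hA.eigenvalues i := by
    by_contra! hcon
    have hle : ∀ i, hA.eigenvalues i * inner ℝ (b i) G ^ 2 ≤ r * inner ℝ (b i) G ^ 2 := by
      intro i
      by_cases hi : inner ℝ (b i) G = 0
      · simp [hi]
      · exact mul_le_mul_of_nonneg_right (hcon i hi).le (sq_nonneg _)
    have : ∃ i, inner ℝ (b i) G ≠ 0 := by
      by_contra! h0
      simp [hGG, h0] at hg
    obtain ⟨i, hi⟩ := this
    have hlt : ∑ i, hA.eigenvalues i * inner ℝ (b i) G ^ 2 < ∑ i, r * inner ℝ (b i) G ^ 2 :=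
      Finset.sum_lt_sum (fun i _ => hle i) ⟨i, Finset.mem_univ i,
        mul_lt_mul_of_pos_right (hcon i hi) (by positivity)⟩
    rw [← Finset.mul_sum, ← hGG, ← hGAG] at hlt
    linarith
  obtain ⟨i, hi0, hir⟩ := hex
  have hPf : P *ᵥ (fun x => b i x / √(π x)) = hA.eigenvalues i • fun x => b i x / √(π x) := by
    funext x
    have e := hbi i x
    simp only [Pi.smul_apply, smul_eq_mul, Matrix.mulVec, dotProduct]
    rw [← mul_div_assoc, eq_div_iff (hq x).ne', ← e, Finset.sum_mul]
    refine Finset.sum_congr rfl fun y _ => ?_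
    simp only [hAdef, Matrix.of_apply]
    ring
  have hsum : inner ℝ (b i) G = ∑ x, π x * g x * (b i x / √(π x)) := by
    rw [hin]
    refine Finset.sum_congr rfl fun x _ => ?_
    simp only [hG]
    have := (hq x).ne'
    field_simp
    rw [pow_two, hqq]
    ring
  refine ⟨hA.eigenvalues i, ?_, hir, _, ?_, hPf⟩
  · intro h1
    rw [h1, one_smul] at hPf
    have hc := hconn _ hPf
    obtain ⟨x0⟩ := h.nonempty
    apply hi0
    rw [hsum]
    simp only [fun x => hc x x0, ← Finset.sum_mul, hg0, zero_mul]
  · intro h0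
    apply hi0
    rw [hsum]
    refine Finset.sum_eq_zero fun x _ => ?_
    have := congrFun h0 x
    simp only [Pi.zero_apply] at this
    rw [this, mul_zero]

lemma LazyRev.trel_bounds {P : Matrix V V ℝ} {π : V → ℝ} (h : LazyRev P π)
    (hconn : ∀ f : V → ℝ, P *ᵥ f = f → ∀ x y, f x = f y) {g : V → ℝ}
    (hg0 : ∑ x, π x * g x = 0) (hg : 0 < ip π g g) {δ : ℝ}
    (hr : ip π g g - ip π g (P *ᵥ g) ≤ δ * ip π g g) {t : ℕ} (ht : dTV P π t ≤ 1 / 4) :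
    1 / δ ≤ trel P ∧ trel P ≤ 2 * t := by
  obtain ⟨μ, hμ1, hμr, hμf⟩ := h.exists_eigenvalue_ge hconn hg0 hg (r := 1 - δ) (by linarith)
  have hub : ∀ ν ∈ {μ : ℝ | μ ≠ 1 ∧ ∃ f : V → ℝ, f ≠ 0 ∧ P.mulVec f = μ • f},
      0 < t ∧ ν ≤ 1 - 1 / (2 * t) := by
    rintro ν ⟨hν, f, hf, hPf⟩
    have e := h.abs_eigenvalue_pow_le hν hf hPf t
    have ht0 : 0 < t := by
      rcases Nat.eq_zero_or_pos t with rfl | h0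
      · rw [pow_zero] at e; linarith
      · exact h0
    have htr : (1 : ℝ) ≤ t := by exact_mod_cast ht0
    refine ⟨ht0, ?_⟩
    by_contra! hlt
    have hb := one_add_mul_le_pow (a := -(1 / (2 * (t : ℝ)))) (by
      have : 1 / (2 * (t : ℝ)) ≤ 1 := by
        rw [div_le_one (by positivity)]; linarith
      linarith) t
    have h2 : (1 : ℝ) + t * -(1 / (2 * (t : ℝ))) = 1 / 2 := by
      have : (t : ℝ) ≠ 0 := by positivity
      field_simp; norm_num
    rw [h2, ← sub_eq_add_neg] at hb
    have h3 : 0 ≤ 1 - 1 / (2 * (t : ℝ)) := by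
      have : 1 / (2 * (t : ℝ)) ≤ 1 := by
        rw [div_le_one (by positivity)]; linarith
      linarith
    have h4 : (1 - 1 / (2 * (t : ℝ))) ^ t < |ν| ^ t :=
      pow_lt_pow_left₀ (hlt.trans_le (le_abs_self _)) h3 ht0.ne'
    linarith
  have hμmem : μ ∈ {μ : ℝ | μ ≠ 1 ∧ ∃ f : V → ℝ, f ≠ 0 ∧ P.mulVec f = μ • f} := ⟨hμ1, hμf⟩
  have ht0 : (0 : ℝ) < t := by exact_mod_cast (hub μ hμmem).1
  have hle : lam2 P ≤ 1 - 1 / (2 * t) := csSup_le ⟨μ, hμmem⟩ fun ν hν => (hub ν hν).2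
  have hge : 1 - δ ≤ lam2 P := hμr.trans (le_csSup ⟨_, fun ν hν => (hub ν hν).2⟩ hμmem)
  have hpos : 0 < 1 / (2 * (t : ℝ)) := by positivity
  constructor
  · exact one_div_le_one_div_of_le (by linarith) (by linarith)
  · rw [trel, div_le_iff₀ (by linarith)]
    have : 2 * (t : ℝ) * (1 / (2 * t)) = 1 := by field_simp
    have h2 : 2 * (t : ℝ) * (1 / (2 * t)) ≤ 2 * t * (1 - lam2 P) :=
      mul_le_mul_of_nonneg_left (by linarith) (by positivity)
    linarith

end Relaxation


/-! ### Networks given by a list of edges -/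

section Networks

open scoped Matrix

/-- a simple graph presented by an injective list of edges -/
structure Net (V I : Type) where
  /-- first endpoint -/
  s : I → V
  /-- second endpoint -/
  t : I → V
  ne : ∀ i, s i ≠ t i
  inj : ∀ i j, (s i = s j ∧ t i = t j) ∨ (s i = t j ∧ t i = s j) → i = j

variable {I : Type} [Fintype I] {W : Type} [Fintype W] [DecidableEq W]

/-- renaming of the vertices -/
def Net.map (E : Net V I) (e : V ≃ W) : Net W I where
  s i := e (E.s i)
  t i := e (E.t i)
  ne i h := E.ne i (e.injective h)
  inj i j h := E.inj i j (by simpa using h)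

/-- edge weights as a function of two vertices -/
def Net.ew (E : Net V I) (c : I → ℝ) (u v : V) : ℝ :=
  ∑ i, c i * ((if E.s i = u ∧ E.t i = v then 1 else 0) + (if E.s i = v ∧ E.t i = u then 1 else 0))

/-- the underlying graph -/
def Net.graph (E : Net V I) : SimpleGraph V where
  Adj u v := ∃ i, (E.s i = u ∧ E.t i = v) ∨ (E.s i = v ∧ E.t i = u)
  symm := ⟨fun _ _ ⟨i, h⟩ => ⟨i, h.symm⟩⟩
  loopless := ⟨fun _ ⟨i, h⟩ => E.ne i (by rcases h with h | h <;> rw [h.1, h.2])⟩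

lemma Net.adj (E : Net V I) (i : I) : E.graph.Adj (E.s i) (E.t i) := ⟨i, Or.inl ⟨rfl, rfl⟩⟩

lemma Net.ew_symm (E : Net V I) (c : I → ℝ) (u v : V) : E.ew c u v = E.ew c v u :=
  Finset.sum_congr rfl fun i _ => by rw [add_comm]

lemma Net.ew_eq (E : Net V I) (c : I → ℝ) {u v : V} {i : I}
    (h : (E.s i = u ∧ E.t i = v) ∨ (E.s i = v ∧ E.t i = u)) : E.ew c u v = c i := by
  rw [Net.ew, Finset.sum_eq_single i]
  · have := E.ne i
    rcases h with ⟨rfl, rfl⟩ | ⟨rfl, rfl⟩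
    · simp [this]
    · simp [this]
  · intro j _ hj
    have h1 : ¬ (E.s j = u ∧ E.t j = v) := by
      rintro ⟨h1, h2⟩
      refine hj (E.inj j i ?_)
      rw [h1, h2]
      rcases h with ⟨h3, h4⟩ | ⟨h3, h4⟩
      · exact Or.inl ⟨h3.symm, h4.symm⟩
      · exact Or.inr ⟨h4.symm, h3.symm⟩
    have h2 : ¬ (E.s j = v ∧ E.t j = u) := by
      rintro ⟨h1, h2⟩
      refine hj (E.inj j i ?_)
      rw [h1, h2]
      rcases h with ⟨h3, h4⟩ | ⟨h3, h4⟩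
      · exact Or.inr ⟨h4.symm, h3.symm⟩
      · exact Or.inl ⟨h3.symm, h4.symm⟩
    rw [if_neg h1, if_neg h2]; ring
  · simp

lemma Net.ew_eq_zero (E : Net V I) (c : I → ℝ) {u v : V} (h : ¬ E.graph.Adj u v) :
    E.ew c u v = 0 := by
  refine Finset.sum_eq_zero fun i _ => ?_
  rw [if_neg fun h1 => h ⟨i, Or.inl h1⟩, if_neg fun h1 => h ⟨i, Or.inr h1⟩]; ring

lemma Net.goodWeights (E : Net V I) {c : I → ℝ} (hc : ∀ i, 0 < c i) :
    GoodWeights E.graph (E.ew c) := by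
  refine ⟨E.ew_symm c, ?_, fun u v h => E.ew_eq_zero c h⟩
  rintro u v ⟨i, hi⟩
  rw [E.ew_eq c hi]; exact hc i

lemma Net.ew_nonneg (E : Net V I) {c : I → ℝ} (hc : ∀ i, 0 < c i) (u v : V) : 0 ≤ E.ew c u v := by
  by_cases h : E.graph.Adj u v
  · exact ((E.goodWeights hc).2.1 u v h).le
  · rw [E.ew_eq_zero c h]

lemma mul_ite_add_ite (a b a' b' : Prop) [Decidable a] [Decidable b] [Decidable a'] [Decidable b']
    (x y : ℝ) : x * (y * ((if a ∧ b then 1 else 0) + (if a' ∧ b' then 1 else 0)))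
      = y * ((if a then if b then x else 0 else 0) + (if b' then if a' then x else 0 else 0)) := by
  by_cases a <;> by_cases b <;> by_cases a' <;> by_cases b' <;> simp [*] <;> ring

lemma Net.sum_ew (E : Net V I) (c : I → ℝ) (F : V → V → ℝ) :
    ∑ u, ∑ v, F u v * E.ew c u v = ∑ i, c i * (F (E.s i) (E.t i) + F (E.t i) (E.s i)) := by
  simp only [Net.ew, Finset.mul_sum]
  rw [Finset.sum_congr rfl fun u _ => Finset.sum_comm, Finset.sum_comm]
  refine Finset.sum_congr rfl fun i _ => ?_
  have e1 : ∀ u v, F u v * (c i * ((if E.s i = u ∧ E.t i = v then 1 else 0) +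
      (if E.s i = v ∧ E.t i = u then 1 else 0)))
      = c i * ((if E.s i = u then if E.t i = v then F u v else 0 else 0)
        + (if E.t i = u then if E.s i = v then F u v else 0 else 0)) := by
    intro u v
    exact mul_ite_add_ite _ _ _ _ _ _
  simp only [e1, ← Finset.mul_sum, Finset.sum_add_distrib]
  simp

/-- total weight at a vertex -/
def Net.cs (E : Net V I) (c : I → ℝ) (v : V) : ℝ := ∑ x, E.ew c v x

lemma Net.sum_cs (E : Net V I) (c : I → ℝ) (η : V → ℝ) :
    ∑ v, η v * E.cs c v = ∑ i, c i * (η (E.s i) + η (E.t i)) := by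
  rw [← E.sum_ew c fun u _ => η u]
  simp only [Net.cs, Finset.mul_sum]

lemma Net.sum_cs_one (E : Net V I) (c : I → ℝ) : ∑ v, E.cs c v = 2 * ∑ i, c i := by
  have := E.sum_cs c fun _ => 1
  simp only [one_mul] at this
  rw [this, Finset.mul_sum]
  exact Finset.sum_congr rfl fun i _ => by ring

/-- every vertex is covered by an edge -/
def Net.Covers (E : Net V I) : Prop := ∀ v, ∃ i, E.s i = v ∨ E.t i = v

lemma Net.cs_pos (E : Net V I) {c : I → ℝ} (hc : ∀ i, 0 < c i) (hcov : E.Covers) (v : V) :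
    0 < E.cs c v := by
  obtain ⟨i, hi⟩ := hcov v
  have : ∃ x, 0 < E.ew c v x := by
    rcases hi with rfl | rfl
    · exact ⟨E.t i, by rw [E.ew_eq c (Or.inl ⟨rfl, rfl⟩)]; exact hc i⟩
    · exact ⟨E.s i, by rw [E.ew_eq c (Or.inr ⟨rfl, rfl⟩)]; exact hc i⟩
  obtain ⟨x, hx⟩ := this
  exact hx.trans_le (Finset.single_le_sum (f := fun x => E.ew c v x)
    (fun y _ => E.ew_nonneg hc v y) (Finset.mem_univ x))

lemma Net.ew_self (E : Net V I) (c : I → ℝ) (v : V) : E.ew c v v = 0 :=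
  E.ew_eq_zero c (SimpleGraph.irrefl _)

lemma Net.wSta_eq (E : Net V I) (c : I → ℝ) (v : V) :
    wSta (E.ew c) v = E.cs c v / (2 * ∑ i, c i) := by
  rw [← E.sum_cs_one]; rfl

lemma Net.wMat_apply (E : Net V I) (c : I → ℝ) (u v : V) :
    wMat (E.ew c) u v = if u = v then 1 / 2 else E.ew c u v / (2 * E.cs c u) := rfl

lemma Net.sum_c_pos (E : Net V I) [Nonempty V] {c : I → ℝ} (hc : ∀ i, 0 < c i) (hcov : E.Covers) :
    0 < ∑ i, c i := by
  obtain ⟨v⟩ := (inferInstance : Nonempty V)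
  obtain ⟨i, -⟩ := hcov v
  exact Finset.sum_pos (fun i _ => hc i) ⟨i, Finset.mem_univ i⟩

lemma Net.lazyRev (E : Net V I) [Nonempty V] {c : I → ℝ} (hc : ∀ i, 0 < c i) (hcov : E.Covers) :
    LazyRev (wMat (E.ew c)) (wSta (E.ew c)) := by
  have hcs := E.cs_pos hc hcov
  have hC := E.sum_c_pos hc hcov
  refine ⟨⟨fun u v => ?_, fun u => ?_⟩, ⟨fun v => ?_, ?_⟩, fun u v => ?_, fun v => ?_⟩
  · rw [E.wMat_apply]
    split_ifs
    · norm_num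
    · exact div_nonneg (E.ew_nonneg hc u v) (by have := hcs u; positivity)
  · have e : ∀ v, wMat (E.ew c) u v = (if u = v then 1 / 2 else 0) + E.ew c u v / (2 * E.cs c u) := by
      intro v
      rw [E.wMat_apply]
      split_ifs with h
      · subst h; rw [E.ew_self]; simp
      · simp
    simp only [e, Finset.sum_add_distrib, ← Finset.sum_div]
    have := (hcs u).ne'
    rw [show ∑ v, E.ew c u v = E.cs c u from rfl]
    simp
    field_simp
    norm_num
  · rw [E.wSta_eq]; have := hcs v; positivity
  · simp only [E.wSta_eq, ← Finset.sum_div, E.sum_cs_one]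
    exact div_self (by positivity)
  · rw [E.wSta_eq, E.wSta_eq, E.wMat_apply, E.wMat_apply, E.ew_symm c v u]
    have h1 := (hcs u).ne'
    have h2 := (hcs v).ne'
    by_cases h : u = v
    · subst h; rfl
    · rw [if_neg h, if_neg (Ne.symm h)]
      field_simp
  · rw [E.wMat_apply, if_pos rfl]

lemma Net.laplacian (E : Net V I) {c : I → ℝ} (hc : ∀ i, 0 < c i) (hcov : E.Covers) (φ : V → ℝ)
    (v : V) : ∑ x, E.ew c v x * (φ v - φ x) = 2 * E.cs c v * (φ v - (wMat (E.ew c) *ᵥ φ) v) := by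
  have hv := (E.cs_pos hc hcov v).ne'
  have e : ∀ x, wMat (E.ew c) v x * φ x =
      (if v = x then 1 / 2 * φ x else 0) + E.ew c v x * φ x / (2 * E.cs c v) := by
    intro x
    rw [E.wMat_apply]
    split_ifs with h
    · subst h; rw [E.ew_self]; simp
    · simp; ring
  have e2 : (wMat (E.ew c) *ᵥ φ) v = 1 / 2 * φ v + (∑ x, E.ew c v x * φ x) / (2 * E.cs c v) := by
    simp only [Matrix.mulVec, dotProduct, e, Finset.sum_add_distrib, ← Finset.sum_div]
    simp
  rw [e2]
  simp only [mul_sub, Finset.sum_sub_distrib, ← Finset.sum_mul]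
  rw [show ∑ x, E.ew c v x = E.cs c v from rfl]
  field_simp
  ring

/-- weak formulation of a supersolution inequality -/
lemma Net.supersolution (E : Net V I) {c : I → ℝ} (hc : ∀ i, 0 < c i) (hcov : E.Covers)
    {φ : V → ℝ} {lam : ℝ} {v : V}
    (h : ∀ η : V → ℝ, (∀ x, 0 ≤ η x) → (∀ x, x ≠ v → η x = 0) →
      0 ≤ ∑ i, c i * ((η (E.s i) - η (E.t i)) * (φ (E.s i) - φ (E.t i))
        - 2 * lam * (η (E.s i) * φ (E.s i) + η (E.t i) * φ (E.t i)))) :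
    (wMat (E.ew c) *ᵥ φ) v ≤ (1 - lam) * φ v := by
  have h1 := h (fun x => if x = v then 1 else 0) (fun x => by split_ifs <;> norm_num)
    (fun x hx => if_neg hx)
  set η : V → ℝ := fun x => if x = v then 1 else 0 with hη
  have e1 : ∑ i, c i * ((η (E.s i) - η (E.t i)) * (φ (E.s i) - φ (E.t i)))
      = ∑ x, E.ew c v x * (φ v - φ x) := by
    have := E.sum_ew c fun u x => η u * (φ u - φ x)
    have e3 : ∀ i, c i * ((η (E.s i) - η (E.t i)) * (φ (E.s i) - φ (E.t i)))
      = c i * (η (E.s i) * (φ (E.s i) - φ (E.t i)) + η (E.t i) * (φ (E.t i) - φ (E.s i))) :=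
      fun i => by ring
    rw [Finset.sum_congr rfl fun i _ => e3 i, ← this]
    simp only [hη, ite_mul, one_mul, zero_mul, Finset.sum_ite_irrel,
      Finset.sum_const_zero, Finset.sum_ite_eq', Finset.mem_univ, if_true]
    exact Finset.sum_congr rfl fun x _ => by ring
  have e2 : ∑ i, c i * (η (E.s i) * φ (E.s i) + η (E.t i) * φ (E.t i)) = φ v * E.cs c v := by
    rw [← E.sum_cs c fun x => η x * φ x]
    simp [hη]
  have e4 : ∑ i, c i * ((η (E.s i) - η (E.t i)) * (φ (E.s i) - φ (E.t i))
        - 2 * lam * (η (E.s i) * φ (E.s i) + η (E.t i) * φ (E.t i)))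
      = ∑ i, c i * ((η (E.s i) - η (E.t i)) * (φ (E.s i) - φ (E.t i)))
        - 2 * lam * ∑ i, c i * (η (E.s i) * φ (E.s i) + η (E.t i) * φ (E.t i)) := by
    rw [Finset.mul_sum, ← Finset.sum_sub_distrib]
    exact Finset.sum_congr rfl fun i _ => by ring
  rw [e4, e1, e2, E.laplacian hc hcov] at h1
  have hv := E.cs_pos hc hcov v
  have h2 : 0 ≤ (2 * E.cs c v) * ((1 - lam) * φ v - (wMat (E.ew c) *ᵥ φ) v) := by
    linarith
  have := nonneg_of_mul_nonneg_right h2 (by positivity)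
  linarith

lemma Net.sum_wSta (E : Net V I) (c : I → ℝ) (η : V → ℝ) :
    ∑ v, wSta (E.ew c) v * η v = (∑ i, c i * (η (E.s i) + η (E.t i))) / (2 * ∑ i, c i) := by
  rw [← E.sum_cs, Finset.sum_div]
  exact Finset.sum_congr rfl fun v _ => by rw [E.wSta_eq]; ring

lemma Net.harmonic_const (E : Net V I) [Nonempty V] {c : I → ℝ} (hc : ∀ i, 0 < c i)
    (hcov : E.Covers) (hcon : E.graph.Connected) {f : V → ℝ}
    (hf : wMat (E.ew c) *ᵥ f = f) (x y : V) : f x = f y := by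
  have hL := E.lazyRev hc hcov
  have he := hL.energy f
  rw [hf, sub_self] at he
  have hz : ∑ x, ∑ y, wSta (E.ew c) x * wMat (E.ew c) x y * (f x - f y) ^ 2 = 0 := by linarith
  have hnn : ∀ x y, 0 ≤ wSta (E.ew c) x * wMat (E.ew c) x y * (f x - f y) ^ 2 := fun x y =>
    mul_nonneg (mul_nonneg (hL.prob.1 x).le (hL.stoch.1 x y)) (sq_nonneg _)
  have hadj : ∀ u v, E.graph.Adj u v → f u = f v := by
    intro u v huv
    have h1 := (Finset.sum_eq_zero_iff_of_nonneg fun x _ => Finset.sum_nonneg fun y _ =>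
      hnn x y).1 hz u (Finset.mem_univ u)
    have h2 := (Finset.sum_eq_zero_iff_of_nonneg fun y _ => hnn u y).1 h1 v (Finset.mem_univ v)
    have h3 : 0 < wMat (E.ew c) u v := by
      rw [E.wMat_apply, if_neg huv.ne]
      have := E.cs_pos hc hcov u
      have := (E.goodWeights hc).2.1 u v huv
      positivity
    have h4 := mul_pos (hL.prob.1 u) h3
    have h5 := (mul_eq_zero.1 h2).resolve_left h4.ne'
    have := pow_eq_zero_iff (two_ne_zero) |>.1 h5
    linarith
  obtain ⟨p⟩ := hcon.preconnected x y
  induction p with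
  | nil => rfl
  | cons h _ ih => rw [hadj _ _ h, ih]

lemma Net.deg_eq (E : Net V I) (v : V) : (deg E.graph v : ℝ) = E.cs (fun _ => 1) v := by
  classical
  have e : ∀ x, E.ew (fun _ => 1) v x = if E.graph.Adj v x then 1 else 0 := by
    intro x
    split_ifs with h
    · obtain ⟨i, hi⟩ := h; rw [E.ew_eq _ hi]
    · exact E.ew_eq_zero _ h
  simp only [deg, Net.cs, e, Finset.sum_boole, Nat.card_eq_fintype_card, Fintype.card_subtype]

lemma Net.degSta_eq (E : Net V I) : degSta E.graph = wSta (E.ew fun _ => 1) := by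
  funext v
  simp only [degSta, E.deg_eq]; rfl

lemma Net.walkMat_eq (E : Net V I) : walkMat E.graph = wMat (E.ew fun _ => 1) := by
  classical
  ext u v
  rw [E.wMat_apply, walkMat, Matrix.of_apply]
  by_cases h : u = v
  · simp [h]
  · rw [if_neg h, if_neg h]
    split_ifs with h1
    · rw [E.deg_eq]; obtain ⟨i, hi⟩ := h1; rw [E.ew_eq _ hi]
    · rw [E.ew_eq_zero _ h1, zero_div]

/-- the relaxation time from the bottleneck ratio of a set bounded by a single edge -/
lemma Net.trel_bounds (E : Net V I) [Nonempty V] (hcov : E.Covers) (hcon : E.graph.Connected)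
    (χ : V → ℝ) (hχ : ∀ v, χ v = 0 ∨ χ v = 1) {i₀ : I}
    (hb : ∀ i, i ≠ i₀ → χ (E.s i) = χ (E.t i)) {p : ℝ} (hp : 0 < p)
    (h1 : p * (2 * Fintype.card I) ≤ ∑ i, (χ (E.s i) + χ (E.t i)))
    (h2 : p * (2 * Fintype.card I) ≤ ∑ i, ((1 - χ (E.s i)) + (1 - χ (E.t i))))
    {t : ℕ} (ht : dTV (walkMat E.graph) (degSta E.graph) t ≤ 1 / 4) :
    4 * p ^ 2 * Fintype.card I ≤ trelG E.graph ∧ trelG E.graph ≤ 2 * t := by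
  classical
  have hc : ∀ i : I, (0 : ℝ) < (fun _ => (1 : ℝ)) i := fun _ => one_pos
  have hL := E.lazyRev hc hcov
  have hI : (0 : ℝ) < Fintype.card I := by simpa using E.sum_c_pos hc hcov
  rw [E.walkMat_eq, E.degSta_eq] at ht
  rw [trelG, E.walkMat_eq]
  set π := wSta (E.ew fun _ => (1 : ℝ)) with hπ
  set P := wMat (E.ew fun _ => (1 : ℝ)) with hP
  set m : ℝ := ∑ v, π v * χ v with hm
  have hm1 : p ≤ m := by
    rw [hm, hπ, E.sum_wSta, le_div_iff₀ (by simpa using hI)]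
    simpa using h1
  have hm2 : p ≤ 1 - m := by
    have e : 1 - m = ∑ v, π v * (1 - χ v) := by
      simp only [mul_sub, mul_one, Finset.sum_sub_distrib, hL.prob.2, hm]
    rw [e, hπ, E.sum_wSta, le_div_iff₀ (by simpa using hI)]
    simpa using h2
  set g : V → ℝ := fun v => χ v - m with hg
  have hg0 : ∑ v, π v * g v = 0 := by
    simp only [hg, mul_sub, Finset.sum_sub_distrib, ← Finset.sum_mul, hL.prob.2]
    rw [← hm]; ring
  have hgg : ip π g g = m * (1 - m) := by
    have e : ∀ v, π v * g v * g v = π v * χ v * (1 - 2 * m) + π v * m ^ 2 := by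
      intro v
      simp only [hg]
      rcases hχ v with h | h <;> rw [h] <;> ring
    simp only [ip, e, Finset.sum_add_distrib, ← Finset.sum_mul, hL.prob.2]
    rw [← hm]; ring
  have hen : ip π g g - ip π g (P *ᵥ g) ≤ 1 / (4 * Fintype.card I) := by
    rw [hL.energy]
    have e : ∀ x y, π x * P x y * (g x - g y) ^ 2
        = ((g x - g y) ^ 2 / (8 * (Fintype.card I / 2))) * E.ew (fun _ => 1) x y := by
      intro x y
      rw [hπ, hP, E.wSta_eq, E.wMat_apply]
      have := (E.cs_pos hc hcov x).ne'
      split_ifs with h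
      · subst h; simp
      · simp only [Finset.sum_const, Finset.card_univ, nsmul_eq_mul, mul_one]
        field_simp
        ring
    simp only [e]
    rw [E.sum_ew]
    have e2 : ∀ i, 1 * ((g (E.s i) - g (E.t i)) ^ 2 / (8 * ((Fintype.card I : ℝ) / 2)) +
        (g (E.t i) - g (E.s i)) ^ 2 / (8 * (Fintype.card I / 2)))
        ≤ if i = i₀ then 1 / (2 * (Fintype.card I : ℝ)) else 0 := by
      intro i
      split_ifs with h
      · have e3 : (g (E.s i) - g (E.t i)) ^ 2 ≤ 1 := by
          simp only [hg]
          rcases hχ (E.s i) with h | h <;> rcases hχ (E.t i) with h' | h' <;> rw [h, h'] <;>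
            ring_nf <;> norm_num
        have e4 : 1 * ((g (E.s i) - g (E.t i)) ^ 2 / (8 * ((Fintype.card I : ℝ) / 2)) +
          (g (E.t i) - g (E.s i)) ^ 2 / (8 * (Fintype.card I / 2)))
          = (g (E.s i) - g (E.t i)) ^ 2 * (1 / (2 * Fintype.card I)) := by field_simp; ring
        rw [e4]
        exact mul_le_of_le_one_left (by positivity) e3
      · have := hb i h
        simp [hg, this]
    have e5 := Finset.sum_le_sum fun i (_ : i ∈ Finset.univ) => e2 i
    rw [Finset.sum_ite_eq' Finset.univ i₀, if_pos (Finset.mem_univ _)] at e5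
    calc _ ≤ 1 / (2 * (Fintype.card I : ℝ)) / 2 := by gcongr
      _ = _ := by field_simp; norm_num
  have hgp : p ^ 2 ≤ ip π g g := by rw [hgg, pow_two]; exact mul_le_mul hm1 hm2 hp.le (hp.le.trans hm1)
  have hp2 : 0 < p ^ 2 := by positivity
  have := hL.trel_bounds (fun f hf x y => E.harmonic_const hc hcov hcon hf x y) hg0
    (hp2.trans_le hgp) (δ := 1 / (4 * p ^ 2 * Fintype.card I)) (hen.trans ?_) ht
  · simpa using this
  · calc 1 / (4 * (Fintype.card I : ℝ)) = 1 / (4 * p ^ 2 * Fintype.card I) * p ^ 2 := by field_simp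
      _ ≤ _ := by gcongr

end Networks


/-! ### Summation by parts along paths and binary heaps -/

section Summation

lemma sum_path_by_parts (y φ : ℕ → ℝ) (lam : ℝ) (n : ℕ) :
    ∑ i ∈ Finset.range (n + 1), ((y i - y (i + 1)) * (φ i - φ (i + 1))
      - 2 * lam * (y i * φ i + y (i + 1) * φ (i + 1)))
    = y 0 * ((φ 0 - φ 1) - 2 * lam * φ 0)
      + y (n + 1) * ((φ (n + 1) - φ n) - 2 * lam * φ (n + 1))
      + ∑ p ∈ Finset.range n, y (p + 1) *
          (2 * φ (p + 1) - φ p - φ (p + 2) - 4 * lam * φ (p + 1)) := by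
  induction n with
  | zero => simp; ring
  | succ n ih => rw [Finset.sum_range_succ, ih, Finset.sum_range_succ]; ring

lemma sum_range_children (g : ℕ → ℝ) (m : ℕ) :
    ∑ j ∈ Finset.range (2 * m + 1), g j
      = g 0 + ∑ i ∈ Finset.range m, (g (2 * i + 1) + g (2 * i + 2)) := by
  induction m with
  | zero => simp
  | succ m ih =>
    rw [show 2 * (m + 1) + 1 = 2 * m + 1 + 1 + 1 by ring, Finset.sum_range_succ,
      Finset.sum_range_succ, ih, Finset.sum_range_succ]
    ring

/-- value at the parent in a binary heap whose root is attached to a vertex of value `a` -/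
def parentVal (a : ℝ) (y : ℕ → ℝ) (i : ℕ) : ℝ := if i = 0 then a else y ((i - 1) / 2)

lemma sum_parent (a : ℝ) (y g : ℕ → ℝ) {m : ℕ} (hm : 1 ≤ m) :
    ∑ i ∈ Finset.range m, parentVal a y i * g i = a * g 0 +
      ∑ i ∈ Finset.range m, y i * ((if 2 * i + 1 < m then g (2 * i + 1) else 0)
        + (if 2 * i + 2 < m then g (2 * i + 2) else 0)) := by
  have e1 : ∑ i ∈ Finset.range m, parentVal a y i * g i
      = ∑ i ∈ Finset.range (2 * m + 1), if i < m then parentVal a y i * g i else 0 := by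
    rw [← Finset.sum_filter]
    refine Finset.sum_congr ?_ fun _ _ => rfl
    ext i; simp; omega
  rw [e1, sum_range_children, if_pos (by omega)]
  congr 1
  refine Finset.sum_congr rfl fun i _ => ?_
  have p1 : parentVal a y (2 * i + 1) = y i := by
    simp only [parentVal]; rw [if_neg (by omega)]; congr 1; omega
  have p2 : parentVal a y (2 * i + 2) = y i := by
    simp only [parentVal]; rw [if_neg (by omega)]; congr 1; omega
  rw [p1, p2]
  split_ifs <;> ring

lemma sum_heap_by_parts (ya φa : ℝ) (y φ : ℕ → ℝ) (lam : ℝ) {m : ℕ} (hm : 1 ≤ m) :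
    ∑ i ∈ Finset.range m, ((y i - parentVal ya y i) * (φ i - parentVal φa φ i)
      - 2 * lam * (y i * φ i + parentVal ya y i * parentVal φa φ i))
    = ya * ((φa - φ 0) - 2 * lam * φa) + ∑ i ∈ Finset.range m, y i *
        ((φ i - parentVal φa φ i) - 2 * lam * φ i
          - ((if 2 * i + 1 < m then φ (2 * i + 1) - φ i + 2 * lam * φ i else 0)
            + (if 2 * i + 2 < m then φ (2 * i + 2) - φ i + 2 * lam * φ i else 0))) := by
  have h := sum_parent ya y (fun i => parentVal φa φ i - φ i - 2 * lam * parentVal φa φ i) hm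
  have p0 : parentVal φa φ 0 = φa := by simp [parentVal]
  have p1 : ∀ i, parentVal φa φ (2 * i + 1) = φ i := fun i => by
    simp only [parentVal]; rw [if_neg (by omega)]; congr 1; omega
  have p2 : ∀ i, parentVal φa φ (2 * i + 2) = φ i := fun i => by
    simp only [parentVal]; rw [if_neg (by omega)]; congr 1; omega
  simp only [p0, p1, p2] at h
  have e : ∀ i, (y i - parentVal ya y i) * (φ i - parentVal φa φ i)
      - 2 * lam * (y i * φ i + parentVal ya y i * parentVal φa φ i)
      = y i * ((φ i - parentVal φa φ i) - 2 * lam * φ i)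
        + parentVal ya y i * (parentVal φa φ i - φ i - 2 * lam * parentVal φa φ i) :=
    fun i => by ring
  simp only [e]
  rw [Finset.sum_add_distrib, h, add_left_comm, ← Finset.sum_add_distrib]
  congr 1
  refine Finset.sum_congr rfl fun i _ => ?_
  split_ifs <;> ring

/-- edge flux at depth `d` in a heap of height `H` -/
def heapFlux (H d : ℕ) : ℝ := 8 * 2 ^ (H - d) - 6

/-- potential on a heap of height `H` -/
def heapPot (H i : ℕ) : ℝ :=
  8 * 2 ^ (H + 1) - 8 * 2 ^ (H - Nat.log 2 (i + 1)) - 6 * (Nat.log 2 (i + 1) + 1)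

lemma log_child_odd (i : ℕ) : Nat.log 2 (2 * i + 1 + 1) = Nat.log 2 (i + 1) + 1 := by
  rw [show 2 * i + 1 + 1 = (i + 1) * 2 by ring]
  exact Nat.log_mul_base (by norm_num) (by omega)

lemma log_child_even (i : ℕ) : Nat.log 2 (2 * i + 2 + 1) = Nat.log 2 (i + 1) + 1 := by
  rw [Nat.log_of_one_lt_of_le (by norm_num) (by omega)]
  congr 2; omega

lemma heapPot_zero (H : ℕ) : heapPot H 0 = heapFlux H 0 := by
  simp [heapPot, heapFlux, pow_succ]; ring

lemma heapPot_step {H d : ℕ} (h : d + 1 ≤ H) {i j : ℕ} (hi : Nat.log 2 (i + 1) = d)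
    (hj : Nat.log 2 (j + 1) = d + 1) : heapPot H j - heapPot H i = heapFlux H (d + 1) := by
  obtain ⟨n, rfl⟩ := Nat.exists_eq_add_of_le h
  rw [heapPot, heapPot, heapFlux, hi, hj, show d + 1 + n - d = n + 1 by omega,
    show d + 1 + n - (d + 1) = n by omega]
  push_cast
  rw [pow_succ (2 : ℝ) n]; ring

lemma heapPot_nonneg {H i : ℕ} (h : Nat.log 2 (i + 1) ≤ H) : 0 ≤ heapPot H i := by
  rw [heapPot]
  generalize Nat.log 2 (i + 1) = d at h
  obtain ⟨n, rfl⟩ := Nat.exists_eq_add_of_le h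
  rw [show d + n - d = n by omega, show d + n + 1 = n + (d + 1) by ring, pow_add]
  have h1 : (1 : ℝ) ≤ 2 ^ n := one_le_pow₀ (by norm_num)
  have h2 : (d : ℝ) + 2 ≤ 2 ^ (d + 1) := by
    exact_mod_cast (Nat.lt_two_pow_self (n := d + 1))
  have h3 : ((d : ℝ) + 1) ≤ 2 ^ n * (2 ^ (d + 1) - 1) := by
    have : (0 : ℝ) ≤ d := Nat.cast_nonneg d
    nlinarith
  have : (0 : ℝ) ≤ d := Nat.cast_nonneg d
  nlinarith

lemma heapPot_le (H i : ℕ) : heapPot H i ≤ 16 * 2 ^ H := by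
  rw [heapPot, pow_succ]
  have h1 : (0 : ℝ) ≤ 2 ^ (H - Nat.log 2 (i + 1)) := by positivity
  have : (0 : ℝ) ≤ Nat.log 2 (i + 1) := Nat.cast_nonneg _
  linarith

lemma log_lt_heap {m j : ℕ} (hj : j < m) : Nat.log 2 (j + 1) ≤ Nat.log 2 m :=
  Nat.log_mono_right hj

/-- the potential on a heap is a supersolution -/
lemma heap_coef_nonneg {m : ℕ} {Fa κ lam : ℝ} (hF : 0 ≤ Fa)
    (hκ : 0 ≤ κ ∨ ∃ H, m = 2 ^ (H + 1) - 1) {i : ℕ} (hi : i < m)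
    (hlam : lam * (1 + κ * heapPot (Nat.log 2 m) i) ≤ κ) {φ : ℕ → ℝ}
    (hφ : φ = fun i => Fa * (1 + κ * heapPot (Nat.log 2 m) i)) :
    0 ≤ (φ i - parentVal Fa φ i) - 2 * lam * φ i
          - ((if 2 * i + 1 < m then φ (2 * i + 1) - φ i + 2 * lam * φ i else 0)
            + (if 2 * i + 2 < m then φ (2 * i + 2) - φ i + 2 * lam * φ i else 0)) := by
  set H := Nat.log 2 m with hH
  set d := Nat.log 2 (i + 1) with hd
  have hdH : d ≤ H := log_lt_heap hi
  have hpar : φ i - parentVal Fa φ i = Fa * κ * heapFlux H d := by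
    rw [hφ]
    rcases Nat.eq_zero_or_pos i with rfl | h0
    · have : d = 0 := by rw [hd]; simp
      simp only [parentVal, if_true]
      rw [this, ← heapPot_zero]; ring
    · simp only [parentVal]
      rw [if_neg (by omega)]
      obtain ⟨j, hj⟩ : ∃ j, i = 2 * j + 1 ∨ i = 2 * j + 2 := ⟨(i - 1) / 2, by omega⟩
      have hlog : d = Nat.log 2 (j + 1) + 1 := by
        rcases hj with rfl | rfl
        · rw [hd, log_child_odd]
        · rw [hd, log_child_even]
      have hij : (i - 1) / 2 = j := by omega
      rw [hij, hlog, ← heapPot_step (by omega : Nat.log 2 (j + 1) + 1 ≤ H) rfl (hd ▸ hlog)]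
      ring
  have hch : ∀ j, (j = 2 * i + 1 ∨ j = 2 * i + 2) → j < m →
      d + 1 ≤ H ∧ φ j - φ i = Fa * κ * heapFlux H (d + 1) := by
    intro j hj hjm
    have hlog : Nat.log 2 (j + 1) = d + 1 := by
      rcases hj with rfl | rfl
      · rw [log_child_odd]
      · rw [log_child_even]
    have h1 : d + 1 ≤ H := by rw [← hlog]; exact log_lt_heap hjm
    refine ⟨h1, ?_⟩
    rw [hφ, ← heapPot_step h1 rfl hlog]
    ring
  rw [hpar]
  have hφi : φ i = Fa * (1 + κ * heapPot H i) := by rw [hφ]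
  have hmain : lam * φ i ≤ Fa * κ := by
    rw [hφi]; nlinarith [mul_le_mul_of_nonneg_left hlam hF]
  have hfl : d + 1 ≤ H → heapFlux H d = 2 * heapFlux H (d + 1) + 6 ∧ 2 ≤ heapFlux H (d + 1) := by
    intro h1
    obtain ⟨n, hn⟩ := Nat.exists_eq_add_of_le h1
    rw [heapFlux, heapFlux, show H - d = n + 1 by omega, show H - (d + 1) = n by omega, pow_succ]
    have : (1 : ℝ) ≤ 2 ^ n := one_le_pow₀ (by norm_num)
    constructor <;> linarith
  have hfl0 : 2 ≤ heapFlux H d := by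
    rw [heapFlux]
    have : (1 : ℝ) ≤ 2 ^ (H - d) := one_le_pow₀ (by norm_num)
    linarith
  by_cases h2 : 2 * i + 2 < m
  · have h1 : 2 * i + 1 < m := by omega
    obtain ⟨hd1, e1⟩ := hch _ (Or.inl rfl) h1
    obtain ⟨-, e2⟩ := hch _ (Or.inr rfl) h2
    rw [if_pos h1, if_pos h2, e1, e2, (hfl hd1).1]
    linarith
  · rw [if_neg h2]
    rcases hκ with hκ | ⟨H', hm⟩
    · have hFκ : 0 ≤ Fa * κ := mul_nonneg hF hκ
      split_ifs with h1
      · obtain ⟨hd1, e1⟩ := hch _ (Or.inl rfl) h1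
        obtain ⟨f1, f2⟩ := hfl hd1
        rw [e1, f1]
        nlinarith
      · nlinarith
    · have hpos : 2 ^ (H' + 1) = 2 * 2 ^ H' := by rw [pow_succ]; ring
      have hpos' : 0 < 2 ^ H' := by positivity
      have h1 : ¬ 2 * i + 1 < m := by omega
      have hHH : H = H' := by
        rw [hH, hm]
        refine Nat.log_eq_of_pow_le_of_lt_pow ?_ ?_ <;> omega
      have hdd : H ≤ d := by
        rw [hd, hHH]
        refine Nat.le_log_of_pow_le (by norm_num) ?_
        omega
      have : heapFlux H d = 2 := by rw [heapFlux, show H - d = 0 by omega]; norm_num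
      rw [if_neg h1, this]
      linarith

end Summation


/-! ### Subdivided graphs with binary heaps attached -/

section Gadgets

open scoped Matrix

/-- a skeleton whose edges are to be subdivided and to which binary heaps are to be attached -/
structure Gad (S E K : Type) where
  /-- source of an edge -/
  src : E → S
  /-- target of an edge -/
  dst : E → S
  src_ne : ∀ e, src e ≠ dst e
  /-- length of the path that replaces an edge -/
  len : E → ℕ
  two_le : ∀ e, 2 ≤ len e
  /-- vertex to which a heap is attached -/
  att : K → S
  /-- size of a heap -/
  hs : K → ℕ
  hs_pos : ∀ k, 1 ≤ hs k
  cover : ∀ x, ∃ e, src e = x ∨ dst e = x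

variable {S E K : Type} [Fintype S] [DecidableEq S] [Fintype E] [DecidableEq E] [Fintype K]
  [DecidableEq K]

namespace Gad

/-- vertices of the subdivided graph -/
abbrev Vert (G : Gad S E K) : Type := S ⊕ ((e : E) × Fin (G.len e - 1)) ⊕ ((k : K) × Fin (G.hs k))

/-- edges of the subdivided graph -/
abbrev Edge (G : Gad S E K) : Type := ((e : E) × Fin (G.len e)) ⊕ ((k : K) × Fin (G.hs k))

/-- the vertex at distance `p` from the source along the path of `e` -/
def pos (G : Gad S E K) (e : E) (p : ℕ) : G.Vert :=
  if p = 0 then Sum.inl (G.src e)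
  else if h : p - 1 < G.len e - 1 then Sum.inr (Sum.inl ⟨e, p - 1, h⟩) else Sum.inl (G.dst e)

/-- the `i`-th vertex of a heap -/
def hnode (G : Gad S E K) (k : K) (i : ℕ) : G.Vert :=
  if h : i < G.hs k then Sum.inr (Sum.inr ⟨k, i, h⟩) else Sum.inl (G.att k)

/-- the parent of the `i`-th vertex of a heap -/
def hpar (G : Gad S E K) (k : K) (i : ℕ) : G.Vert :=
  if i = 0 then Sum.inl (G.att k) else G.hnode k ((i - 1) / 2)

/-- coordinates of an inner vertex of a path -/
def decPath (G : Gad S E K) : G.Vert → Option (E × ℕ)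
  | Sum.inl _ => none
  | Sum.inr (Sum.inl ⟨e, p⟩) => some (e, p + 1)
  | Sum.inr (Sum.inr _) => none

/-- coordinates of a vertex of a heap -/
def decHeap (G : Gad S E K) : G.Vert → Option (K × ℕ)
  | Sum.inl _ => none
  | Sum.inr (Sum.inl _) => none
  | Sum.inr (Sum.inr ⟨k, i⟩) => some (k, i)

variable (G : Gad S E K)

lemma pos_zero (e : E) : G.pos e 0 = Sum.inl (G.src e) := rfl

lemma pos_len (e : E) : G.pos e (G.len e) = Sum.inl (G.dst e) := by
  have := G.two_le e
  rw [pos, if_neg (by omega), dif_neg (by omega)]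

lemma pos_succ (e : E) (p : Fin (G.len e - 1)) :
    G.pos e (p + 1) = Sum.inr (Sum.inl ⟨e, p⟩) := by
  rw [pos, if_neg (by omega), dif_pos (by simp)]
  simp

lemma decPath_pos (e : E) (p : ℕ) :
    G.decPath (G.pos e p) = if 0 < p ∧ p < G.len e then some (e, p) else none := by
  rw [pos]
  split_ifs with h1 h2 h3 h4 h5 <;> simp only [decPath] <;> first | omega | rfl | skip
  rw [Nat.sub_add_cancel (by omega)]

lemma decHeap_pos (e : E) (p : ℕ) : G.decHeap (G.pos e p) = none := by
  rw [pos]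
  split_ifs <;> rfl

lemma hnode_eq (k : K) (i : Fin (G.hs k)) : G.hnode k i = Sum.inr (Sum.inr ⟨k, i⟩) := by
  rw [hnode, dif_pos i.2]

lemma decHeap_hnode {k : K} {i : ℕ} (h : i < G.hs k) : G.decHeap (G.hnode k i) = some (k, i) := by
  rw [hnode, dif_pos h]; rfl

lemma decHeap_hpar {k : K} {i : ℕ} (h : i < G.hs k) :
    G.decHeap (G.hpar k i) = if i = 0 then none else some (k, (i - 1) / 2) := by
  rw [hpar]
  split_ifs with h0
  · rfl
  · exact G.decHeap_hnode (by omega)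

lemma pos_inj {e : E} {p q : ℕ} (hp : p ≤ G.len e) (hq : q ≤ G.len e)
    (h : G.pos e p = G.pos e q) : p = q := by
  have h1 := congrArg G.decPath h
  rw [decPath_pos, decPath_pos] at h1
  split_ifs at h1 with h2 h3 h3
  · simpa using h1
  · have hp' : p = 0 ∨ p = G.len e := by omega
    have hq' : q = 0 ∨ q = G.len e := by omega
    have hne := G.src_ne e
    rcases hp' with rfl | rfl <;> rcases hq' with rfl | rfl
    · rfl
    · rw [pos_zero, pos_len] at h; exact absurd (Sum.inl_injective h) hne
    · rw [pos_zero, pos_len] at h; exact absurd (Sum.inl_injective h).symm hne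
    · rfl

lemma pos_eq_imp {e e' : E} {p q : ℕ} (h0 : 0 < p) (hp : p < G.len e)
    (h : G.pos e p = G.pos e' q) : e = e' ∧ p = q := by
  have h1 := congrArg G.decPath h
  rw [decPath_pos, decPath_pos, if_pos ⟨h0, hp⟩] at h1
  split_ifs at h1
  simpa using h1

/-- the subdivided graph as a list of edges -/
def net : Net G.Vert G.Edge where
  s i := match i with
    | Sum.inl ⟨e, i⟩ => G.pos e i
    | Sum.inr ⟨k, i⟩ => G.hnode k i
  t i := match i with
    | Sum.inl ⟨e, i⟩ => G.pos e (i + 1)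
    | Sum.inr ⟨k, i⟩ => G.hpar k i
  ne i := by
    rcases i with ⟨e, i⟩ | ⟨k, i⟩
    · intro h
      have := G.pos_inj (e := e) (by omega) (by omega) h
      omega
    · intro h
      have := congrArg G.decHeap h
      rw [G.decHeap_hnode i.2, G.decHeap_hpar i.2] at this
      split_ifs at this with h0
      simp only [Option.some.injEq, Prod.mk.injEq, true_and] at this
      omega
  inj i j h := by
    rcases i with ⟨e, i⟩ | ⟨k, i⟩ <;> rcases j with ⟨e', j⟩ | ⟨k', j⟩
    · dsimp only at h
      have hl := G.two_le e
      have hi := i.2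
      have hj := j.2
      have key : e = e' ∧ (i : ℕ) = j := by
        rcases h with ⟨h1, h2⟩ | ⟨h1, h2⟩
        · by_cases h0 : 0 < (i : ℕ)
          · exact G.pos_eq_imp h0 hi h1
          · have := G.pos_eq_imp (p := i + 1) (by omega) (by omega) h2
            exact ⟨this.1, by omega⟩
        · exfalso
          have he : e = e' := by
            by_cases h0 : 0 < (i : ℕ)
            · exact (G.pos_eq_imp h0 hi h1).1
            · exact (G.pos_eq_imp (p := i + 1) (by omega) (by omega) h2).1
          subst he
          have e1 := G.pos_inj (by omega) (by omega) h1
          have e2 := G.pos_inj (by omega) (by omega) h2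
          omega
      obtain ⟨rfl, h2⟩ := key
      rw [Fin.ext h2]
    · exfalso
      dsimp only at h
      rcases h with ⟨h1, -⟩ | ⟨-, h1⟩
      · have := congrArg G.decHeap h1
        rw [decHeap_pos, G.decHeap_hnode j.2] at this
        simp at this
      · have := congrArg G.decHeap h1
        rw [decHeap_pos, G.decHeap_hnode j.2] at this
        simp at this
    · exfalso
      dsimp only at h
      rcases h with ⟨h1, -⟩ | ⟨h1, -⟩
      · have := congrArg G.decHeap h1
        rw [decHeap_pos, G.decHeap_hnode i.2] at this
        simp at this
      · have := congrArg G.decHeap h1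
        rw [decHeap_pos, G.decHeap_hnode i.2] at this
        simp at this
    · dsimp only at h
      rcases h with ⟨h1, -⟩ | ⟨h1, h2⟩
      · rw [hnode_eq, hnode_eq] at h1
        rw [Sum.inr_injective (Sum.inr_injective h1)]
      · exfalso
        have e1 := congrArg G.decHeap h1
        have e2 := congrArg G.decHeap h2
        rw [G.decHeap_hnode i.2, G.decHeap_hpar j.2] at e1
        rw [G.decHeap_hnode j.2, G.decHeap_hpar i.2] at e2
        split_ifs at e1 e2 with h3 h4
        simp only [Option.some.injEq, Prod.mk.injEq] at e1 e2
        omega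

lemma sum_edge (X : G.Edge → ℝ) (A : E → ℕ → ℝ) (B : K → ℕ → ℝ)
    (hA : ∀ e (i : Fin (G.len e)), X (Sum.inl ⟨e, i⟩) = A e i)
    (hB : ∀ k (i : Fin (G.hs k)), X (Sum.inr ⟨k, i⟩) = B k i) :
    ∑ i, X i = ∑ e, ∑ i ∈ Finset.range (G.len e), A e i
      + ∑ k, ∑ i ∈ Finset.range (G.hs k), B k i := by
  rw [Fintype.sum_sum_type, Fintype.sum_sigma, Fintype.sum_sigma]
  simp only [hA, hB, Finset.sum_range]

lemma sum_vert (X : G.Vert → ℝ) :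
    ∑ v, X v = ∑ x, X (Sum.inl x) + (∑ e, ∑ p ∈ Finset.range (G.len e - 1), X (G.pos e (p + 1))
      + ∑ k, ∑ i ∈ Finset.range (G.hs k), X (G.hnode k i)) := by
  rw [Fintype.sum_sum_type, Fintype.sum_sum_type, Fintype.sum_sigma, Fintype.sum_sigma]
  simp only [Finset.sum_range, pos_succ, hnode_eq]

lemma card_vert : Fintype.card G.Vert
    = Fintype.card S + (∑ e, (G.len e - 1) + ∑ k, G.hs k) := by
  simp [Vert, Fintype.card_sum, Fintype.card_sigma]

lemma card_edge : Fintype.card G.Edge = ∑ e, G.len e + ∑ k, G.hs k := by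
  simp [Edge, Fintype.card_sum, Fintype.card_sigma]

lemma covers : G.net.Covers := by
  intro v
  rcases v with x | ⟨e, p⟩ | ⟨k, i⟩
  · obtain ⟨e, he⟩ := G.cover x
    have := G.two_le e
    rcases he with rfl | rfl
    · exact ⟨Sum.inl ⟨e, ⟨0, by omega⟩⟩, Or.inl rfl⟩
    · refine ⟨Sum.inl ⟨e, ⟨G.len e - 1, by omega⟩⟩, Or.inr ?_⟩
      rw [← G.pos_len]
      change G.pos e (G.len e - 1 + 1) = _
      rw [Nat.sub_add_cancel (by omega)]
  · refine ⟨Sum.inl ⟨e, ⟨p, by omega⟩⟩, Or.inr ?_⟩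
    rw [← G.pos_succ]; rfl
  · exact ⟨Sum.inr ⟨k, i⟩, Or.inl (G.hnode_eq k i)⟩

/-- induction along the edges of the subdivided graph -/
lemma connected_of {z : S} (hz : ∀ R : S → Prop, R z → (∀ e, R (G.src e) ↔ R (G.dst e)) → ∀ x, R x) :
    G.net.graph.Connected := by
  have hedge : ∀ i, G.net.graph.Reachable (G.net.s i) (G.net.t i) := fun i => (G.net.adj i).reachable
  have hpath : ∀ e p, p ≤ G.len e → G.net.graph.Reachable (G.pos e 0) (G.pos e p) := by
    intro e p hp
    induction p with
    | zero => exact SimpleGraph.Reachable.refl _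
    | succ p ih => exact (ih (by omega)).trans (hedge (Sum.inl ⟨e, ⟨p, by omega⟩⟩))
  have hS : ∀ x, G.net.graph.Reachable (Sum.inl z) (Sum.inl x) := by
    refine hz _ (SimpleGraph.Reachable.refl _) fun e => ?_
    have := hpath e _ le_rfl
    rw [pos_zero, pos_len] at this
    exact ⟨fun h => h.trans this, fun h => h.trans this.symm⟩
  have hheap : ∀ k i, i < G.hs k → G.net.graph.Reachable (Sum.inl z) (G.hnode k i) := by
    intro k i
    induction i using Nat.strong_induction_on with
    | _ i ih =>
      intro hi
      have h1 : G.net.graph.Reachable (Sum.inl z) (G.hpar k i) := by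
        rw [hpar]
        split_ifs with h0
        · exact hS _
        · exact ih _ (by omega) (by omega)
      exact h1.trans (hedge (Sum.inr ⟨k, ⟨i, hi⟩⟩)).symm
  have hall : ∀ v, G.net.graph.Reachable (Sum.inl z) v := by
    rintro (x | ⟨e, p⟩ | ⟨k, i⟩)
    · exact hS x
    · rw [← G.pos_succ]
      have := hpath e (p + 1) (by omega)
      rw [pos_zero] at this
      exact (hS _).trans this
    · rw [← G.hnode_eq]
      exact hheap k i i.2
  have : Nonempty G.Vert := ⟨Sum.inl z⟩
  exact ⟨fun u v => (hall u).symm.trans (hall v)⟩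

/-- weights on the subdivided graph that are constant along paths and `1` on heaps -/
def wts (wt : E → ℝ) : G.Edge → ℝ
  | Sum.inl ⟨e, _⟩ => wt e
  | Sum.inr _ => 1

/-- upper bound for the sum of the degrees against a nonnegative function -/
lemma sum_ends_le {D : ℝ} (hD3 : 3 ≤ D)
    (hD : ∀ y : S → ℝ, (∀ x, 0 ≤ y x) →
      ∑ e, (y (G.src e) + y (G.dst e)) + ∑ k, y (G.att k) ≤ D * ∑ x, y x)
    (η : G.Vert → ℝ) (hη : ∀ v, 0 ≤ η v) :
    ∑ i, (η (G.net.s i) + η (G.net.t i)) ≤ D * ∑ v, η v := by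
  rw [G.sum_edge _ (fun e i => η (G.pos e i) + η (G.pos e (i + 1)))
    (fun k i => η (G.hnode k i) + η (G.hpar k i)) (fun _ _ => rfl) (fun _ _ => rfl), sum_vert]
  have h1 : ∀ e, ∑ i ∈ Finset.range (G.len e), (η (G.pos e i) + η (G.pos e (i + 1)))
      ≤ (η (Sum.inl (G.src e)) + η (Sum.inl (G.dst e)))
        + D * ∑ p ∈ Finset.range (G.len e - 1), η (G.pos e (p + 1)) := by
    intro e
    have hl := G.two_le e
    have h := sum_path_by_parts (fun i => η (G.pos e i)) (fun _ => 1) (-1/2) (G.len e - 1)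
    rw [Nat.sub_add_cancel (by omega)] at h
    rw [G.pos_len, G.pos_zero] at h
    have h2 : ∑ p ∈ Finset.range (G.len e - 1), η (G.pos e (p + 1)) * (2 * 1 - 1 - 1 - 4 * (-1/2) * 1)
        = 2 * ∑ p ∈ Finset.range (G.len e - 1), η (G.pos e (p + 1)) := by
      rw [Finset.mul_sum]; exact Finset.sum_congr rfl fun _ _ => by ring
    have h3 : 0 ≤ ∑ p ∈ Finset.range (G.len e - 1), η (G.pos e (p + 1)) :=
      Finset.sum_nonneg fun _ _ => hη _
    have h4 : ∑ i ∈ Finset.range (G.len e), (η (G.pos e i) + η (G.pos e (i + 1)))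
      = ∑ i ∈ Finset.range (G.len e), ((η (G.pos e i) - η (G.pos e (i + 1))) * ((1:ℝ) - 1)
      - 2 * (-1/2) * (η (G.pos e i) * 1 + η (G.pos e (i + 1)) * 1)) :=
      Finset.sum_congr rfl fun _ _ => by ring
    rw [h4, h, h2]
    nlinarith
  have h2 : ∀ k, ∑ i ∈ Finset.range (G.hs k), (η (G.hnode k i) + η (G.hpar k i))
      ≤ η (Sum.inl (G.att k)) + D * ∑ i ∈ Finset.range (G.hs k), η (G.hnode k i) := by
    intro k
    have h := sum_parent (η (Sum.inl (G.att k))) (fun i => η (G.hnode k i)) (fun _ => 1) (G.hs_pos k)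
    have hp : ∀ i, parentVal (η (Sum.inl (G.att k))) (fun i => η (G.hnode k i)) i
        = η (G.hpar k i) := by
      intro i
      rw [parentVal, hpar]; split_ifs <;> rfl
    simp only [hp, mul_one] at h
    rw [Finset.sum_add_distrib, h]
    have h3 : ∑ i ∈ Finset.range (G.hs k), η (G.hnode k i) *
        ((if 2 * i + 1 < G.hs k then (1:ℝ) else 0) + (if 2 * i + 2 < G.hs k then (1:ℝ) else 0))
        ≤ ∑ i ∈ Finset.range (G.hs k), 2 * η (G.hnode k i) := by
      refine Finset.sum_le_sum fun i _ => ?_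
      have := hη (G.hnode k i)
      split_ifs <;> nlinarith
    rw [← Finset.mul_sum] at h3
    have h4 : 0 ≤ ∑ i ∈ Finset.range (G.hs k), η (G.hnode k i) :=
      Finset.sum_nonneg fun _ _ => hη _
    nlinarith
  have h3 := hD (fun x => η (Sum.inl x)) fun x => hη _
  have h4 := Finset.sum_le_sum fun e (_ : e ∈ Finset.univ) => h1 e
  have h5 := Finset.sum_le_sum fun k (_ : k ∈ Finset.univ) => h2 k
  rw [Finset.sum_add_distrib, ← Finset.mul_sum] at h4 h5
  nlinarith

/-- interpolation along a path -/
def pathVal (a b γ : ℝ) (l p : ℝ) : ℝ := a * (1 - p / l) + b * (p / l) + γ * p * (l - p)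

/-- extension of a function on the skeleton to the subdivided graph -/
def ext (F : S → ℝ) (γ : E → ℝ) (κ : K → ℝ) : G.Vert → ℝ
  | Sum.inl x => F x
  | Sum.inr (Sum.inl ⟨e, p⟩) =>
      pathVal (F (G.src e)) (F (G.dst e)) (γ e) (G.len e) ((p : ℕ) + 1)
  | Sum.inr (Sum.inr ⟨k, i⟩) => F (G.att k) * (1 + κ k * heapPot (Nat.log 2 (G.hs k)) i)

lemma ext_pos (F : S → ℝ) (γ : E → ℝ) (κ : K → ℝ) (e : E) {p : ℕ} (hp : p ≤ G.len e) :
    G.ext F γ κ (G.pos e p) = pathVal (F (G.src e)) (F (G.dst e)) (γ e) (G.len e) p := by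
  have hl := G.two_le e
  rcases Nat.eq_zero_or_pos p with rfl | h0
  · rw [pos_zero]; simp [ext, pathVal]
  · rcases hp.eq_or_lt with rfl | h1
    · rw [pos_len]
      have : (G.len e : ℝ) ≠ 0 := by positivity
      simp [ext, pathVal, this]
    · have := G.pos_succ e ⟨p - 1, by omega⟩
      simp only [Nat.sub_add_cancel h0] at this
      rw [this]
      simp only [ext]
      rw [← Nat.cast_succ, Nat.succ_eq_add_one, Nat.sub_add_cancel h0]

lemma ext_hnode (F : S → ℝ) (γ : E → ℝ) (κ : K → ℝ) (k : K) {i : ℕ} (hi : i < G.hs k) :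
    G.ext F γ κ (G.hnode k i) = F (G.att k) * (1 + κ k * heapPot (Nat.log 2 (G.hs k)) i) := by
  rw [hnode, dif_pos hi]; rfl

/-- the energy form of an extension is bounded below by its restriction to the skeleton -/
lemma form_le {wt : E → ℝ} (hwt : ∀ e, 0 ≤ wt e) {F : S → ℝ} {γ : E → ℝ} {κ : K → ℝ} {lam : ℝ}
    (hγ : ∀ e p, 0 < p → p < G.len e →
      2 * lam * pathVal (F (G.src e)) (F (G.dst e)) (γ e) (G.len e) p ≤ γ e)
    (hF : ∀ k, 0 ≤ F (G.att k))
    (hκ : ∀ k, 0 ≤ κ k ∨ ∃ H, G.hs k = 2 ^ (H + 1) - 1)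
    (hh : ∀ k i, i < G.hs k → lam * (1 + κ k * heapPot (Nat.log 2 (G.hs k)) i) ≤ κ k)
    (η : G.Vert → ℝ) (hη : ∀ v, 0 ≤ η v) :
    ∑ e, wt e * (η (Sum.inl (G.src e)) * ((F (G.src e) - F (G.dst e)) / G.len e
            - γ e * (G.len e - 1) - 2 * lam * F (G.src e))
          + η (Sum.inl (G.dst e)) * ((F (G.dst e) - F (G.src e)) / G.len e
            - γ e * (G.len e - 1) - 2 * lam * F (G.dst e)))
        - ∑ k, η (Sum.inl (G.att k)) * (F (G.att k) *
            (κ k * heapFlux (Nat.log 2 (G.hs k)) 0 + 2 * lam))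
      ≤ ∑ i, G.wts wt i * ((η (G.net.s i) - η (G.net.t i))
          * (G.ext F γ κ (G.net.s i) - G.ext F γ κ (G.net.t i))
          - 2 * lam * (η (G.net.s i) * G.ext F γ κ (G.net.s i)
            + η (G.net.t i) * G.ext F γ κ (G.net.t i))) := by
  set Φ := G.ext F γ κ with hΦ
  rw [G.sum_edge _ (fun e i => wt e * ((η (G.pos e i) - η (G.pos e (i + 1)))
      * (Φ (G.pos e i) - Φ (G.pos e (i + 1))) - 2 * lam * (η (G.pos e i) * Φ (G.pos e i)
        + η (G.pos e (i + 1)) * Φ (G.pos e (i + 1)))))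
    (fun k i => (η (G.hnode k i) - η (G.hpar k i))
      * (Φ (G.hnode k i) - Φ (G.hpar k i)) - 2 * lam * (η (G.hnode k i) * Φ (G.hnode k i)
        + η (G.hpar k i) * Φ (G.hpar k i))) (fun _ _ => rfl) (fun _ _ => by
          simp only [wts, one_mul]; rfl), sub_eq_add_neg, ← Finset.sum_neg_distrib]
  refine add_le_add (Finset.sum_le_sum fun e _ => ?_) (Finset.sum_le_sum fun k _ => ?_)
  · rw [← Finset.mul_sum]
    refine mul_le_mul_of_nonneg_left ?_ (hwt e)
    have hl := G.two_le e
    have hl0 : (G.len e : ℝ) ≠ 0 := by positivity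
    have h := sum_path_by_parts (fun i => η (G.pos e i)) (fun i => Φ (G.pos e i)) lam (G.len e - 1)
    rw [Nat.sub_add_cancel (by omega)] at h
    rw [h, G.pos_zero, G.pos_len]
    have e0 : Φ (Sum.inl (G.src e)) = F (G.src e) := rfl
    have e1 : Φ (Sum.inl (G.dst e)) = F (G.dst e) := rfl
    have e2 : F (G.src e) - Φ (G.pos e 1)
        = (F (G.src e) - F (G.dst e)) / G.len e - γ e * (G.len e - 1) := by
      rw [hΦ, G.ext_pos _ _ _ e (by omega), pathVal]
      push_cast; field_simp; ring
    have e3 : F (G.dst e) - Φ (G.pos e (G.len e - 1))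
        = (F (G.dst e) - F (G.src e)) / G.len e - γ e * (G.len e - 1) := by
      rw [hΦ, G.ext_pos _ _ _ e (by omega), pathVal]
      push_cast [show 1 ≤ G.len e by omega]; field_simp; ring
    rw [e0, e1, e2, e3, le_add_iff_nonneg_right]
    refine Finset.sum_nonneg fun p hp => mul_nonneg (hη _) ?_
    have hp := Finset.mem_range.1 hp
    have h1 := hγ e (p + 1) (by omega) (by omega)
    rw [hΦ, G.ext_pos _ _ _ e (by omega), G.ext_pos _ _ _ e (by omega),
      G.ext_pos _ _ _ e (by omega)]
    have h2 : 2 * pathVal (F (G.src e)) (F (G.dst e)) (γ e) (G.len e) (p + 1 : ℕ)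
        - pathVal (F (G.src e)) (F (G.dst e)) (γ e) (G.len e) p
        - pathVal (F (G.src e)) (F (G.dst e)) (γ e) (G.len e) (p + 2 : ℕ) = 2 * γ e := by
      rw [pathVal, pathVal, pathVal]; push_cast; field_simp; ring
    linarith
  · have hp : ∀ (g : G.Vert → ℝ) i, parentVal (g (Sum.inl (G.att k))) (fun i => g (G.hnode k i)) i
        = g (G.hpar k i) := by
      intro g i
      rw [parentVal, hpar]; split_ifs <;> rfl
    have h := sum_heap_by_parts (η (Sum.inl (G.att k))) (Φ (Sum.inl (G.att k)))
      (fun i => η (G.hnode k i)) (fun i => Φ (G.hnode k i)) lam (G.hs_pos k)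
    simp only [hp η] at h
    rw [Finset.sum_congr rfl fun i _ => by rw [← hp Φ]]
    rw [h]
    have e0 : Φ (Sum.inl (G.att k)) = F (G.att k) := rfl
    have e1 : Φ (G.hnode k 0) = F (G.att k) * (1 + κ k * heapFlux (Nat.log 2 (G.hs k)) 0) := by
      rw [hΦ, G.ext_hnode _ _ _ k (G.hs_pos k), heapPot_zero]
    rw [e0, e1]
    have h2 : 0 ≤ ∑ i ∈ Finset.range (G.hs k), η (G.hnode k i) *
        ((Φ (G.hnode k i) - parentVal (F (G.att k)) (fun i => Φ (G.hnode k i)) i)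
          - 2 * lam * Φ (G.hnode k i)
          - ((if 2 * i + 1 < G.hs k then Φ (G.hnode k (2 * i + 1)) - Φ (G.hnode k i)
              + 2 * lam * Φ (G.hnode k i) else 0)
            + (if 2 * i + 2 < G.hs k then Φ (G.hnode k (2 * i + 2)) - Φ (G.hnode k i)
              + 2 * lam * Φ (G.hnode k i) else 0))) := by
      refine Finset.sum_nonneg fun i hi => mul_nonneg (hη _) ?_
      have hi := Finset.mem_range.1 hi
      have h3 := heap_coef_nonneg (hF k) (hκ k) hi (hh k i hi) rfl
      have h4 : ∀ j < G.hs k, Φ (G.hnode k j)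
        = F (G.att k) * (1 + κ k * heapPot (Nat.log 2 (G.hs k)) j) :=
        fun j hj => G.ext_hnode _ _ _ k hj
      have h5 : parentVal (F (G.att k)) (fun i => Φ (G.hnode k i)) i
          = parentVal (F (G.att k))
            (fun i => F (G.att k) * (1 + κ k * heapPot (Nat.log 2 (G.hs k)) i)) i := by
        rw [parentVal, parentVal]
        split_ifs with h0
        · rfl
        · exact h4 _ (by omega)
      rw [h5, h4 i hi]
      refine h3.trans_eq ?_
      congr 2
      · split_ifs with h6
        · rw [h4 _ h6]
        · rfl
      · split_ifs with h6
        · rw [h4 _ h6]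
        · rfl
    linarith

end Gad

end Gadgets


section GadgetWalks

open scoped Matrix

variable {S E K : Type} [Fintype S] [DecidableEq S] [Fintype E] [DecidableEq E] [Fintype K]
  [DecidableEq K]

lemma Net.map_covers {I : Type} {W : Type} (T : Net V I) (e : V ≃ W)
    (h : T.Covers) : (T.map e).Covers := by
  intro w
  obtain ⟨i, hi⟩ := h (e.symm w)
  refine ⟨i, ?_⟩
  rcases hi with hi | hi
  · left; simp [Net.map, hi]
  · right; simp [Net.map, hi]

lemma Net.map_connected {I : Type} {W : Type} (T : Net V I) (e : V ≃ W)
    (h : T.graph.Connected) : (T.map e).graph.Connected := by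
  have iso : T.graph ≃g (T.map e).graph :=
    ⟨e, by intro a b; simp [Net.graph, Net.map]⟩
  exact iso.connected_iff.1 h

namespace Gad

variable (G : Gad S E K) {N : ℕ} (e : G.Vert ≃ Fin N)

/-- degrees against test functions are at most `D` -/
def DegBound (G : Gad S E K) (D : ℝ) : Prop := ∀ y : S → ℝ, (∀ x, 0 ≤ y x) →
  ∑ e, (y (G.src e) + y (G.dst e)) + ∑ k, y (G.att k) ≤ D * ∑ x, y x

lemma deg_le {D : ℕ} (hD3 : 3 ≤ D) (hD : G.DegBound D) (v : Fin N) :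
    deg (G.net.map e).graph v ≤ D := by
  have h1 := (G.net.map e).sum_cs (fun _ => 1) (fun x => if x = v then 1 else 0)
  have h2 := G.sum_ends_le (by exact_mod_cast hD3) hD (fun x => if e x = v then 1 else 0)
    (fun x => by split_ifs <;> norm_num)
  simp only [ite_mul, one_mul, zero_mul, Finset.sum_ite_eq', Finset.mem_univ, if_true] at h1
  rw [← (G.net.map e).deg_eq] at h1
  have h3 : ∑ x : G.Vert, (if e x = v then (1:ℝ) else 0) = 1 := by
    rw [Equiv.sum_comp e (fun x => if x = v then (1:ℝ) else 0)]; simp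
  rw [h3, mul_one] at h2
  have : ((deg (G.net.map e).graph v : ℕ) : ℝ) ≤ D := by rw [h1]; exact h2
  exact_mod_cast this

/-- number of vertices off the heaps in `bl` -/
def off (bl : Finset K) : ℕ := Fintype.card S + ∑ e, (G.len e - 1) + ∑ k ∈ blᶜ, G.hs k

/-- the vertices of the heaps in `bl` -/
def inBlob (bl : Finset K) (v : G.Vert) : Prop :=
  ∃ k ∈ bl, ∃ i, i < G.hs k ∧ v = G.hnode k i

lemma card_eq (bl : Finset K) : Fintype.card G.Vert = G.off bl + ∑ k ∈ bl, G.hs k := by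
  rw [card_vert, off, ← Finset.sum_add_sum_compl bl G.hs]; ring

lemma sum_off (bl : Finset K) [DecidablePred (G.inBlob bl)] :
    ∑ v, (if G.inBlob bl v then (0:ℝ) else 1) ≤ G.off bl := by
  rw [sum_vert, off]
  have h1 : ∀ x, (if G.inBlob bl x then (0:ℝ) else 1) ≤ 1 := fun x => by split_ifs <;> norm_num
  have h2 : ∑ x, (if G.inBlob bl (Sum.inl x) then (0:ℝ) else 1) ≤ Fintype.card S := by
    refine (Finset.sum_le_sum fun x _ => h1 _).trans ?_
    simp
  have h3 : ∑ e, ∑ p ∈ Finset.range (G.len e - 1),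
      (if G.inBlob bl (G.pos e (p + 1)) then (0:ℝ) else 1) ≤ ∑ e, ((G.len e - 1 : ℕ) : ℝ) := by
    refine Finset.sum_le_sum fun e _ => ?_
    refine (Finset.sum_le_sum fun x _ => h1 _).trans ?_
    simp
  have h4 : ∑ k, ∑ i ∈ Finset.range (G.hs k), (if G.inBlob bl (G.hnode k i) then (0:ℝ) else 1)
      ≤ ∑ k ∈ blᶜ, (G.hs k : ℝ) := by
    rw [← Finset.sum_add_sum_compl bl]
    have h5 : ∑ k ∈ bl, ∑ i ∈ Finset.range (G.hs k),
        (if G.inBlob bl (G.hnode k i) then (0:ℝ) else 1) = 0 := by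
      refine Finset.sum_eq_zero fun k hk => Finset.sum_eq_zero fun i hi => ?_
      rw [if_pos ⟨k, hk, i, Finset.mem_range.1 hi, rfl⟩]
    rw [h5, zero_add]
    refine Finset.sum_le_sum fun k _ => ?_
    refine (Finset.sum_le_sum fun x _ => h1 _).trans ?_
    simp
  push_cast
  linarith

lemma wts_one : G.wts (fun _ => 1) = fun _ => 1 := by
  funext i
  rcases i with ⟨e, i⟩ | i <;> rfl

lemma wts_mem {wt : E → ℝ} (hwt : ∀ e, 1 ≤ wt e ∧ wt e ≤ 4) (i : G.Edge) :
    1 ≤ G.wts wt i ∧ G.wts wt i ≤ 4 := by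
  rcases i with ⟨e, i⟩ | i
  · exact hwt e
  · norm_num [wts]

lemma card_edge_ge (bl : Finset K) (hq : 2 * G.off bl ≤ Fintype.card G.Vert) :
    Fintype.card G.Vert ≤ 2 * Fintype.card G.Edge := by
  have h1 : Fintype.card G.Edge = ∑ e, G.len e + ∑ k, G.hs k := G.card_edge
  have h2 := G.card_eq bl
  have h3 := Finset.sum_add_sum_compl bl G.hs
  omega

lemma sum_wSta_le {D : ℝ} (hD3 : 3 ≤ D) (hD : G.DegBound D) {bl : Finset K}
    (hq : 2 * G.off bl ≤ N) (hN : 0 < N)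
    {wt : E → ℝ} (hwt : ∀ e, 1 ≤ wt e ∧ wt e ≤ 4) (η : Fin N → ℝ) (hη : ∀ v, 0 ≤ η v) :
    ∑ v, wSta ((G.net.map e).ew (G.wts wt)) v * η v ≤ 4 * D * (∑ v, η v) / N := by
  have hcard : Fintype.card G.Vert = N := by rw [Fintype.card_congr e]; simp
  have h0 := G.card_edge_ge bl (by omega)
  rw [hcard] at h0
  have h0' : (N : ℝ) ≤ 2 * Fintype.card G.Edge := by exact_mod_cast h0
  rw [Net.sum_wSta]
  have h1 : (Fintype.card G.Edge : ℝ) ≤ ∑ i, G.wts wt i := by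
    have : ∑ _i : G.Edge, (1:ℝ) ≤ ∑ i, G.wts wt i :=
      Finset.sum_le_sum fun i _ => (G.wts_mem hwt i).1
    simpa using this
  have h2 := G.sum_ends_le hD3 hD (fun v => η (e v)) (fun v => hη _)
  have h3 : ∑ i, G.wts wt i * (η ((G.net.map e).s i) + η ((G.net.map e).t i))
      ≤ 4 * ∑ i, (η (e (G.net.s i)) + η (e (G.net.t i))) := by
    rw [Finset.mul_sum]
    refine Finset.sum_le_sum fun i _ => ?_
    exact mul_le_mul_of_nonneg_right (G.wts_mem hwt i).2 (add_nonneg (hη _) (hη _))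
  have h4 : ∑ v, η (e v) = ∑ v, η v := Equiv.sum_comp e η
  have hNr : (0:ℝ) < N := by exact_mod_cast hN
  have h5 : 0 ≤ ∑ v, η v := Finset.sum_nonneg fun v _ => hη v
  rw [h4] at h2
  have h6 : 0 ≤ 4 * D * ∑ v, η v := by positivity
  exact (div_le_div_of_nonneg_right (h3.trans (by linarith)) (by linarith)).trans
    (div_le_div_of_nonneg_left h6 hNr (by linarith))

/-- the skeleton inequality that makes an extension a supersolution off `Z` -/
def SkelSuper (wt : E → ℝ) (F : S → ℝ) (γ : E → ℝ) (κ : K → ℝ) (lam : ℝ) (Z : Set S) : Prop :=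
  ∀ y : S → ℝ, (∀ x, 0 ≤ y x) → (∀ x ∈ Z, y x = 0) →
    0 ≤ ∑ e, wt e * (y (G.src e) * ((F (G.src e) - F (G.dst e)) / G.len e
            - γ e * (G.len e - 1) - 2 * lam * F (G.src e))
          + y (G.dst e) * ((F (G.dst e) - F (G.src e)) / G.len e
            - γ e * (G.len e - 1) - 2 * lam * F (G.dst e)))
        - ∑ k, y (G.att k) * (F (G.att k) *
            (κ k * heapFlux (Nat.log 2 (G.hs k)) 0 + 2 * lam))

lemma super {wt : E → ℝ} (hwt : ∀ e, 1 ≤ wt e ∧ wt e ≤ 4) {F : S → ℝ} {γ : E → ℝ} {κ : K → ℝ}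
    {lam : ℝ} {Z : Set S}
    (hγ : ∀ e p, 0 < p → p < G.len e →
      2 * lam * pathVal (F (G.src e)) (F (G.dst e)) (γ e) (G.len e) p ≤ γ e)
    (hF : ∀ k, 0 ≤ F (G.att k))
    (hκ : ∀ k, 0 ≤ κ k ∨ ∃ H, G.hs k = 2 ^ (H + 1) - 1)
    (hh : ∀ k i, i < G.hs k → lam * (1 + κ k * heapPot (Nat.log 2 (G.hs k)) i) ≤ κ k)
    (hs : G.SkelSuper wt F γ κ lam Z) (v : Fin N) (hv : ∀ x ∈ Z, v ≠ e (Sum.inl x)) :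
    (wMat ((G.net.map e).ew (G.wts wt)) *ᵥ fun v => G.ext F γ κ (e.symm v)) v
      ≤ (1 - lam) * G.ext F γ κ (e.symm v) := by
  refine (G.net.map e).supersolution (φ := fun v => G.ext F γ κ (e.symm v))
    (fun i => by linarith [(G.wts_mem hwt i).1]) (G.net.map_covers e G.covers) fun η hη hηv => ?_
  have h1 := G.form_le (fun e => by linarith [(hwt e).1]) hγ hF hκ hh (fun x => η (e x))
    fun x => hη _
  refine (hs (fun x => η (e (Sum.inl x))) (fun x => hη _)
    fun x hx => hηv _ (hv x hx).symm).trans (h1.trans_eq ?_)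
  simp [Net.map]

lemma pathVal_ge {a b γ l p m : ℝ} (ha : m ≤ a) (hb : m ≤ b) (hγ : 0 ≤ γ) (hp : 0 ≤ p) (hl : p ≤ l)
    (hl0 : 0 < l) : m ≤ pathVal a b γ l p := by
  rw [pathVal]
  have h1 : 0 ≤ p / l := by positivity
  have h2 : p / l ≤ 1 := (div_le_one hl0).2 hl
  have h3 : 0 ≤ γ * p * (l - p) := mul_nonneg (mul_nonneg hγ hp) (by linarith)
  nlinarith

lemma pathVal_le {a b γ l p m : ℝ} (ha : a ≤ m) (hb : b ≤ m) (hγ : 0 ≤ γ) (hp : 0 ≤ p) (hl : p ≤ l)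
    (hl0 : 0 < l) : pathVal a b γ l p ≤ m + γ * l ^ 2 / 4 := by
  rw [pathVal]
  have h1 : 0 ≤ p / l := by positivity
  have h2 : p / l ≤ 1 := (div_le_one hl0).2 hl
  have h3 : γ * (p * (l - p)) ≤ γ * (l ^ 2 / 4) :=
    mul_le_mul_of_nonneg_left (by nlinarith [sq_nonneg (l - 2 * p)]) hγ
  nlinarith

lemma pow_log_le (k : K) : (2:ℝ) ^ (Nat.log 2 (G.hs k)) ≤ G.hs k := by
  have h := Nat.pow_log_le_self 2 (x := G.hs k) (by have := G.hs_pos k; omega)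
  exact_mod_cast h

lemma vert_cases (P : G.Vert → Prop) (h1 : ∀ e p, p ≤ G.len e → P (G.pos e p))
    (h2 : ∀ k i, i < G.hs k → P (G.hnode k i)) (v : G.Vert) : P v := by
  rcases v with x | ⟨e, p⟩ | ⟨k, i⟩
  · obtain ⟨e, rfl | rfl⟩ := G.cover x
    · exact G.pos_zero e ▸ h1 e 0 (by omega)
    · exact G.pos_len e ▸ h1 e _ le_rfl
  · rw [← pos_succ]
    exact h1 _ _ (by omega)
  · rw [← hnode_eq]
    exact h2 _ _ i.2

/-- upper bound for the distance to stationarity by a supersolution -/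
lemma upper {D : ℝ} (hD3 : 3 ≤ D) (hD : G.DegBound D) {bl : Finset K}
    (hq : 2 * G.off bl ≤ N) {wt : E → ℝ} (hwt : ∀ e, 1 ≤ wt e ∧ wt e ≤ 4) {F : S → ℝ} {γ : E → ℝ}
    {κ : K → ℝ} {lam B M : ℝ} {z : S} (hl0 : 0 < lam) (hl1 : lam ≤ 1)
    (hγ0 : ∀ e, 0 ≤ γ e) (hκ0 : ∀ k, 0 ≤ κ k) (hF1 : ∀ x, 1 ≤ F x)
    (hγ : ∀ e p, 0 < p → p < G.len e →
      2 * lam * pathVal (F (G.src e)) (F (G.dst e)) (γ e) (G.len e) p ≤ γ e)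
    (hh : ∀ k, lam * (1 + κ k * (16 * G.hs k)) ≤ κ k)
    (hs : G.SkelSuper wt F γ κ lam {z})
    (hBp : ∀ e p, p ≤ G.len e → pathVal (F (G.src e)) (F (G.dst e)) (γ e) (G.len e) p ≤ B)
    (hBh : ∀ k, F (G.att k) * (1 + κ k * (16 * G.hs k)) ≤ B)
    (hM : ∀ k ∈ bl, F (G.att k) * (1 + κ k * (16 * G.hs k)) ≤ M) (hM0 : 0 ≤ M)
    (t : ℕ) {u : ℕ} (hu : 0 < u) :
    dTV (wMat ((G.net.map e).ew (G.wts wt))) (wSta ((G.net.map e).ew (G.wts wt))) (t + u)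
      ≤ B * (1 - lam) ^ t + √((M + 4 * D * B * G.off bl / N) / (lam * u)) / 2 := by
  classical
  have : Nonempty (Fin N) := ⟨e (Sum.inl z)⟩
  have hN : 0 < N := Fin.pos_iff_nonempty.2 this
  have hL := (G.net.map e).lazyRev (c := G.wts wt)
    (fun i => by linarith [(G.wts_mem hwt i).1]) (G.net.map_covers e G.covers)
  have hpot : ∀ k i, i < G.hs k → heapPot (Nat.log 2 (G.hs k)) i ≤ 16 * G.hs k := fun k i _ =>
    (heapPot_le _ _).trans (by linarith [G.pow_log_le k])
  have hpot0 : ∀ k i, i < G.hs k → 0 ≤ heapPot (Nat.log 2 (G.hs k)) i := fun k i hi =>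
    heapPot_nonneg (log_lt_heap hi)
  have hnode : ∀ k i, i < G.hs k → G.ext F γ κ (G.hnode k i)
      ≤ F (G.att k) * (1 + κ k * (16 * G.hs k)) := by
    intro k i hi
    rw [G.ext_hnode _ _ _ _ hi]
    refine mul_le_mul_of_nonneg_left ?_ (by linarith [hF1 (G.att k)])
    linarith [mul_le_mul_of_nonneg_left (hpot k i hi) (hκ0 k)]
  have h1 : ∀ v, 1 ≤ G.ext F γ κ v := by
    refine G.vert_cases _ (fun e p hp => ?_) fun k i hi => ?_
    · rw [G.ext_pos _ _ _ _ hp]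
      have := G.two_le e
      exact pathVal_ge (hF1 _) (hF1 _) (hγ0 e) (by positivity) (by exact_mod_cast hp)
        (by positivity)
    · rw [G.ext_hnode _ _ _ _ hi]
      nlinarith [hF1 (G.att k), mul_nonneg (hκ0 k) (hpot0 k i hi)]
  have hB : ∀ v, G.ext F γ κ v ≤ B := by
    refine G.vert_cases _ (fun e p hp => ?_) fun k i hi => ?_
    · rw [G.ext_pos _ _ _ _ hp]; exact hBp e p hp
    · exact (hnode k i hi).trans (hBh k)
  have hB0 : 0 ≤ B := by linarith [h1 (Sum.inl z), hB (Sum.inl z)]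
  refine hL.upper (z := e (Sum.inl z)) (φ := fun v => G.ext F γ κ (e.symm v)) (fun v => h1 _)
    (fun v => hB _) ?_ hl0 hl1 ?_ t hu
  · have h2 : ∀ v, G.ext F γ κ (e.symm v) ≤ M + B * (if G.inBlob bl (e.symm v) then 0 else 1) := by
      intro v
      split_ifs with h
      · obtain ⟨k, hk, i, hi, hv⟩ := h
        rw [hv]
        linarith [hnode k i hi, hM k hk]
      · linarith [hB (e.symm v)]
    refine (Finset.sum_le_sum fun v _ => mul_le_mul_of_nonneg_left (h2 v) (hL.prob.1 v).le).trans ?_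
    have h3 : ∀ v, wSta ((G.net.map e).ew (G.wts wt)) v
        * (M + B * (if G.inBlob bl (e.symm v) then 0 else 1))
        = M * wSta ((G.net.map e).ew (G.wts wt)) v + B * (wSta ((G.net.map e).ew (G.wts wt)) v
          * (if G.inBlob bl (e.symm v) then 0 else 1)) := fun v => by ring
    simp only [h3]
    rw [Finset.sum_add_distrib, ← Finset.mul_sum, ← Finset.mul_sum, hL.prob.2, mul_one]
    have h4 := G.sum_wSta_le e hD3 hD hq hN hwt
      (fun v => if G.inBlob bl (e.symm v) then 0 else 1) fun v => by split_ifs <;> norm_num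
    rw [Equiv.sum_comp e.symm (fun v => if G.inBlob bl v then (0:ℝ) else 1)] at h4
    have h5 : 4 * D * (∑ v, (if G.inBlob bl v then (0:ℝ) else 1)) / N ≤ 4 * D * G.off bl / N :=
      div_le_div_of_nonneg_right (mul_le_mul_of_nonneg_left (G.sum_off bl) (by linarith))
        (by positivity)
    have h6 := mul_le_mul_of_nonneg_left (h4.trans h5) hB0
    have h7 : B * (4 * D * G.off bl / N) = 4 * D * B * G.off bl / N := by ring
    linarith
  · intro v hv
    refine G.super e hwt hγ (fun k => by linarith [hF1 (G.att k)]) (fun k => Or.inl (hκ0 k)) ?_ hs v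
      (by rintro x rfl; exact hv)
    intro k i hi
    refine le_trans ?_ (hh k)
    refine mul_le_mul_of_nonneg_left ?_ hl0.le
    linarith [mul_le_mul_of_nonneg_left (hpot k i hi) (hκ0 k)]

/-- lower bound for the distance to stationarity by a subsolution -/
lemma lower {D : ℝ} (hD3 : 3 ≤ D) (hD : G.DegBound D) {bl : Finset K}
    (hq : 2 * G.off bl ≤ N) {wt : E → ℝ} (hwt : ∀ e, 1 ≤ wt e ∧ wt e ≤ 4) {F : S → ℝ}
    {κ : K → ℝ} {lam : ℝ} (hl0 : 0 ≤ lam)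
    (hF0 : ∀ x, 0 ≤ F x) (hbl : ∀ k ∈ bl, F (G.att k) = 1 ∧ κ k = 0)
    (hκ : ∀ k, κ k ≤ 0 ∧ (0 ≤ κ k ∨ ∃ H, G.hs k = 2 ^ (H + 1) - 1))
    (hκ1 : ∀ k, -1 ≤ κ k * (16 * G.hs k))
    (hh : ∀ k, -lam * (1 + κ k * (16 * G.hs k)) ≤ κ k)
    (hs : G.SkelSuper wt F (fun _ => 0) κ (-lam) ∅) (t : ℕ) (x : S) :
    1 - 4 * D * G.off bl / N - (1 + lam) ^ t * F x ≤
    dTV (wMat ((G.net.map e).ew (G.wts wt))) (wSta ((G.net.map e).ew (G.wts wt))) t := by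
  classical
  have : Nonempty (Fin N) := ⟨e (Sum.inl x)⟩
  have hN : 0 < N := Fin.pos_iff_nonempty.2 this
  have hL := (G.net.map e).lazyRev (c := G.wts wt)
    (fun i => by linarith [(G.wts_mem hwt i).1]) (G.net.map_covers e G.covers)
  have hpot : ∀ k i, i < G.hs k → κ k * (16 * G.hs k) ≤ κ k * heapPot (Nat.log 2 (G.hs k)) i :=
    fun k i _ => mul_le_mul_of_nonpos_left
      ((heapPot_le _ _).trans (by linarith [G.pow_log_le k])) (hκ k).1
  have h0 : ∀ v, 0 ≤ G.ext F (fun _ => 0) κ v := by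
    refine G.vert_cases _ (fun e p hp => ?_) fun k i hi => ?_
    · rw [G.ext_pos _ _ _ _ hp]
      have := G.two_le e
      exact pathVal_ge (hF0 _) (hF0 _) le_rfl (by positivity) (by exact_mod_cast hp)
        (by positivity)
    · rw [G.ext_hnode _ _ _ _ hi]
      exact mul_nonneg (hF0 _) (by linarith [hpot k i hi, hκ1 k])
  have h1 := hL.lower (ψ := fun v => G.ext F (fun _ => 0) κ (e.symm v)) (lam := lam) (by linarith)
    (Finset.univ.filter fun v => G.inBlob bl (e.symm v)) (fun v => h0 _) ?_ ?_ t (e (Sum.inl x))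
  · have h2 : ∑ y ∈ Finset.univ.filter (fun v => G.inBlob bl (e.symm v)),
        wSta ((G.net.map e).ew (G.wts wt)) y = 1 - ∑ y, wSta ((G.net.map e).ew (G.wts wt)) y
          * (if G.inBlob bl (e.symm y) then 0 else 1) := by
      rw [eq_sub_iff_add_eq, Finset.sum_filter, ← Finset.sum_add_distrib]
      refine (Finset.sum_congr rfl fun v _ => ?_).trans hL.prob.2
      split_ifs <;> ring
    have h4 := G.sum_wSta_le e hD3 hD hq hN hwt
      (fun v => if G.inBlob bl (e.symm v) then 0 else 1) fun v => by split_ifs <;> norm_num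
    rw [Equiv.sum_comp e.symm (fun v => if G.inBlob bl v then (0:ℝ) else 1)] at h4
    have h5 : 4 * D * (∑ v, (if G.inBlob bl v then (0:ℝ) else 1)) / N ≤ 4 * D * G.off bl / N :=
      div_le_div_of_nonneg_right (mul_le_mul_of_nonneg_left (G.sum_off bl) (by linarith))
        (by positivity)
    rw [h2] at h1
    have h6 : G.ext F (fun _ => 0) κ (e.symm (e (Sum.inl x))) = F x := by simp [ext]
    rw [h6] at h1
    linarith
  · intro v hv
    obtain ⟨k, hk, i, hi, hv⟩ := (Finset.mem_filter.1 hv).2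
    rw [hv, G.ext_hnode _ _ _ _ hi, (hbl k hk).1, (hbl k hk).2]
    norm_num
  · intro v
    have h7 := G.super e hwt (F := F) (γ := fun _ => 0) (κ := κ) (lam := -lam) (Z := ∅) ?_
      (fun k => hF0 _) (fun k => (hκ k).2) ?_ hs v (by simp)
    · rwa [sub_neg_eq_add] at h7
    · intro e p hp0 hp
      have := G.two_le e
      have h8 : 0 ≤ pathVal (F (G.src e)) (F (G.dst e)) 0 (G.len e) p :=
        pathVal_ge (hF0 _) (hF0 _) le_rfl (by positivity) (by exact_mod_cast hp.le)
          (by positivity)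
      nlinarith
    · intro k i hi
      refine le_trans ?_ (hh k)
      nlinarith [hpot k i hi]

/-- relaxation time bounds for a gadget with two large heaps -/
lemma trel_bounds {D : ℝ} (hD3 : 3 ≤ D) (hD : G.DegBound D) {bl : Finset K}
    (hq : 2 * G.off bl ≤ N) (hcon : G.net.graph.Connected) {k₁ k₂ : K} (hk : k₁ ≠ k₂)
    {p : ℝ} (hp : 0 < p) (h1 : p * (D * N) ≤ G.hs k₁) (h2 : p * (D * N) ≤ G.hs k₂) {t : ℕ}
    (ht : dTV (walkMat (G.net.map e).graph) (degSta (G.net.map e).graph) t ≤ 1 / 4) :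
    2 * p ^ 2 * N ≤ trelG (G.net.map e).graph ∧ trelG (G.net.map e).graph ≤ 2 * t := by
  classical
  have hcard : Fintype.card G.Vert = N := by rw [Fintype.card_congr e]; simp
  have : Nonempty (Fin N) := ⟨e (Sum.inl (G.att k₁))⟩
  have h0 := G.card_edge_ge bl (by omega)
  rw [hcard] at h0
  have h0' : (N : ℝ) ≤ 2 * Fintype.card G.Edge := by exact_mod_cast h0
  have hDN : 2 * (Fintype.card G.Edge : ℝ) ≤ D * N := by
    have h := G.sum_ends_le hD3 hD (fun _ => 1) fun _ => zero_le_one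
    simp only [Finset.sum_const, Finset.card_univ, hcard, nsmul_eq_mul, mul_one] at h
    linarith
  set χ : Fin N → ℝ := fun v => if G.inBlob {k₁} (e.symm v) then 1 else 0 with hχ
  have hblob : ∀ k v, G.inBlob {k} v ↔ ∃ i, G.decHeap v = some (k, i) := by
    intro k v
    constructor
    · rintro ⟨k', hk', i, hi, rfl⟩
      rw [Finset.mem_singleton] at hk'
      subst hk'
      exact ⟨i, G.decHeap_hnode hi⟩
    · rintro ⟨i, hi⟩
      rcases v with x | ⟨e, p⟩ | ⟨k', j⟩
      · simp [decHeap] at hi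
      · simp [decHeap] at hi
      · simp only [decHeap, Option.some.injEq, Prod.mk.injEq] at hi
        obtain ⟨rfl, rfl⟩ := hi
        exact ⟨_, by simp, j, j.2, (G.hnode_eq _ j).symm⟩
  have hχs : ∀ k (i : Fin (G.hs k)), χ ((G.net.map e).s (Sum.inr ⟨k, i⟩)) = if k = k₁ then 1 else 0 := by
    intro k i
    have : e.symm ((G.net.map e).s (Sum.inr ⟨k, i⟩)) = G.hnode k i := by simp [Net.map, net]
    simp only [hχ, this, hblob, G.decHeap_hnode i.2]
    simp
  have hχ01 : ∀ v, 0 ≤ χ v ∧ χ v ≤ 1 := fun v => by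
    simp only [hχ]; split_ifs <;> norm_num
  have key : ∀ (g : Fin N → ℝ), (∀ v, 0 ≤ g v) → ∀ k, (∀ i : Fin (G.hs k),
      g ((G.net.map e).s (Sum.inr ⟨k, i⟩)) = 1) →
      (G.hs k : ℝ) ≤ ∑ i, (g ((G.net.map e).s i) + g ((G.net.map e).t i)) := by
    intro g hg k hgk
    rw [Fintype.sum_sum_type, Fintype.sum_sigma (f := fun x : (k : K) × Fin (G.hs k) => _)]
    have e1 : (G.hs k : ℝ) ≤ ∑ i : Fin (G.hs k),
        (g ((G.net.map e).s (Sum.inr ⟨k, i⟩)) + g ((G.net.map e).t (Sum.inr ⟨k, i⟩))) := by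
      have : ∑ _i : Fin (G.hs k), (1:ℝ) ≤ ∑ i : Fin (G.hs k),
        (g ((G.net.map e).s (Sum.inr ⟨k, i⟩)) + g ((G.net.map e).t (Sum.inr ⟨k, i⟩))) :=
        Finset.sum_le_sum fun i _ => by rw [hgk i]; linarith [hg ((G.net.map e).t (Sum.inr ⟨k, i⟩))]
      simpa using this
    have e2 := Finset.single_le_sum (f := fun k => ∑ i : Fin (G.hs k),
        (g ((G.net.map e).s (Sum.inr ⟨k, i⟩)) + g ((G.net.map e).t (Sum.inr ⟨k, i⟩))))
      (fun k _ => Finset.sum_nonneg fun i _ => add_nonneg (hg _) (hg _)) (Finset.mem_univ k)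
    have e3 : 0 ≤ ∑ i : (e : E) × Fin (G.len e), (g ((G.net.map e).s (Sum.inl i))
        + g ((G.net.map e).t (Sum.inl i))) :=
      Finset.sum_nonneg fun i _ => add_nonneg (hg _) (hg _)
    linarith
  have h3 := (G.net.map e).trel_bounds (G.net.map_covers e G.covers) (G.net.map_connected e hcon)
    χ (fun v => by simp only [hχ]; split_ifs <;> simp) (i₀ := Sum.inr ⟨k₁, ⟨0, G.hs_pos k₁⟩⟩) ?_ hp
    ?_ ?_ ht
  · refine ⟨le_trans ?_ h3.1, h3.2⟩
    have := mul_le_mul_of_nonneg_left h0' (by positivity : 0 ≤ 2 * p ^ 2)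
    linarith
  · intro i hi
    rcases i with ⟨f, i⟩ | ⟨k, i⟩
    · simp [hχ, Net.map, net, hblob, decHeap_pos]
    · have h0 : ¬ (k = k₁ ∧ (i : ℕ) = 0) := by
        rintro ⟨rfl, h⟩
        exact hi (by congr; exact Fin.ext h)
      simp only [hχ, Net.map, net, hblob, Equiv.symm_apply_apply, G.decHeap_hnode i.2,
        G.decHeap_hpar i.2]
      by_cases hk' : k = k₁ <;> by_cases hi' : (i : ℕ) = 0 <;> (simp [hk', hi']; try tauto)
  · refine le_trans (le_trans ?_ h1) (key χ (fun v => (hχ01 v).1) k₁ fun i => by rw [hχs]; simp)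
    exact mul_le_mul_of_nonneg_left hDN hp.le
  · refine le_trans (le_trans ?_ h2) (key (fun v => 1 - χ v) (fun v => by linarith [(hχ01 v).2]) k₂
      fun i => by rw [hχs]; simp [hk.symm])
    exact mul_le_mul_of_nonneg_left hDN hp.le

end Gad

end GadgetWalks


/-! ### The strip -/

section Strip

/-- horizontal coordinate after a step to the right or to the left in a strip of width `W` -/
def stepTo (W : ℕ) (b : Bool) (Y : ℕ) : ℕ := if b then min (Y + 1) W else Y - 1

lemma stepTo_le {W Y : ℕ} (b : Bool) (hY : Y ≤ W) : stepTo W b Y ≤ W := by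
  cases b <;> simp [stepTo]; omega

lemma sum_stepTo (W : ℕ) (G : ℕ → ℝ) :
    ∑ Y ∈ Finset.range (W + 1), (G (stepTo W true Y) + G (stepTo W false Y))
      = 2 * ∑ Y ∈ Finset.range (W + 1), G Y := by
  have h1 : ∑ Y ∈ Finset.range (W + 1), G (stepTo W true Y)
      = ∑ Y ∈ Finset.range W, G (Y + 1) + G W := by
    rw [Finset.sum_range_succ]
    congr 1
    · refine Finset.sum_congr rfl fun Y hY => ?_
      have := Finset.mem_range.1 hY
      simp only [stepTo, if_true]
      rw [min_eq_left (by omega)]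
    · simp [stepTo]
  have h2 : ∑ Y ∈ Finset.range (W + 1), G (stepTo W false Y)
      = ∑ Y ∈ Finset.range W, G Y + G 0 := by
    rw [Finset.sum_range_succ']
    congr 1
  rw [Finset.sum_add_distrib, h1, h2, two_mul]
  nth_rewrite 1 [Finset.sum_range_succ']
  rw [Finset.sum_range_succ]
  ring

/-- parameters of a strip -/
structure StripPar where
  /-- number of levels -/
  L : ℕ
  /-- width -/
  W : ℕ
  /-- inverse drift -/
  a : ℕ
  /-- unit length of a level -/
  U : ℕ → ℕ
  /-- heights of the heaps on the left side -/
  ht : ℕ → ℕ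
  /-- sizes of the two heaps at the bottom left corner -/
  bs : Bool → ℕ
  hL : 1 ≤ L
  hW : 1 ≤ W
  ha : 2 ≤ a
  hU : ∀ j, 1 ≤ U j
  hbs : ∀ i, 1 ≤ bs i

namespace StripPar

variable (p : StripPar)

/-- nodes of the strip -/
abbrev Node : Type := Fin (p.L + 1) × Fin (p.W + 1)

/-- skeleton edges of the strip -/
abbrev SEdge : Type := (Fin p.L × Fin (p.W + 1) × Bool) ⊕ Fin p.W

/-- heaps of the strip -/
abbrev SHeap : Type := Fin p.L ⊕ Bool

/-- length of the path leaving the node `(j, Y)` in direction `b` -/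
def plen (j Y : ℕ) (b : Bool) : ℕ :=
  (if b then p.a else if Y < p.W then p.a + 1 else p.a * (p.a + 1)) * p.U j

lemma plen_ge (j Y : ℕ) (b : Bool) : 2 ≤ p.plen j Y b := by
  have h1 := p.ha
  have h2 := p.hU j
  rw [plen]
  have h3 : 2 ≤ (if b then p.a else if Y < p.W then p.a + 1 else p.a * (p.a + 1)) := by
    split_ifs <;> nlinarith
  nlinarith

/-- a node from natural coordinates -/
def node (j Y : ℕ) (hj : j ≤ p.L) (hY : Y ≤ p.W) : p.Node :=
  (⟨j, Nat.lt_succ_of_le hj⟩, ⟨Y, Nat.lt_succ_of_le hY⟩)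

/-- the bottom left corner -/
def corner : p.Node := p.node p.L 0 le_rfl (Nat.zero_le _)

/-- the strip as a gadget graph -/
def gad : Gad p.Node p.SEdge p.SHeap where
  src e := match e with
    | Sum.inl (j, Y, _) => (j.castSucc, Y)
    | Sum.inr Y => (Fin.last _, Y.castSucc)
  dst e := match e with
    | Sum.inl (j, Y, b) => (j.succ, ⟨stepTo p.W b Y,
        Nat.lt_succ_of_le (stepTo_le b (Nat.le_of_lt_succ Y.2))⟩)
    | Sum.inr Y => (Fin.last _, Y.succ)
  src_ne e := by
    rcases e with ⟨j, Y, b⟩ | Y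
    · intro h
      have := congrArg (fun x => (x.1 : ℕ)) h
      simp at this
    · intro h
      have := congrArg (fun x => (x.2 : ℕ)) h
      simp at this
  len e := match e with
    | Sum.inl (j, Y, b) => p.plen j Y b
    | Sum.inr _ => 2
  two_le e := by
    rcases e with ⟨j, Y, b⟩ | Y
    · exact p.plen_ge _ _ _
    · exact le_rfl
  att k := match k with
    | Sum.inl j => (j.castSucc, 0)
    | Sum.inr _ => p.corner
  hs k := match k with
    | Sum.inl j => 2 ^ (p.ht j + 1) - 1
    | Sum.inr i => p.bs i
  hs_pos k := by
    rcases k with j | i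
    · have : 2 ^ (p.ht j + 1) = 2 * 2 ^ p.ht j := by rw [pow_succ]; ring
      have h2 : 0 < 2 ^ p.ht j := by positivity
      simp only
      omega
    · exact p.hbs i
  cover x := by
    obtain ⟨j, Y⟩ := x
    rcases Fin.eq_castSucc_or_eq_last j with ⟨j, rfl⟩ | rfl
    · exact ⟨Sum.inl (j, Y, true), Or.inl rfl⟩
    · rcases Fin.eq_castSucc_or_eq_last Y with ⟨Y, rfl⟩ | rfl
      · exact ⟨Sum.inr Y, Or.inl rfl⟩
      · refine ⟨Sum.inr ⟨p.W - 1, by have := p.hW; omega⟩, Or.inr ?_⟩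
        ext
        · rfl
        · simp [Nat.sub_add_cancel p.hW]

/-- a function on nodes as a function of natural coordinates -/
def nat (y : p.Node → ℝ) (j Y : ℕ) : ℝ :=
  if h : j ≤ p.L ∧ Y ≤ p.W then y (p.node j Y h.1 h.2) else 0

lemma nat_eq (y : p.Node → ℝ) (x : p.Node) : y x = p.nat y x.1 x.2 := by
  rw [nat, dif_pos ⟨by omega, by omega⟩]; rfl

lemma nat_nonneg {y : p.Node → ℝ} (hy : ∀ x, 0 ≤ y x) (j Y : ℕ) : 0 ≤ p.nat y j Y := by
  rw [nat]; split_ifs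
  · exact hy _
  · exact le_rfl

lemma sum_sedge (X : p.SEdge → ℝ) (A : ℕ → ℕ → Bool → ℝ) (B : ℕ → ℝ)
    (hA : ∀ j Y b, X (Sum.inl (j, Y, b)) = A j Y b) (hB : ∀ Y, X (Sum.inr Y) = B Y) :
    ∑ e, X e = ∑ j ∈ Finset.range p.L, ∑ Y ∈ Finset.range (p.W + 1), (A j Y true + A j Y false)
      + ∑ Y ∈ Finset.range p.W, B Y := by
  rw [Fintype.sum_sum_type, Fintype.sum_prod_type]
  simp only [Fintype.sum_prod_type, Fintype.sum_bool, hA, hB, Finset.sum_range]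

lemma sum_sheap (X : p.SHeap → ℝ) (A : ℕ → ℝ) (hA : ∀ j, X (Sum.inl j) = A j) :
    ∑ k, X k = ∑ j ∈ Finset.range p.L, A j + (X (Sum.inr true) + X (Sum.inr false)) := by
  rw [Fintype.sum_sum_type, Fintype.sum_bool]
  simp only [hA, Finset.sum_range]

lemma sum_node (y : p.Node → ℝ) :
    ∑ x, y x = ∑ j ∈ Finset.range (p.L + 1), ∑ Y ∈ Finset.range (p.W + 1), p.nat y j Y := by
  rw [Fintype.sum_prod_type]
  simp only [Finset.sum_range]
  exact Finset.sum_congr rfl fun j _ => Finset.sum_congr rfl fun Y _ => p.nat_eq y (j, Y)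

lemma degBound : p.gad.DegBound (9 : ℕ) := by
  intro y hy
  have hn := p.nat_nonneg hy
  rw [p.sum_sedge _ (fun j Y b => p.nat y j Y + p.nat y (j + 1) (stepTo p.W b Y))
    (fun Y => p.nat y p.L Y + p.nat y p.L (Y + 1))
    (fun j Y b => by rw [p.nat_eq y, p.nat_eq y]; rfl)
    (fun Y => by rw [p.nat_eq y, p.nat_eq y]; rfl),
    p.sum_sheap _ (fun j => p.nat y j 0) (fun j => by rw [p.nat_eq y]; rfl), sum_node]
  have hc : ∀ b, y (p.gad.att (Sum.inr b)) = p.nat y p.L 0 := fun b => by rw [p.nat_eq y]; rfl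
  rw [hc, hc]
  set S := ∑ j ∈ Finset.range (p.L + 1), ∑ Y ∈ Finset.range (p.W + 1), p.nat y j Y with hS
  have row0 : ∀ j, 0 ≤ ∑ Y ∈ Finset.range (p.W + 1), p.nat y j Y := fun j =>
    Finset.sum_nonneg fun Y _ => hn _ _
  have hS1 : S = ∑ j ∈ Finset.range p.L, ∑ Y ∈ Finset.range (p.W + 1), p.nat y j Y
      + ∑ Y ∈ Finset.range (p.W + 1), p.nat y p.L Y := Finset.sum_range_succ _ _
  have hS2 : S = ∑ j ∈ Finset.range p.L, ∑ Y ∈ Finset.range (p.W + 1), p.nat y (j + 1) Y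
      + ∑ Y ∈ Finset.range (p.W + 1), p.nat y 0 Y := Finset.sum_range_succ' _ _
  have hL0 : 0 ≤ ∑ j ∈ Finset.range p.L, ∑ Y ∈ Finset.range (p.W + 1), p.nat y j Y :=
    Finset.sum_nonneg fun j _ => row0 j
  have h1 : ∑ j ∈ Finset.range p.L, ∑ Y ∈ Finset.range (p.W + 1),
      (p.nat y j Y + p.nat y (j + 1) (stepTo p.W true Y)
        + (p.nat y j Y + p.nat y (j + 1) (stepTo p.W false Y)))
      = 2 * ∑ j ∈ Finset.range p.L, ∑ Y ∈ Finset.range (p.W + 1), p.nat y j Y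
      + 2 * ∑ j ∈ Finset.range p.L, ∑ Y ∈ Finset.range (p.W + 1), p.nat y (j + 1) Y := by
    rw [Finset.mul_sum, Finset.mul_sum, ← Finset.sum_add_distrib]
    refine Finset.sum_congr rfl fun j _ => ?_
    rw [← sum_stepTo p.W (fun Y => p.nat y (j + 1) Y), Finset.mul_sum, ← Finset.sum_add_distrib]
    exact Finset.sum_congr rfl fun Y _ => by ring
  have h2 : ∑ Y ∈ Finset.range p.W, (p.nat y p.L Y + p.nat y p.L (Y + 1))
      ≤ 2 * ∑ Y ∈ Finset.range (p.W + 1), p.nat y p.L Y := by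
    rw [Finset.sum_add_distrib, two_mul]
    refine add_le_add ?_ ?_
    · rw [Finset.sum_range_succ]; linarith [hn p.L p.W]
    · rw [Finset.sum_range_succ']; linarith [hn p.L 0]
  have h3 : ∑ j ∈ Finset.range p.L, p.nat y j 0
      ≤ ∑ j ∈ Finset.range p.L, ∑ Y ∈ Finset.range (p.W + 1), p.nat y j Y :=
    Finset.sum_le_sum fun j _ => Finset.single_le_sum (f := fun Y => p.nat y j Y)
      (fun Y _ => hn _ _) (by simp)
  have h4 : p.nat y p.L 0 ≤ ∑ Y ∈ Finset.range (p.W + 1), p.nat y p.L Y :=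
    Finset.single_le_sum (f := fun Y => p.nat y p.L Y) (fun Y _ => hn _ _) (by simp)
  rw [h1]
  push_cast
  linarith [row0 p.L, row0 0]

lemma connected : p.gad.net.graph.Connected := by
  refine p.gad.connected_of (z := p.corner) fun R hz he => ?_
  have hrow : ∀ Y (hY : Y ≤ p.W), R (p.node p.L Y le_rfl hY) := by
    intro Y
    induction Y with
    | zero => exact fun _ => hz
    | succ Y ih =>
      intro hY
      exact (he (Sum.inr ⟨Y, by omega⟩)).1 (ih (by omega))
  have hall : ∀ i, ∀ j, j + i = p.L → ∀ (hj : j ≤ p.L) Y (hY : Y ≤ p.W), R (p.node j Y hj hY) := by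
    intro i
    induction i with
    | zero => rintro j rfl _ Y hY; exact hrow Y hY
    | succ i ih =>
      intro j hj hj' Y hY
      exact (he (Sum.inl (⟨j, by omega⟩, ⟨Y, by omega⟩, true))).2
        (ih (j + 1) (by omega) (by omega) _ (stepTo_le true hY))
  intro x
  exact hall (p.L - x.1) x.1 (by omega) (by omega) x.2 (by omega)

/-- edge weights depending on the horizontal coordinate and on the direction -/
def wt (w : ℕ → Bool → ℝ) : p.SEdge → ℝ
  | Sum.inl (_, Y, b) => w Y b
  | Sum.inr _ => 1

/-- curvatures on the paths -/
def gam (γ : ℕ → ℕ → Bool → ℝ) (γr : ℝ) : p.SEdge → ℝ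
  | Sum.inl (j, Y, b) => γ j Y b
  | Sum.inr _ => γr

/-- heap parameters -/
def kap (κ κb : ℝ) : p.SHeap → ℝ
  | Sum.inl _ => κ
  | Sum.inr _ => κb

/-- a supersolution of the skeleton inequality from local inequalities with tolls `T` -/
lemma skelSuper {w : ℕ → Bool → ℝ} {F T : ℕ → ℕ → ℝ} {γ : ℕ → ℕ → Bool → ℝ} {γr κ κb lam : ℝ}
    {Z : ℕ → ℕ → Prop}
    (hT0 : ∀ Y ≤ p.W, 0 ≤ T 0 Y)
    (hin : ∀ j < p.L, ∀ Y ≤ p.W, ∀ b, ¬ Z (j + 1) (stepTo p.W b Y) →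
      -T (j + 1) (stepTo p.W b Y) ≤ w Y b * ((F (j + 1) (stepTo p.W b Y) - F j Y) / p.plen j Y b
        - γ j Y b * (p.plen j Y b - 1) - 2 * lam * F (j + 1) (stepTo p.W b Y)))
    (hout : ∀ j < p.L, ∀ Y ≤ p.W,
      2 * T j Y + (if Y = 0 then F j 0 * (κ * (8 * 2 ^ p.ht j - 6) + 2 * lam) else 0)
      ≤ w Y true * ((F j Y - F (j + 1) (stepTo p.W true Y)) / p.plen j Y true
        - γ j Y true * (p.plen j Y true - 1) - 2 * lam * F j Y)
      + w Y false * ((F j Y - F (j + 1) (stepTo p.W false Y)) / p.plen j Y false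
        - γ j Y false * (p.plen j Y false - 1) - 2 * lam * F j Y))
    (hrim : ∀ y : ℕ → ℝ, (∀ Y, 0 ≤ y Y) → (∀ Y, Z p.L Y → y Y = 0) →
      2 * ∑ Y ∈ Finset.range (p.W + 1), y Y * T p.L Y
        + (y 0 * (F p.L 0 * (κb * heapFlux (Nat.log 2 (p.bs true)) 0 + 2 * lam))
          + y 0 * (F p.L 0 * (κb * heapFlux (Nat.log 2 (p.bs false)) 0 + 2 * lam)))
      ≤ ∑ Y ∈ Finset.range p.W,
        (y Y * ((F p.L Y - F p.L (Y + 1)) / 2 - γr - 2 * lam * F p.L Y)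
          + y (Y + 1) * ((F p.L (Y + 1) - F p.L Y) / 2 - γr - 2 * lam * F p.L (Y + 1)))) :
    p.gad.SkelSuper (p.wt w) (fun x => F x.1 x.2) (p.gam γ γr) (p.kap κ κb) lam
      {x | Z x.1 x.2} := by
  intro y hy hZ
  have hn := p.nat_nonneg hy
  have hZ' : ∀ j Y, Z j Y → p.nat y j Y = 0 := by
    intro j Y h
    rw [nat]; split_ifs with h'
    · exact hZ _ h
    · rfl
  rw [p.sum_sedge _ (fun j Y b => w Y b * (p.nat y j Y * ((F j Y - F (j + 1) (stepTo p.W b Y))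
          / p.plen j Y b - γ j Y b * (p.plen j Y b - 1) - 2 * lam * F j Y)
        + p.nat y (j + 1) (stepTo p.W b Y) * ((F (j + 1) (stepTo p.W b Y) - F j Y) / p.plen j Y b
          - γ j Y b * (p.plen j Y b - 1) - 2 * lam * F (j + 1) (stepTo p.W b Y))))
    (fun Y => p.nat y p.L Y * ((F p.L Y - F p.L (Y + 1)) / 2 - γr - 2 * lam * F p.L Y)
          + p.nat y p.L (Y + 1) * ((F p.L (Y + 1) - F p.L Y) / 2 - γr
            - 2 * lam * F p.L (Y + 1)))
    (fun j Y b => by rw [p.nat_eq y, p.nat_eq y]; rfl)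
    (fun Y => by
      rw [p.nat_eq y, p.nat_eq y]
      simp only [gad, wt, gam, Fin.val_last, Fin.val_castSucc, Fin.val_succ]
      push_cast; ring),
    p.sum_sheap _ (fun j => p.nat y j 0 * (F j 0 * (κ * (8 * 2 ^ p.ht j - 6) + 2 * lam)))
    (fun j => by
      rw [p.nat_eq y]
      have : Nat.log 2 (2 ^ (p.ht j + 1) - 1) = p.ht j := by
        have h1 : 2 ^ (p.ht j + 1) = 2 * 2 ^ p.ht j := by rw [pow_succ]; ring
        have h2 : 0 < 2 ^ p.ht j := by positivity
        exact Nat.log_eq_of_pow_le_of_lt_pow (by omega) (by omega)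
      simp only [gad, kap, Fin.val_castSucc, this, heapFlux, Nat.sub_zero, Fin.val_zero])]
  have hc : ∀ b, y (p.gad.att (Sum.inr b)) * (F (p.gad.att (Sum.inr b)).1 (p.gad.att (Sum.inr b)).2
      * (p.kap κ κb (Sum.inr b) * heapFlux (Nat.log 2 (p.gad.hs (Sum.inr b))) 0 + 2 * lam))
      = p.nat y p.L 0 * (F p.L 0 * (κb * heapFlux (Nat.log 2 (p.bs b)) 0 + 2 * lam)) := fun b => by
    rw [p.nat_eq y]; rfl
  rw [hc, hc]
  have h1 := hrim (p.nat y p.L) (hn p.L) (hZ' p.L)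
  have hrow : ∀ j ∈ Finset.range p.L,
      2 * ∑ Y ∈ Finset.range (p.W + 1), p.nat y j Y * T j Y
        - 2 * ∑ Y ∈ Finset.range (p.W + 1), p.nat y (j + 1) Y * T (j + 1) Y
        + p.nat y j 0 * (F j 0 * (κ * (8 * 2 ^ p.ht j - 6) + 2 * lam))
      ≤ ∑ Y ∈ Finset.range (p.W + 1),
        (w Y true * (p.nat y j Y * ((F j Y - F (j + 1) (stepTo p.W true Y))
          / p.plen j Y true - γ j Y true * (p.plen j Y true - 1) - 2 * lam * F j Y)
        + p.nat y (j + 1) (stepTo p.W true Y) * ((F (j + 1) (stepTo p.W true Y) - F j Y)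
          / p.plen j Y true
          - γ j Y true * (p.plen j Y true - 1) - 2 * lam * F (j + 1) (stepTo p.W true Y)))
        + w Y false * (p.nat y j Y * ((F j Y - F (j + 1) (stepTo p.W false Y))
          / p.plen j Y false - γ j Y false * (p.plen j Y false - 1) - 2 * lam * F j Y)
        + p.nat y (j + 1) (stepTo p.W false Y) * ((F (j + 1) (stepTo p.W false Y) - F j Y)
          / p.plen j Y false
          - γ j Y false * (p.plen j Y false - 1)
          - 2 * lam * F (j + 1) (stepTo p.W false Y)))) := by
    intro j hj
    have hj := Finset.mem_range.1 hj
    rw [← sum_stepTo p.W (fun Y => p.nat y (j + 1) Y * T (j + 1) Y)]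
    have e1 : p.nat y j 0 * (F j 0 * (κ * (8 * 2 ^ p.ht j - 6) + 2 * lam))
        = ∑ Y ∈ Finset.range (p.W + 1), p.nat y j Y * (if Y = 0 then
          F j 0 * (κ * (8 * 2 ^ p.ht j - 6) + 2 * lam) else 0) := by
      rw [Finset.sum_eq_single 0]
      · simp
      · intro Y _ hY; simp [hY]
      · simp
    rw [e1, Finset.mul_sum, ← Finset.sum_sub_distrib, ← Finset.sum_add_distrib]
    refine Finset.sum_le_sum fun Y hY => ?_
    have hY : Y ≤ p.W := Nat.le_of_lt_succ (Finset.mem_range.1 hY)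
    have ho := mul_le_mul_of_nonneg_left (hout j hj Y hY) (hn j Y)
    have hi : ∀ b, p.nat y (j + 1) (stepTo p.W b Y) * (-T (j + 1) (stepTo p.W b Y))
        ≤ p.nat y (j + 1) (stepTo p.W b Y) *
        (w Y b * ((F (j + 1) (stepTo p.W b Y) - F j Y) / p.plen j Y b
        - γ j Y b * (p.plen j Y b - 1) - 2 * lam * F (j + 1) (stepTo p.W b Y))) := by
      intro b
      by_cases hz : Z (j + 1) (stepTo p.W b Y)
      · rw [hZ' _ _ hz]; simp
      · exact mul_le_mul_of_nonneg_left (hin j hj Y hY b hz) (hn _ _)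
    have h2 := hi true
    have h3 := hi false
    linarith
  have h2 := Finset.sum_le_sum hrow
  rw [Finset.sum_add_distrib] at h2
  have h3 : ∑ j ∈ Finset.range p.L, (2 * ∑ Y ∈ Finset.range (p.W + 1), p.nat y j Y * T j Y
        - 2 * ∑ Y ∈ Finset.range (p.W + 1), p.nat y (j + 1) Y * T (j + 1) Y)
      = 2 * ∑ Y ∈ Finset.range (p.W + 1), p.nat y 0 Y * T 0 Y
        - 2 * ∑ Y ∈ Finset.range (p.W + 1), p.nat y p.L Y * T p.L Y :=
    Finset.sum_range_sub' (fun j => 2 * ∑ Y ∈ Finset.range (p.W + 1), p.nat y j Y * T j Y) p.L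
  have h4 : 0 ≤ ∑ Y ∈ Finset.range (p.W + 1), p.nat y 0 Y * T 0 Y :=
    Finset.sum_nonneg fun Y hY => mul_nonneg (hn _ _)
      (hT0 Y (Nat.le_of_lt_succ (Finset.mem_range.1 hY)))
  rw [h3] at h2
  linarith

end StripPar

end Strip


/-! ### Upper bound for the mixing time on the strip -/

section StripUpper

namespace StripPar

/-- length of a path of the strip in units of its level -/
def cl (p : StripPar) (Y : ℕ) (b : Bool) : ℝ :=
  if b then p.a else if Y < p.W then p.a + 1 else p.a * (p.a + 1)

lemma plen_cast (p : StripPar) (j Y : ℕ) (b : Bool) : (p.plen j Y b : ℝ) = p.cl Y b * p.U j := by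
  rw [plen, cl]; split_ifs <;> push_cast <;> ring

lemma cl_ge (p : StripPar) (Y : ℕ) (b : Bool) : 1 ≤ p.cl Y b := by
  have h : (2:ℝ) ≤ p.a := by exact_mod_cast p.ha
  rw [cl]; split_ifs <;> nlinarith

lemma cl_le (p : StripPar) (Y : ℕ) (b : Bool) : p.cl Y b ≤ p.a * (p.a + 1) := by
  have h : (2:ℝ) ≤ p.a := by exact_mod_cast p.ha
  rw [cl]; split_ifs <;> nlinarith

/-- a strip with geometrically decreasing levels, with the scales `K`, `m`, `s`, `ρ` -/
structure Std (p : StripPar) (K m s ρ : ℝ) : Prop where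
  hρ : ∀ j < p.L, (p.U (j + 1) : ℝ) = ρ * p.U j
  hs : ∀ j < p.L, 8 * (2:ℝ) ^ p.ht j * p.U j = s
  hU2 : ∀ j, (p.U j : ℝ) ≤ m ^ 2
  hU1 : ∀ j ≤ p.L, m ≤ (p.U j : ℝ)
  hK : 16 ≤ K
  haK : (p.a : ℝ) ≤ K
  hWK : (p.W : ℝ) ≤ K
  hKm : K ^ 12 ≤ m
  hms : 8 * m ^ 10 ≤ s
  hbl : ∀ b, (p.bs b : ℝ) ≤ 2 * (p.a:ℝ) ^ 2 * s

variable {p : StripPar} {K m s ρ : ℝ}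

namespace Std

lemma m_big (hp : p.Std K m s ρ) : 10 ^ 12 ≤ m := by
  have h : (16:ℝ) ^ 12 ≤ K ^ 12 := pow_le_pow_left₀ (by norm_num) hp.hK 12
  linarith [hp.hKm, (by norm_num : (10:ℝ) ^ 12 ≤ 16 ^ 12)]

lemma s_pos (hp : p.Std K m s ρ) : 0 < s := by
  have h := hp.m_big
  have h2 : 0 < m ^ 10 := by positivity
  linarith [hp.hms]

lemma U_pos (_ : p.Std K m s ρ) (j : ℕ) : (1:ℝ) ≤ p.U j := by exact_mod_cast p.hU j

lemma K_le (hp : p.Std K m s ρ) : 10000 * K ^ 2 ≤ m := by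
  have hK := hp.hK
  have h10 : (16:ℝ) ^ 10 ≤ K ^ 10 := pow_le_pow_left₀ (by norm_num) hK 10
  have h2 : 0 < K ^ 2 := by positivity
  have e : K ^ 12 = K ^ 10 * K ^ 2 := by ring
  have := hp.hKm
  rw [e] at this
  nlinarith

lemma plen_le (hp : p.Std K m s ρ) (j Y : ℕ) (b : Bool) : (p.plen j Y b : ℝ) ≤ m ^ 3 / 5000 := by
  have h1 := p.cl_le Y b
  have h2 := hp.haK
  have h3 := hp.hK
  have h4 : (p.a : ℝ) * (p.a + 1) ≤ 2 * K ^ 2 := by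
    have : (0:ℝ) ≤ p.a := Nat.cast_nonneg _
    nlinarith
  rw [plen_cast]
  have h5 := hp.hU2 j
  have h6 := hp.U_pos j
  have h7 := hp.K_le
  have h8 := hp.m_big
  calc p.cl Y b * p.U j ≤ (2 * K ^ 2) * m ^ 2 :=
        mul_le_mul (h1.trans h4) h5 (by linarith) (by positivity)
    _ ≤ (m / 5000) * m ^ 2 := by gcongr; linarith
    _ = m ^ 3 / 5000 := by ring

lemma lam_plen (hp : p.Std K m s ρ) {lam : ℝ} (h0 : 0 ≤ lam) (hl : lam * s ≤ 1) (j Y : ℕ) (b : Bool)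
    {x : ℝ} (hx0 : 0 ≤ x) (hx : x ≤ m ^ 3) :
    lam * p.plen j Y b * x ≤ 1 / (40000 * m ^ 4) := by
  have h1 := hp.plen_le j Y b
  have h2 := hp.m_big
  have h3 : lam * (8 * m ^ 10) ≤ 1 := (mul_le_mul_of_nonneg_left hp.hms h0).trans hl
  have h4 : (p.plen j Y b : ℝ) * x ≤ m ^ 3 / 5000 * m ^ 3 :=
    mul_le_mul h1 hx hx0 (by positivity)
  rw [le_div_iff₀ (by positivity)]
  calc lam * p.plen j Y b * x * (40000 * m ^ 4) = lam * (p.plen j Y b * x) * (40000 * m ^ 4) := by ring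
    _ ≤ lam * (m ^ 3 / 5000 * m ^ 3) * (40000 * m ^ 4) := by gcongr
    _ = lam * (8 * m ^ 10) := by ring
    _ ≤ 1 := h3

lemma lam_plen_le (hp : p.Std K m s ρ) {lam : ℝ} (h0 : 0 ≤ lam) (hl : lam * s ≤ 1) (i j Y : ℕ)
    (b : Bool) : lam * p.plen j Y b ≤ 1 / m ^ 3 / p.U i / 40000 := by
  have hm := hp.m_big
  have hU := hp.U_pos i
  have hU2 : (p.U i : ℝ) ≤ m ^ 3 :=
    (hp.hU2 i).trans (pow_le_pow_right₀ (by linarith) (by norm_num))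
  have h := hp.lam_plen h0 hl j Y b (by linarith) hU2
  have h2 : 1 / (40000 * m ^ 4) ≤ 1 / (40000 * m ^ 3) := by
    apply one_div_le_one_div_of_le (by positivity)
    gcongr <;> linarith
  have e : 1 / m ^ 3 / p.U i / 40000 = 1 / (40000 * m ^ 3) / p.U i := by
    field_simp
  rw [e, le_div_iff₀ (by linarith)]
  exact h.trans h2

lemma hs_le (hp : p.Std K m s ρ) {κ : ℝ} (h0 : 0 ≤ κ) (j : Fin p.L) :
    κ * (16 * p.gad.hs (Sum.inl j)) ≤ 4 * κ * s := by
  have h1 : (p.gad.hs (Sum.inl j) : ℝ) ≤ 2 * 2 ^ p.ht j := by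
    have : p.gad.hs (Sum.inl j) ≤ 2 * 2 ^ p.ht j := by
      simp only [gad, pow_succ]; omega
    exact_mod_cast this
  have h2 := hp.hs j j.2
  have h3 := hp.U_pos j
  have h4 : (0:ℝ) < 2 ^ p.ht j := by positivity
  have h5 : 32 * (2:ℝ) ^ p.ht j ≤ 4 * s := by nlinarith
  nlinarith

end Std

/-- the values on the nodes: `F` above the bottom row, a parabola on the bottom row -/
def bot (p : StripPar) (F : ℕ → ℕ → ℝ) (j Y : ℕ) : ℝ :=
  if j < p.L then F j Y else 1 + (Y * (2 * p.W + 1 - Y)) / (2 * p.W + 1) ^ 2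

lemma bot_of_lt {F : ℕ → ℕ → ℝ} {j : ℕ} (hj : j < p.L) (Y : ℕ) : p.bot F j Y = F j Y := if_pos hj

lemma bot_last {F : ℕ → ℕ → ℝ} (Y : ℕ) :
    p.bot F p.L Y = 1 + (Y * (2 * p.W + 1 - Y)) / (2 * p.W + 1) ^ 2 := if_neg (lt_irrefl _)

lemma bot_last_mem {F : ℕ → ℕ → ℝ} {Y : ℕ} (hY : Y ≤ p.W) :
    1 ≤ p.bot F p.L Y ∧ p.bot F p.L Y ≤ 2 := by
  rw [bot_last]
  have h : (Y:ℝ) ≤ p.W := by exact_mod_cast hY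
  have h0 : (0:ℝ) ≤ Y := Nat.cast_nonneg _
  constructor
  · have : 0 ≤ (Y * (2 * p.W + 1 - Y)) / (2 * p.W + 1 : ℝ) ^ 2 :=
      div_nonneg (mul_nonneg h0 (by linarith)) (by positivity)
    linarith
  · have : (Y * (2 * p.W + 1 - Y)) / (2 * p.W + 1 : ℝ) ^ 2 ≤ 1 := by
      rw [div_le_one (by positivity)]
      nlinarith
    linarith

/-- the inequality along the bottom row -/
lemma rim_ineq {W : ℕ} {y E : ℕ → ℝ} {ξ e : ℝ} (hy : ∀ Y, 0 ≤ y Y) (hy0 : y 0 = 0)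
    (he : 8 * e ≤ ξ) (hE : ∀ Y ≤ W, E Y ≤ e) (he0 : 0 ≤ e) (F : ℕ → ℝ)
    (hF : ∀ Y < W, (F (Y + 1) - F Y) / 2 = ξ * (W - Y)) :
    2 * ∑ Y ∈ Finset.range (W + 1), y Y * (ξ / 8)
      ≤ ∑ Y ∈ Finset.range W, (y Y * ((F Y - F (Y + 1)) / 2 - E Y)
          + y (Y + 1) * ((F (Y + 1) - F Y) / 2 - E (Y + 1))) := by
  have h1 : ∀ Y ∈ Finset.range W,
      (((W:ℝ) - (Y + 1 : ℕ)) * y (Y + 1) - ((W:ℝ) - (Y : ℕ)) * y Y) * ξ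
        + (ξ * y (Y + 1) - e * y Y - e * y (Y + 1))
      ≤ (y Y * ((F Y - F (Y + 1)) / 2 - E Y)
          + y (Y + 1) * ((F (Y + 1) - F Y) / 2 - E (Y + 1))) := by
    intro Y hY
    have hY := Finset.mem_range.1 hY
    have h2 := hF Y hY
    have h3 : (F Y - F (Y + 1)) / 2 = -(ξ * (W - Y)) := by linarith
    rw [h2, h3]
    have h4 := mul_le_mul_of_nonneg_left (hE Y hY.le) (hy Y)
    have h5 := mul_le_mul_of_nonneg_left (hE (Y + 1) hY) (hy (Y + 1))
    push_cast
    nlinarith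
  refine le_trans ?_ (Finset.sum_le_sum h1)
  have ht := Finset.sum_range_sub (fun Y : ℕ => ((W:ℝ) - (Y : ℕ)) * y Y) W
  simp only [hy0] at ht
  rw [Finset.sum_add_distrib, ← Finset.sum_mul, ← Finset.sum_mul, ht, Finset.sum_sub_distrib,
    Finset.sum_sub_distrib, ← Finset.mul_sum, ← Finset.mul_sum, ← Finset.mul_sum]
  have h6 : ∑ Y ∈ Finset.range W, y Y ≤ ∑ Y ∈ Finset.range W, y (Y + 1) := by
    have h7 := Finset.sum_range_succ y W
    have h8 := Finset.sum_range_succ' y W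
    linarith [hy W]
  have h9 : ∑ Y ∈ Finset.range (W + 1), y Y = ∑ Y ∈ Finset.range W, y (Y + 1) := by
    rw [Finset.sum_range_succ', hy0, add_zero]
  rw [h9]
  have h10 : 0 ≤ ∑ Y ∈ Finset.range W, y (Y + 1) := Finset.sum_nonneg fun _ _ => hy _
  simp only [sub_self, zero_mul, mul_zero, zero_add]
  nlinarith

/-- curvature of the paths -/
def cur (p : StripPar) (F : ℕ → ℕ → ℝ) (lam : ℝ) (j Y : ℕ) (b : Bool) : ℝ :=
  4 * lam * (p.bot F j Y + p.bot F (j + 1) (stepTo p.W b Y))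

/-- tolls -/
def toll (p : StripPar) (F G : ℕ → ℕ → ℝ) (m ρ : ℝ) (j Y : ℕ) : ℝ :=
  if j < p.L then (4 * ρ * G j Y + F j Y / (4 * m ^ 3)) / p.U j else 1 / (2 * p.W + 1) ^ 2 / 8

set_option maxHeartbeats 1000000 in
lemma skel_upper (hp : p.Std K m s ρ) {F G : ℕ → ℕ → ℝ} {w : ℕ → Bool → ℝ} {lam κ κb : ℝ}
    (hw : ∀ Y b, 1 ≤ w Y b ∧ w Y b ≤ 4)
    (hF2 : ∀ j ≤ p.L, ∀ Y ≤ p.W, 2 ≤ F j Y) (hFB : ∀ j Y, Y ≤ p.W → F j Y ≤ 2 * K ^ 2)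
    (hF4 : ∀ j < p.L, ∀ Y ≤ p.W, ∀ b, F (j + 1) (stepTo p.W b Y) ≤ 4 * F j Y ∧
      F j Y ≤ 4 * F (j + 1) (stepTo p.W b Y))
    (hG : ∀ j < p.L, ∀ Y ≤ p.W, ∀ b, F j Y - F (j + 1) (stepTo p.W b Y) ≤ G (j + 1) (stepTo p.W b Y))
    (hG0 : ∀ j Y, 0 ≤ G j Y) (hρ0 : 0 ≤ ρ) (hl0 : 0 ≤ lam) (hl : lam * s ≤ 1) (hκ : lam ≤ κ)
    (hout : ∀ j < p.L, ∀ Y ≤ p.W,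
      8 * ρ * G j Y + F j Y / m ^ 3 + (if Y = 0 then F j 0 * (κ * s) else 0)
      ≤ w Y true * ((F j Y - F (j + 1) (stepTo p.W true Y)) / p.cl Y true)
        + w Y false * ((F j Y - F (j + 1) (stepTo p.W false Y)) / p.cl Y false)) :
    p.gad.SkelSuper (p.wt w) (fun x => p.bot F x.1 x.2) (p.gam (p.cur F lam) (16 * lam))
      (p.kap κ κb) lam {x | (x.1 : ℕ) = p.L ∧ (x.2 : ℕ) = 0} := by
  have hm := hp.m_big
  have hbotF : ∀ j ≤ p.L, ∀ Y ≤ p.W, p.bot F j Y ≤ F j Y := by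
    intro j hj Y hY
    rcases hj.lt_or_eq with h | rfl
    · rw [bot_of_lt h]
    · exact (bot_last_mem hY).2.trans (hF2 _ le_rfl _ hY)
  have hbot1 : ∀ j ≤ p.L, ∀ Y ≤ p.W, 1 ≤ p.bot F j Y := by
    intro j hj Y hY
    rcases hj.lt_or_eq with h | rfl
    · rw [bot_of_lt h]; linarith [hF2 j hj Y hY]
    · exact (bot_last_mem hY).1
  refine p.skelSuper (T := p.toll F G m ρ) (Z := fun j Y => j = p.L ∧ Y = 0) ?_ ?_ ?_ ?_
  · intro Y hY
    have h1 := hG0 0 Y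
    have h2 := hF2 0 (Nat.zero_le _) Y hY
    rw [toll, if_pos (by have := p.hL; omega)]
    have : (0:ℝ) ≤ F 0 Y := by linarith
    positivity
  · intro j hj Y hY b hz
    have hσ := stepTo_le b hY
    set σ := stepTo p.W b Y with hσd
    have hl1 : (2:ℝ) ≤ p.plen j Y b := by exact_mod_cast p.plen_ge j Y b
    have hU := hp.U_pos j
    have hU' := hp.U_pos (j + 1)
    have hℓU : (p.U j : ℝ) ≤ p.plen j Y b := by
      rw [plen_cast]; nlinarith [p.cl_ge Y b]
    have hww := hw Y b
    have hq := hp.lam_plen_le hl0 hl (j + 1) j Y b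
    set ℓ : ℝ := ((p.plen j Y b : ℕ) : ℝ) with hℓ
    have hF := hF2 j hj.le Y hY
    rw [cur, bot_of_lt hj]
    rcases Nat.lt_or_ge (j + 1) p.L with hj' | hj'
    · rw [bot_of_lt hj', toll, if_pos hj']
      have hF' := hF2 (j + 1) hj'.le σ hσ
      have h4 := (hF4 j hj Y hY b).2
      have hg := hG j hj Y hY b
      have hg0 := hG0 (j + 1) σ
      rw [← hσd] at h4 hg
      set f := F j Y
      set f' := F (j + 1) σ
      set g := G (j + 1) σ
      set q : ℝ := 1 / m ^ 3 / p.U (j + 1) with hqd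
      have h5 : (f - f') / ℓ ≤ g / p.U j :=
        div_le_div₀ hg0 hg (by linarith) hℓU
      have h6 : g / p.U j = ρ * g / p.U (j + 1) := by
        have h7 := hp.hρ j hj
        have : ρ ≠ 0 := by rintro rfl; rw [h7] at hU'; linarith
        rw [h7]; field_simp
      have h8 : 4 * lam * (f + f') * (ℓ - 1) + 2 * lam * f' ≤ 20 * (lam * ℓ) * f' := by
        have : 4 * lam * (f + f') * (ℓ - 1) ≤ 4 * lam * (5 * f') * (ℓ - 1) := by
          have : 0 ≤ ℓ - 1 := by linarith
          gcongr; linarith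
        nlinarith [mul_nonneg hl0 (by linarith : (0:ℝ) ≤ f')]
      have h9 : 20 * (lam * ℓ) * f' ≤ 20 * (q / 40000) * f' := by gcongr
      have h10 : (4 * ρ * g + f' / (4 * m ^ 3)) / p.U (j + 1)
          = 4 * (ρ * g / p.U (j + 1)) + q * f' / 4 := by
        rw [hqd]; field_simp
      rw [h10]
      have h11 : (f' - f) / ℓ = -((f - f') / ℓ) := by ring
      rw [h11]
      have hρg : 0 ≤ ρ * g / p.U (j + 1) := by positivity
      have hqf : 0 ≤ q * f' := by positivity
      have h12 : (f - f') / ℓ + 4 * lam * (f + f') * (ℓ - 1) + 2 * lam * f'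
        ≤ ρ * g / p.U (j + 1) + q * f' / 2000 := by linarith
      have h13 := mul_le_mul_of_nonneg_left h12 (by linarith : 0 ≤ w Y b)
      have h14 : w Y b * (ρ * g / p.U (j + 1) + q * f' / 2000)
        ≤ 4 * (ρ * g / p.U (j + 1) + q * f' / 2000) :=
        mul_le_mul_of_nonneg_right hww.2 (by positivity)
      linarith
    · have hjL : j + 1 = p.L := by omega
      rw [hjL, toll, if_neg (lt_irrefl _)]
      have hb := bot_last_mem (F := F) hσ
      have hFj := hFB j Y hY
      set f := F j Y
      set f' := p.bot F p.L σ
      have hU1 := hp.hU1 j hj.le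
      have hq' := hp.lam_plen_le hl0 hl 0 j Y b
      rw [← hℓ] at hq'
      have hq2 : 1 / m ^ 3 / p.U 0 / 40000 ≤ 1 / m := by
        have hU0 := hp.U_pos 0
        calc 1 / m ^ 3 / p.U 0 / 40000 ≤ 1 / m ^ 3 := by
              rw [div_div, div_le_iff₀ (by positivity)]
              have : 0 < 1 / m ^ 3 := by positivity
              nlinarith
          _ ≤ 1 / m := by
              apply one_div_le_one_div_of_le (by linarith)
              exact le_self_pow₀ (by linarith) (by norm_num)
      have hK := hp.hK
      have hW1 : 1 / (72 * K ^ 2) ≤ 1 / (2 * (p.W:ℝ) + 1) ^ 2 / 8 := by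
        rw [div_div]
        apply one_div_le_one_div_of_le (by positivity)
        have := hp.hWK
        have h0 : (0:ℝ) ≤ p.W := Nat.cast_nonneg _
        nlinarith
      have hmK : 1 / m ≤ 1 / K ^ 6 / K ^ 6 := by
        rw [div_div, ← pow_add]
        exact one_div_le_one_div_of_le (by positivity) hp.hKm
      have h5 : (f - f') / ℓ ≤ 2 * K ^ 2 * (1 / m) := by
        rw [mul_one_div]
        exact div_le_div₀ (by positivity) (by linarith) (by linarith) (by linarith)
      have h8 : 4 * lam * (f + f') * (ℓ - 1) + 2 * lam * f' ≤ 12 * K ^ 2 * (lam * ℓ) := by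
        have h81 : f + f' ≤ 2 * K ^ 2 + 2 := by linarith
        have : 4 * lam * (f + f') * (ℓ - 1) ≤ 4 * lam * (2 * K ^ 2 + 2) * (ℓ - 1) := by
          have : 0 ≤ ℓ - 1 := by linarith
          gcongr
        have h82 : 2 * lam * f' ≤ 2 * lam * 2 := by gcongr; exact hb.2
        have h83 : 0 ≤ lam * (ℓ - 1) := mul_nonneg hl0 (by linarith)
        have hK2 : 256 ≤ K ^ 2 := by nlinarith
        have h84 : 8 * (lam * (ℓ - 1)) ≤ 4 * K ^ 2 * (lam * (ℓ - 1)) := by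
          apply mul_le_mul_of_nonneg_right _ h83; linarith
        have h85 : 4 * lam ≤ 12 * K ^ 2 * lam := by
          apply mul_le_mul_of_nonneg_right _ hl0; linarith
        linarith
      have h9 : 12 * K ^ 2 * (lam * ℓ) ≤ 12 * K ^ 2 * (1 / m) := by
        have := hq'.trans hq2
        gcongr
      have h11 : (f' - f) / ℓ = -((f - f') / ℓ) := by ring
      have h12 : (f - f') / ℓ + 4 * lam * (f + f') * (ℓ - 1) + 2 * lam * f'
        ≤ 14 * K ^ 2 * (1 / m) := by linarith
      have h13 := mul_le_mul_of_nonneg_left h12 (by linarith : 0 ≤ w Y b)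
      have h14 : w Y b * (14 * K ^ 2 * (1 / m)) ≤ 4 * (14 * K ^ 2 * (1 / m)) :=
        mul_le_mul_of_nonneg_right hww.2 (by positivity)
      have h15 : 56 * K ^ 2 * (1 / m) ≤ 1 / (72 * K ^ 2) := by
        have hKm := hp.hKm
        rw [mul_one_div, div_le_div_iff₀ (by linarith) (by positivity)]
        have h8 : (16:ℝ) ^ 8 ≤ K ^ 8 := pow_le_pow_left₀ (by norm_num) hK 8
        have h9 : 4032 * K ^ 4 ≤ K ^ 8 * K ^ 4 :=
          mul_le_mul_of_nonneg_right (by linarith) (by positivity)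
        have e9 : K ^ 8 * K ^ 4 = K ^ 12 := by ring
        linarith
      rw [h11]
      linarith
  · intro j hj Y hY
    have hU := hp.U_pos j
    have ho := hout j hj Y hY
    have hF := hF2 j hj.le Y hY
    have key : ∀ b, w Y b * ((F j Y - F (j + 1) (stepTo p.W b Y)) / p.cl Y b) / p.U j
          - F j Y / m ^ 3 / p.U j / 500
        ≤ w Y b * ((p.bot F j Y - p.bot F (j + 1) (stepTo p.W b Y)) / p.plen j Y b
        - p.cur F lam j Y b * (p.plen j Y b - 1) - 2 * lam * p.bot F j Y) := by
      intro b
      have hσ := stepTo_le b hY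
      have hl1 : (2:ℝ) ≤ p.plen j Y b := by exact_mod_cast p.plen_ge j Y b
      have hww := hw Y b
      have hc := p.cl_ge Y b
      have hq := hp.lam_plen_le hl0 hl j j Y b
      have h4 := (hF4 j hj Y hY b).1
      have hb1 := hbot1 (j + 1) hj _ hσ
      have hb2 := hbotF (j + 1) hj _ hσ
      rw [cur, bot_of_lt hj]
      have e1 := p.plen_cast j Y b
      set ℓ : ℝ := ((p.plen j Y b : ℕ) : ℝ) with hℓ
      set f' := p.bot F (j + 1) (stepTo p.W b Y)
      set f := F j Y
      set f'' := F (j + 1) (stepTo p.W b Y)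
      have h8 : 4 * lam * (f + f') * (ℓ - 1) + 2 * lam * f ≤ 20 * (lam * ℓ) * f := by
        have : 4 * lam * (f + f') * (ℓ - 1) ≤ 4 * lam * (5 * f) * (ℓ - 1) := by
          have : 0 ≤ ℓ - 1 := by linarith
          gcongr; linarith
        nlinarith [mul_nonneg hl0 (by linarith : (0:ℝ) ≤ f)]
      have h9 : 20 * (lam * ℓ) * f ≤ 20 * (1 / m ^ 3 / p.U j / 40000) * f := by gcongr
      have h10 : 20 * (1 / m ^ 3 / p.U j / 40000) * f = f / m ^ 3 / p.U j / 2000 := by ring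
      have h11 : (f - f'') / p.cl Y b / p.U j ≤ (f - f') / ℓ := by
        rw [div_div, ← e1]
        gcongr
      have h12 : (f - f'') / p.cl Y b / p.U j - f / m ^ 3 / p.U j / 2000
          ≤ (f - f') / ℓ - 4 * lam * (f + f') * (ℓ - 1) - 2 * lam * f := by linarith
      have h13 := mul_le_mul_of_nonneg_left h12 (by linarith : 0 ≤ w Y b)
      have hfq : 0 ≤ f / m ^ 3 / p.U j / 2000 := by positivity
      have h14 := mul_le_mul_of_nonneg_right hww.2 hfq
      have e2 : w Y b * ((f - f'') / p.cl Y b) / p.U j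
          = w Y b * ((f - f'') / p.cl Y b / p.U j) := by ring
      rw [e2]
      linarith
    refine le_trans ?_ (add_le_add (key true) (key false))
    have h1 : (8 * ρ * G j Y + F j Y / m ^ 3 + (if Y = 0 then F j 0 * (κ * s) else 0)) / p.U j
        ≤ w Y true * ((F j Y - F (j + 1) (stepTo p.W true Y)) / p.cl Y true) / p.U j
        + w Y false * ((F j Y - F (j + 1) (stepTo p.W false Y)) / p.cl Y false) / p.U j := by
      rw [← add_div]; gcongr
    have h2 : 2 * p.toll F G m ρ j Y = 8 * ρ * G j Y / p.U j + F j Y / m ^ 3 / p.U j / 2 := by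
      rw [toll, if_pos hj]; field_simp; ring
    have h3 : (if Y = 0 then p.bot F j 0 * (κ * (8 * 2 ^ p.ht j - 6) + 2 * lam) else 0)
        ≤ (if Y = 0 then F j 0 * (κ * s) else 0) / p.U j := by
      split_ifs with h
      · have h5 := hF2 j hj.le 0 (Nat.zero_le _)
        rw [bot_of_lt hj, mul_div_assoc]
        apply mul_le_mul_of_nonneg_left _ (by linarith)
        rw [le_div_iff₀ (by linarith), ← hp.hs j hj]
        nlinarith
      · simp
    have hfq : 0 ≤ F j Y / m ^ 3 / p.U j := by positivity
    rw [h2]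
    have h4 : (8 * ρ * G j Y + F j Y / m ^ 3 + (if Y = 0 then F j 0 * (κ * s) else 0)) / p.U j
      = 8 * ρ * G j Y / p.U j + F j Y / m ^ 3 / p.U j
        + (if Y = 0 then F j 0 * (κ * s) else 0) / p.U j := by ring
    linarith
  · intro y hy hy0
    rw [hy0 0 ⟨rfl, rfl⟩]
    simp only [zero_mul, add_zero, sub_sub]
    have ht : ∀ Y, p.toll F G m ρ p.L Y = 1 / (2 * p.W + 1) ^ 2 / 8 := fun Y => by
      rw [toll, if_neg (lt_irrefl _)]
    simp only [ht]
    have hlm : lam ≤ 1 / m := by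
      have h1 := hp.hms
      have : m ≤ s := by
        have : m ≤ m ^ 10 := le_self_pow₀ (by linarith) (by norm_num)
        linarith [pow_pos (by linarith : 0 < m) 10]
      rw [le_div_iff₀ (by linarith)]
      nlinarith
    have hW1 : 1 / (9 * K ^ 2) ≤ 1 / (2 * (p.W:ℝ) + 1) ^ 2 := by
      apply one_div_le_one_div_of_le (by positivity)
      have := hp.hWK
      have h0 : (0:ℝ) ≤ p.W := Nat.cast_nonneg _
      have := hp.hK
      nlinarith
    have hKm : 160 * (1 / m) ≤ 1 / (9 * K ^ 2) := by
      have := hp.K_le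
      have := hp.hK
      rw [mul_one_div, div_le_div_iff₀ (by linarith) (by positivity)]
      linarith
    refine rim_ineq (e := 20 * lam) (F := p.bot F p.L) hy (hy0 0 ⟨rfl, rfl⟩) (by linarith) ?_
      (by linarith) ?_
    · intro Y hY
      have := (bot_last_mem (F := F) hY).2
      nlinarith
    · intro Y hY
      rw [bot_last, bot_last]
      push_cast
      field_simp
      ring

end StripPar

end StripUpper


section StripUpper

namespace StripPar

variable {p : StripPar} {K m s ρ : ℝ}

/-- the two large heaps -/
def blobs (p : StripPar) : Finset p.SHeap := {Sum.inr true, Sum.inr false}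

lemma wt_mem {w : ℕ → Bool → ℝ} (hw : ∀ Y b, 1 ≤ w Y b ∧ w Y b ≤ 4) (e : p.SEdge) :
    1 ≤ p.wt w e ∧ p.wt w e ≤ 4 := by
  rcases e with ⟨j, Y, b⟩ | Y
  · exact hw _ _
  · simp only [wt]; norm_num

lemma strip_upper {N : ℕ} (hp : p.Std K m s ρ) (e : p.gad.Vert ≃ Fin N) {F G : ℕ → ℕ → ℝ}
    {w : ℕ → Bool → ℝ} {lam κ B : ℝ}
    (hw : ∀ Y b, 1 ≤ w Y b ∧ w Y b ≤ 4)
    (hF2 : ∀ j ≤ p.L, ∀ Y ≤ p.W, 2 ≤ F j Y) (hFB : ∀ j Y, Y ≤ p.W → F j Y ≤ B)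
    (hB : B ≤ 2 * K ^ 2)
    (hF4 : ∀ j < p.L, ∀ Y ≤ p.W, ∀ b, F (j + 1) (stepTo p.W b Y) ≤ 4 * F j Y ∧
      F j Y ≤ 4 * F (j + 1) (stepTo p.W b Y))
    (hG : ∀ j < p.L, ∀ Y ≤ p.W, ∀ b, F j Y - F (j + 1) (stepTo p.W b Y) ≤ G (j + 1) (stepTo p.W b Y))
    (hG0 : ∀ j Y, 0 ≤ G j Y) (hρ0 : 0 ≤ ρ) (hl0 : 0 < lam) (hl : lam * s ≤ 1)
    (hlb : 64 * lam * p.a ^ 2 * s ≤ 1) (hκ : lam * (1 + 4 * κ * s) ≤ κ) (hκ1 : 4 * κ * s ≤ 1)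
    (hκ0 : 0 ≤ κ)
    (hout : ∀ j < p.L, ∀ Y ≤ p.W,
      8 * ρ * G j Y + F j Y / m ^ 3 + (if Y = 0 then F j 0 * (κ * s) else 0)
      ≤ w Y true * ((F j Y - F (j + 1) (stepTo p.W true Y)) / p.cl Y true)
        + w Y false * ((F j Y - F (j + 1) (stepTo p.W false Y)) / p.cl Y false))
    (hoff : 2 * B * p.gad.off p.blobs ≤ N) (t : ℕ) {u : ℕ} (hu : 0 < u) :
    dTV (wMat ((p.gad.net.map e).ew (p.gad.wts (p.wt w))))
        (wSta ((p.gad.net.map e).ew (p.gad.wts (p.wt w)))) (t + u)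
      ≤ 2 * B * (1 - lam) ^ t + √(38 / (lam * u)) / 2 := by
  have hm := hp.m_big
  have hs0 := hp.s_pos
  have hB2 : 2 ≤ B := (hF2 0 (Nat.zero_le _) 0 (Nat.zero_le _)).trans (hFB 0 0 (Nat.zero_le _))
  have hs1 : 10 ^ 12 ≤ s := by
    have : m ≤ m ^ 10 := le_self_pow₀ (by linarith) (by norm_num)
    linarith [hp.hms]
  have hl1 : lam ≤ 1 / 10 ^ 12 := by
    rw [le_div_iff₀ (by norm_num)]
    exact (mul_le_mul_of_nonneg_left hs1 hl0.le).trans hl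
  have hbot : ∀ x : p.Node, 1 ≤ p.bot F x.1 x.2 ∧ p.bot F x.1 x.2 ≤ B := by
    intro x
    have hY : (x.2 : ℕ) ≤ p.W := Nat.le_of_lt_succ x.2.2
    have hj : (x.1 : ℕ) ≤ p.L := Nat.le_of_lt_succ x.1.2
    rcases hj.lt_or_eq with h | h
    · rw [bot_of_lt h]; exact ⟨by linarith [hF2 _ hj _ hY], hFB _ _ hY⟩
    · rw [h]; have := bot_last_mem (F := F) hY; exact ⟨this.1, by linarith⟩
  have hcorner : p.bot F p.corner.1 p.corner.2 = 1 := by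
    have : p.bot F p.corner.1 p.corner.2 = p.bot F p.L 0 := rfl
    rw [this, bot_last]; simp
  have hN0 : (0:ℝ) ≤ N := Nat.cast_nonneg _
  have ho0 : (0:ℝ) ≤ p.gad.off p.blobs := Nat.cast_nonneg _
  have hlamsq : ∀ j Y b, lam * (p.plen j Y b : ℝ) ^ 2 ≤ 1 / 4 := by
    intro j Y b
    have h1 := hp.plen_le j Y b
    have h3 := hp.lam_plen hl0.le hl j Y b (Nat.cast_nonneg _) (x := p.plen j Y b)
      (by linarith [pow_pos (by linarith : 0 < m) 3])
    have h4 : 1 / (40000 * m ^ 4) ≤ 1 / 4 := by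
      apply one_div_le_one_div_of_le (by norm_num)
      have : 1 ≤ m ^ 4 := one_le_pow₀ (by linarith)
      linarith
    calc _ = lam * p.plen j Y b * p.plen j Y b := by ring
      _ ≤ _ := h3.trans h4
  have hrimF : ∀ Y : Fin p.W, p.bot F (p.gad.src (Sum.inr Y)).1 (p.gad.src (Sum.inr Y)).2 ≤ 2 ∧
      p.bot F (p.gad.dst (Sum.inr Y)).1 (p.gad.dst (Sum.inr Y)).2 ≤ 2 := fun Y =>
    ⟨(bot_last_mem (F := F) (by omega : (Y : ℕ) ≤ p.W)).2,
      (bot_last_mem (F := F) (by omega : (Y : ℕ) + 1 ≤ p.W)).2⟩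
  have hpvP : ∀ (j : Fin p.L) (Y : Fin (p.W + 1)) (b : Bool) (q : ℕ), q ≤ p.plen j Y b → ∀ A : ℝ,
      p.bot F (p.gad.src (Sum.inl (j, Y, b))).1 (p.gad.src (Sum.inl (j, Y, b))).2 ≤ A →
      p.bot F (p.gad.dst (Sum.inl (j, Y, b))).1 (p.gad.dst (Sum.inl (j, Y, b))).2 ≤ A →
      Gad.pathVal (p.bot F (p.gad.src (Sum.inl (j, Y, b))).1 (p.gad.src (Sum.inl (j, Y, b))).2)
        (p.bot F (p.gad.dst (Sum.inl (j, Y, b))).1 (p.gad.dst (Sum.inl (j, Y, b))).2)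
        (p.gam (p.cur F lam) (16 * lam) (Sum.inl (j, Y, b))) (p.gad.len (Sum.inl (j, Y, b))) q
      ≤ A + (p.bot F (p.gad.src (Sum.inl (j, Y, b))).1 (p.gad.src (Sum.inl (j, Y, b))).2
        + p.bot F (p.gad.dst (Sum.inl (j, Y, b))).1 (p.gad.dst (Sum.inl (j, Y, b))).2) / 4 := by
    intro j Y b q hq A h1 h2
    have hg : p.gam (p.cur F lam) (16 * lam) (Sum.inl (j, Y, b))
      = 4 * lam * (p.bot F (p.gad.src (Sum.inl (j, Y, b))).1 (p.gad.src (Sum.inl (j, Y, b))).2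
        + p.bot F (p.gad.dst (Sum.inl (j, Y, b))).1 (p.gad.dst (Sum.inl (j, Y, b))).2) := rfl
    have h3 := (hbot (p.gad.src (Sum.inl (j, Y, b)))).1
    have h4 := (hbot (p.gad.dst (Sum.inl (j, Y, b)))).1
    rw [hg]
    set f := p.bot F (p.gad.src (Sum.inl (j, Y, b))).1 (p.gad.src (Sum.inl (j, Y, b))).2
    set f' := p.bot F (p.gad.dst (Sum.inl (j, Y, b))).1 (p.gad.dst (Sum.inl (j, Y, b))).2
    have hlen : p.gad.len (Sum.inl (j, Y, b)) = p.plen j Y b := rfl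
    rw [hlen]
    refine (Gad.pathVal_le h1 h2 (by positivity) (Nat.cast_nonneg _) (by exact_mod_cast hq) ?_).trans ?_
    · have := p.plen_ge j Y b
      exact_mod_cast (by omega : 0 < p.plen j Y b)
    · have := hlamsq j Y b
      nlinarith
  have hpvR : ∀ (Y : Fin p.W) (q : ℕ), q ≤ 2 →
      Gad.pathVal (p.bot F (p.gad.src (Sum.inr Y)).1 (p.gad.src (Sum.inr Y)).2)
        (p.bot F (p.gad.dst (Sum.inr Y)).1 (p.gad.dst (Sum.inr Y)).2)
        (p.gam (p.cur F lam) (16 * lam) (Sum.inr Y)) (p.gad.len (Sum.inr Y)) q ≤ 2 + 16 * lam := by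
    intro Y q hq
    have hlen : p.gad.len (Sum.inr Y) = 2 := rfl
    have hg : p.gam (p.cur F lam) (16 * lam) (Sum.inr Y) = 16 * lam := rfl
    rw [hlen, hg]
    refine (Gad.pathVal_le (hrimF Y).1 (hrimF Y).2 (by positivity) (Nat.cast_nonneg _)
      (by exact_mod_cast hq) (by norm_num)).trans (le_of_eq ?_)
    push_cast; ring
  have hblob : ∀ b, 2 * lam * (16 * p.gad.hs (Sum.inr b)) ≤ 1 := by
    intro b
    have h1 := hp.hbl b
    have e1 : p.gad.hs (Sum.inr b) = p.bs b := rfl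
    rw [e1]
    have := mul_le_mul_of_nonneg_left h1 hl0.le
    linarith
  have hnode : ∀ j, κ * (16 * p.gad.hs (Sum.inl j)) ≤ 4 * κ * s := fun j => hp.hs_le hκ0 j
  have h := Gad.upper (p.gad) e (D := (9:ℕ)) (by norm_num) p.degBound (bl := p.blobs) (wt := p.wt w)
    (F := fun x => p.bot F x.1 x.2) (γ := p.gam (p.cur F lam) (16 * lam))
    (κ := p.kap κ (2 * lam)) (lam := lam) (B := 2 * B) (M := 2) (z := p.corner)
    (by
      have : (2:ℝ) * p.gad.off p.blobs ≤ N := by nlinarith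
      exact_mod_cast this)
    (wt_mem hw) hl0 (by linarith) ?_ ?_ (fun x => (hbot x).1) ?_ ?_ ?_ ?_ ?_ ?_ (by norm_num) t hu
  · refine h.trans ?_
    gcongr
    rcases hN0.eq_or_lt with h0 | h0
    · rw [← h0]; norm_num
    · have : 4 * ((9:ℕ):ℝ) * (2 * B) * p.gad.off p.blobs / N ≤ 36 := by
        rw [div_le_iff₀ h0]; push_cast; linarith
      linarith
  · rintro (⟨j, Y, b⟩ | Y)
    · have h3 := (hbot (p.gad.src (Sum.inl (j, Y, b)))).1
      have h4 := (hbot (p.gad.dst (Sum.inl (j, Y, b)))).1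
      exact mul_nonneg (by linarith) (add_nonneg (zero_le_one.trans h3) (zero_le_one.trans h4))
    · exact (by linarith : 0 ≤ 16 * lam)
  · rintro (j | b)
    · exact hκ0
    · exact (by linarith : 0 ≤ 2 * lam)
  · rintro (⟨j, Y, b⟩ | Y) q hq0 hq
    · have h3 := (hbot (p.gad.src (Sum.inl (j, Y, b)))).1
      have h4 := (hbot (p.gad.dst (Sum.inl (j, Y, b)))).1
      have h5 := hpvP j Y b q hq.le _ (le_add_of_nonneg_right (zero_le_one.trans h4))
        (le_add_of_nonneg_left (zero_le_one.trans h3))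
      refine (mul_le_mul_of_nonneg_left h5 (by linarith)).trans ?_
      have hg : p.gam (p.cur F lam) (16 * lam) (Sum.inl (j, Y, b))
        = 4 * lam * (p.bot F (p.gad.src (Sum.inl (j, Y, b))).1 (p.gad.src (Sum.inl (j, Y, b))).2
        + p.bot F (p.gad.dst (Sum.inl (j, Y, b))).1 (p.gad.dst (Sum.inl (j, Y, b))).2) := rfl
      rw [hg]
      nlinarith
    · refine (mul_le_mul_of_nonneg_left (hpvR Y q hq.le) (by linarith)).trans ?_
      have hg : p.gam (p.cur F lam) (16 * lam) (Sum.inr Y) = 16 * lam := rfl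
      rw [hg]
      nlinarith
  · rintro (j | b)
    · have e1 : p.kap κ (2 * lam) (Sum.inl j) = κ := rfl
      rw [e1]
      refine le_trans ?_ hκ
      have := hnode j
      gcongr
    · have e1 : p.kap κ (2 * lam) (Sum.inr b) = 2 * lam := rfl
      rw [e1]
      have := hblob b
      nlinarith
  · have hset : ({x : p.Node | (x.1 : ℕ) = p.L ∧ (x.2 : ℕ) = 0} : Set p.Node) = {p.corner} := by
      ext x
      simp only [Set.mem_ofPred_eq, Set.mem_singleton_iff, corner, node, Prod.ext_iff, Fin.ext_iff]
    rw [← hset]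
    exact skel_upper hp hw hF2 (fun j Y hY => (hFB j Y hY).trans hB) hF4 hG hG0 hρ0 hl0.le hl
      (by nlinarith [mul_nonneg hκ0 hs0.le]) hout
  · rintro (⟨j, Y, b⟩ | Y) q hq
    · have h3 := (hbot (p.gad.src (Sum.inl (j, Y, b)))).2
      have h4 := (hbot (p.gad.dst (Sum.inl (j, Y, b)))).2
      refine (hpvP j Y b q hq B h3 h4).trans ?_
      linarith
    · exact (hpvR Y q hq).trans (by linarith)
  · rintro (j | b)
    · have e1 : p.kap κ (2 * lam) (Sum.inl j) = κ := rfl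
      rw [e1]
      have h1 := hnode j
      have h2 := hbot (p.gad.att (Sum.inl j))
      have h3 : (0:ℝ) ≤ p.gad.hs (Sum.inl j) := Nat.cast_nonneg _
      have h4 : 1 + κ * (16 * p.gad.hs (Sum.inl j)) ≤ 2 := by linarith
      calc _ ≤ B * 2 := mul_le_mul h2.2 h4 (by positivity) (by linarith)
        _ = 2 * B := by ring
    · have e1 : p.kap κ (2 * lam) (Sum.inr b) = 2 * lam := rfl
      have e2 : p.bot F (p.gad.att (Sum.inr b)).1 (p.gad.att (Sum.inr b)).2 = 1 := hcorner
      simp only [e1, e2]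
      have := hblob b
      linarith
  · intro k hk
    simp only [blobs, Finset.mem_insert, Finset.mem_singleton] at hk
    have : ∃ b, k = Sum.inr b := by rcases hk with rfl | rfl <;> exact ⟨_, rfl⟩
    obtain ⟨b, rfl⟩ := this
    have e1 : p.kap κ (2 * lam) (Sum.inr b) = 2 * lam := rfl
    have e2 : p.bot F (p.gad.att (Sum.inr b)).1 (p.gad.att (Sum.inr b)).2 = 1 := hcorner
    simp only [e1, e2]
    have := hblob b
    linarith

end StripPar

end StripUpper


/-! ### Lower bound for the mixing time on the strip -/

section StripLower

namespace StripPar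

variable {p : StripPar} {K m s ρ : ℝ}

/-- tolls -/
def tollLow (p : StripPar) (f : ℕ → ℕ → ℝ) (ρ : ℝ) (j Y : ℕ) : ℝ :=
  if f j Y < 1 then 4 * ρ * f j Y / p.U j else 0

lemma skel_lower (hp : p.Std K m s ρ) {f : ℕ → ℕ → ℝ} {w : ℕ → Bool → ℝ} {lam κ : ℝ}
    (hw : ∀ Y b, 1 ≤ w Y b ∧ w Y b ≤ 4) (hf0 : ∀ j Y, 0 < f j Y) (hfL : ∀ Y ≤ p.W, 1 ≤ f p.L Y)
    (hf2 : ∀ j < p.L, ∀ Y ≤ p.W, ∀ b, f j Y ≤ 2 * f (j + 1) (stepTo p.W b Y))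
    (hρ0 : 0 ≤ ρ) (hl0 : 0 ≤ lam) (hκ0 : 0 ≤ κ)
    (hout : ∀ j < p.L, ∀ Y ≤ p.W,
      w Y true * ((f (j + 1) (stepTo p.W true Y) - f j Y) / p.cl Y true)
        + w Y false * ((f (j + 1) (stepTo p.W false Y) - f j Y) / p.cl Y false) + 8 * ρ * f j Y
      ≤ (if Y = 0 then f j 0 * (κ * s - 6 * κ * m ^ 2) else 0)) :
    p.gad.SkelSuper (p.wt w) (fun x => min 1 (f x.1 x.2)) (fun _ => 0) (p.kap (-κ) 0) (-lam) ∅ := by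
  have hZ : (∅ : Set p.Node) = {x | (fun _ _ : ℕ => False) (x.1 : ℕ) (x.2 : ℕ)} := by ext; simp
  have hγ : (fun _ : p.SEdge => (0:ℝ)) = p.gam (fun _ _ _ => 0) 0 := by
    funext e; rcases e with e | e <;> rfl
  have hF0 : ∀ j Y, 0 < min 1 (f j Y) := fun j Y => lt_min zero_lt_one (hf0 j Y)
  have hT0 : ∀ j Y, 0 ≤ p.tollLow f ρ j Y := by
    intro j Y
    rw [tollLow]
    have := hf0 j Y
    split_ifs <;> positivity
  rw [hZ, hγ]
  refine p.skelSuper (T := p.tollLow f ρ) (F := fun j Y => min 1 (f j Y)) (Z := fun _ _ => False)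
    (fun Y _ => hT0 0 Y) ?_ ?_ ?_
  · intro j hj Y hY b _
    have hσ := stepTo_le b hY
    have hl1 : (2:ℝ) ≤ p.plen j Y b := by exact_mod_cast p.plen_ge j Y b
    have hU := hp.U_pos j
    have hU' := hp.U_pos (j + 1)
    have hℓU : (p.U j : ℝ) ≤ p.plen j Y b := by
      rw [plen_cast]; nlinarith [p.cl_ge Y b]
    have hww := hw Y b
    have h2 := hf2 j hj Y hY b
    have hT := hT0 (j + 1) (stepTo p.W b Y)
    have hF := hF0 (j + 1) (stepTo p.W b Y)
    rcases lt_or_ge (f (j + 1) (stepTo p.W b Y)) 1 with h | h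
    · have hj' : j + 1 < p.L := by
        rcases Nat.lt_or_ge (j + 1) p.L with h' | h'
        · exact h'
        · have : j + 1 = p.L := by omega
          rw [this] at h
          linarith [hfL _ hσ]
      rw [tollLow, if_pos h, min_eq_right h.le]
      have hf' := hf0 (j + 1) (stepTo p.W b Y)
      have hmin := min_le_right 1 (f j Y)
      set f' := f (j + 1) (stepTo p.W b Y)
      have h5 : (min 1 (f j Y) - f') / p.plen j Y b ≤ f' / p.U j :=
        div_le_div₀ hf'.le (by linarith) (by linarith) hℓU
      have h6 : f' / p.U j = ρ * f' / p.U (j + 1) := by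
        have h7 := hp.hρ j hj
        have : ρ ≠ 0 := by rintro rfl; rw [h7] at hU'; linarith
        rw [h7]; field_simp
      have h11 : (f' - min 1 (f j Y)) / p.plen j Y b = -((min 1 (f j Y) - f') / p.plen j Y b) := by
        ring
      rw [h11]
      have hρf : 0 ≤ ρ * f' / p.U (j + 1) := by positivity
      have h13 := mul_le_mul_of_nonneg_left (h5.trans_eq h6) (by linarith : 0 ≤ w Y b)
      have h14 := mul_le_mul_of_nonneg_right hww.2 hρf
      have h15 : 0 ≤ w Y b * (lam * f') := by
        have : 0 ≤ w Y b := by linarith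
        positivity
      have h16 : 4 * ρ * f' / p.U (j + 1) = 4 * (ρ * f' / p.U (j + 1)) := by ring
      rw [h16]
      linarith
    · rw [min_eq_left h]
      have h3 := min_le_left 1 (f j Y)
      have h4 : 0 ≤ (1 - min 1 (f j Y)) / p.plen j Y b := div_nonneg (by linarith) (by linarith)
      have : 0 ≤ w Y b * ((1 - min 1 (f j Y)) / p.plen j Y b - 0 * (p.plen j Y b - 1)
          - 2 * -lam * 1) := mul_nonneg (by linarith) (by linarith)
      linarith
  · intro j hj Y hY
    have hU := hp.U_pos j
    have ho := hout j hj Y hY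
    have hpl : ∀ b, (0:ℝ) < p.plen j Y b := fun b => by
      have := p.plen_ge j Y b
      exact_mod_cast (by omega : 0 < p.plen j Y b)
    have hht : (1:ℝ) ≤ 2 ^ p.ht j := one_le_pow₀ (by norm_num)
    rcases lt_or_ge (f j Y) 1 with h | h
    · have key : ∀ b, -(w Y b * ((f (j + 1) (stepTo p.W b Y) - f j Y) / p.cl Y b)) / p.U j
          ≤ w Y b * ((f j Y - min 1 (f (j + 1) (stepTo p.W b Y))) / p.plen j Y b
            - 0 * (p.plen j Y b - 1) - 2 * -lam * f j Y) := by
        intro b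
        have hww := hw Y b
        have hc := p.cl_ge Y b
        have e1 : -(w Y b * ((f (j + 1) (stepTo p.W b Y) - f j Y) / p.cl Y b)) / p.U j
          = w Y b * ((f j Y - f (j + 1) (stepTo p.W b Y)) / p.plen j Y b) := by
          rw [plen_cast]; field_simp; ring
        rw [e1]
        apply mul_le_mul_of_nonneg_left _ (by linarith)
        have h1 : (f j Y - f (j + 1) (stepTo p.W b Y)) / p.plen j Y b
          ≤ (f j Y - min 1 (f (j + 1) (stepTo p.W b Y))) / p.plen j Y b :=
          div_le_div_of_nonneg_right (by linarith [min_le_right 1 (f (j + 1) (stepTo p.W b Y))])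
            (hpl b).le
        have := mul_nonneg hl0 (hf0 j Y).le
        linarith
      rw [min_eq_right h.le]
      refine le_trans ?_ (add_le_add (key true) (key false))
      rw [tollLow, if_pos h]
      have h1 := div_le_div_of_nonneg_right ho (by linarith : (0:ℝ) ≤ p.U j)
      have h3 : (if Y = 0 then f j 0 * (κ * s - 6 * κ * m ^ 2) else 0) / p.U j
          ≤ - (if Y = 0 then min 1 (f j 0) * (-κ * (8 * 2 ^ p.ht j - 6) + 2 * -lam) else 0) := by
        split_ifs with h0
        · rw [h0] at h
          rw [min_eq_right h.le, mul_div_assoc, ← mul_neg]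
          apply mul_le_mul_of_nonneg_left _ (hf0 j 0).le
          rw [div_le_iff₀ (by linarith), ← hp.hs j hj]
          have h4 := mul_le_mul_of_nonneg_left (hp.hU2 j) hκ0
          have h5 : 0 ≤ lam * p.U j := by positivity
          linarith
        · simp
      have e2 : (w Y true * ((f (j + 1) (stepTo p.W true Y) - f j Y) / p.cl Y true)
        + w Y false * ((f (j + 1) (stepTo p.W false Y) - f j Y) / p.cl Y false) + 8 * ρ * f j Y)
          / p.U j = -(-(w Y true * ((f (j + 1) (stepTo p.W true Y) - f j Y) / p.cl Y true)) / p.U j)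
          - (-(w Y false * ((f (j + 1) (stepTo p.W false Y) - f j Y) / p.cl Y false)) / p.U j)
          + 2 * (4 * ρ * f j Y / p.U j) := by ring
      linarith
    · rw [tollLow, if_neg (by linarith), min_eq_left h]
      have hb : ∀ b, 0 ≤ w Y b * ((1 - min 1 (f (j + 1) (stepTo p.W b Y))) / p.plen j Y b
            - 0 * (p.plen j Y b - 1) - 2 * -lam * 1) := by
        intro b
        have hww := hw Y b
        have h3 := min_le_left 1 (f (j + 1) (stepTo p.W b Y))
        have h4 : 0 ≤ (1 - min 1 (f (j + 1) (stepTo p.W b Y))) / p.plen j Y b :=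
          div_nonneg (by linarith) (hpl b).le
        exact mul_nonneg (by linarith) (by linarith)
      have h1 : (if Y = 0 then min 1 (f j 0) * (-κ * (8 * 2 ^ p.ht j - 6) + 2 * -lam) else 0) ≤ 0 := by
        split_ifs with h0
        · have : 0 ≤ min 1 (f j 0) * (κ * (8 * 2 ^ p.ht j - 6) + 2 * lam) :=
            mul_nonneg (hF0 j 0).le (add_nonneg (mul_nonneg hκ0 (by linarith)) (by linarith))
          linarith
        · exact le_rfl
      linarith [hb true, hb false]
  · intro y hy _
    have hF : ∀ Y ≤ p.W, min 1 (f p.L Y) = 1 := fun Y hY => min_eq_left (hfL Y hY)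
    have hT : ∀ Y ∈ Finset.range (p.W + 1), y Y * p.tollLow f ρ p.L Y = 0 := by
      intro Y hY
      have := hfL Y (Nat.le_of_lt_succ (Finset.mem_range.1 hY))
      rw [tollLow, if_neg (by linarith), mul_zero]
    rw [Finset.sum_eq_zero hT]
    have h1 : 0 ≤ ∑ Y ∈ Finset.range p.W,
        (y Y * ((min 1 (f p.L Y) - min 1 (f p.L (Y + 1))) / 2 - 0 - 2 * -lam * min 1 (f p.L Y))
          + y (Y + 1) * ((min 1 (f p.L (Y + 1)) - min 1 (f p.L Y)) / 2 - 0
            - 2 * -lam * min 1 (f p.L (Y + 1)))) := by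
      refine Finset.sum_nonneg fun Y hY => ?_
      have hY := Finset.mem_range.1 hY
      rw [hF Y hY.le, hF (Y + 1) hY]
      have h1 := mul_nonneg (hy Y) hl0
      have h2 := mul_nonneg (hy (Y + 1)) hl0
      linarith
    have h2 := mul_nonneg (hy 0) hl0
    rw [hF 0 (Nat.zero_le _)] 
    linarith

lemma strip_lower {N : ℕ} (hp : p.Std K m s ρ) (e : p.gad.Vert ≃ Fin N) {f : ℕ → ℕ → ℝ}
    {w : ℕ → Bool → ℝ} {lam κ : ℝ}
    (hw : ∀ Y b, 1 ≤ w Y b ∧ w Y b ≤ 4) (hf0 : ∀ j Y, 0 < f j Y) (hfL : ∀ Y ≤ p.W, 1 ≤ f p.L Y)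
    (hf2 : ∀ j < p.L, ∀ Y ≤ p.W, ∀ b, f j Y ≤ 2 * f (j + 1) (stepTo p.W b Y))
    (hρ0 : 0 ≤ ρ) (hl0 : 0 ≤ lam) (hκ0 : 0 ≤ κ) (hκ : κ ≤ lam * (1 - 4 * κ * s))
    (hκ1 : 4 * κ * s ≤ 1)
    (hout : ∀ j < p.L, ∀ Y ≤ p.W,
      w Y true * ((f (j + 1) (stepTo p.W true Y) - f j Y) / p.cl Y true)
        + w Y false * ((f (j + 1) (stepTo p.W false Y) - f j Y) / p.cl Y false) + 8 * ρ * f j Y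
      ≤ (if Y = 0 then f j 0 * (κ * s - 6 * κ * m ^ 2) else 0))
    (hoff : 2 * p.gad.off p.blobs ≤ N) (t : ℕ) :
    1 - 36 * p.gad.off p.blobs / N - (1 + lam) ^ t * f 0 0
      ≤ dTV (wMat ((p.gad.net.map e).ew (p.gad.wts (p.wt w))))
        (wSta ((p.gad.net.map e).ew (p.gad.wts (p.wt w)))) t := by
  have hnode : ∀ j, κ * (16 * p.gad.hs (Sum.inl j)) ≤ 4 * κ * s := fun j => hp.hs_le hκ0 j
  have h := Gad.lower (p.gad) e (D := (9:ℕ)) (by norm_num) p.degBound (bl := p.blobs) (wt := p.wt w)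
    (F := fun x => min 1 (f x.1 x.2)) (κ := p.kap (-κ) 0) (lam := lam) hoff (wt_mem hw) hl0
    (fun x => (lt_min zero_lt_one (hf0 _ _)).le) ?_ ?_ ?_ ?_
    (skel_lower hp hw hf0 hfL hf2 hρ0 hl0 hκ0 hout) t (p.node 0 0 (Nat.zero_le _) (Nat.zero_le _))
  · refine le_trans ?_ h
    have h1 : min 1 (f (p.node 0 0 (Nat.zero_le _) (Nat.zero_le _)).1
      (p.node 0 0 (Nat.zero_le _) (Nat.zero_le _)).2) ≤ f 0 0 := min_le_right _ _
    have h2 := mul_le_mul_of_nonneg_left h1 (by positivity : 0 ≤ (1 + lam) ^ t)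
    have e1 : 4 * ((9:ℕ):ℝ) * p.gad.off p.blobs / N = 36 * p.gad.off p.blobs / N := by
      push_cast; ring
    rw [e1]
    linarith
  · intro k hk
    simp only [blobs, Finset.mem_insert, Finset.mem_singleton] at hk
    have : ∃ b, k = Sum.inr b := by rcases hk with rfl | rfl <;> exact ⟨_, rfl⟩
    obtain ⟨b, rfl⟩ := this
    exact ⟨min_eq_left (hfL 0 (Nat.zero_le _)), rfl⟩
  · rintro (j | b)
    · exact ⟨neg_nonpos.2 hκ0, Or.inr ⟨p.ht j, rfl⟩⟩
    · exact ⟨le_rfl, Or.inl le_rfl⟩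
  · rintro (j | b)
    · have e1 : p.kap (-κ) 0 (Sum.inl j) = -κ := rfl
      rw [e1]; linarith [hnode j]
    · have e1 : p.kap (-κ) 0 (Sum.inr b) = 0 := rfl
      rw [e1]; linarith
  · rintro (j | b)
    · have e1 : p.kap (-κ) 0 (Sum.inl j) = -κ := rfl
      rw [e1]
      have := mul_le_mul_of_nonneg_left (hnode j) hl0
      linarith
    · have e1 : p.kap (-κ) 0 (Sum.inr b) = 0 := rfl
      rw [e1]; linarith

end StripPar

end StripLower


/-! ### The unperturbed walk -/

section StripBase

namespace StripPar

/-- a standard strip of length `(a g)²` and width `a g` -/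
structure Full (p : StripPar) (K m s ρ : ℝ) (g : ℕ) : Prop extends p.Std K m s ρ where
  hLg : p.L = (p.a * g) ^ 2
  hWg : p.W = p.a * g
  hLK : (p.L : ℝ) ≤ K
  hρm : 1 ≤ ρ * m
  ha40 : 40 ≤ p.a
  hρa : 10000 * (p.a : ℝ) ^ 4 * ρ ≤ 1
  hgθ : 2 * (g:ℝ) ^ 2 * ((2 * p.a + 1) / (2 * p.a + 2) : ℝ) ^ p.W ≤ 1

variable {p : StripPar} {K m s ρ : ℝ} {g : ℕ}

namespace Full

lemma ρ_pos (hp : p.Full K m s ρ g) : 0 < ρ := by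
  have := hp.m_big
  have := hp.hρm
  by_contra h
  nlinarith

lemma ρ_le (hp : p.Full K m s ρ g) : ρ ≤ 1 := by
  have h1 := hp.hρa
  have h2 : (40:ℝ) ≤ p.a := by exact_mod_cast hp.ha40
  have h3 : 1 ≤ (p.a:ℝ) ^ 4 := one_le_pow₀ (by linarith)
  nlinarith [hp.ρ_pos]

lemma inv_m (hp : p.Full K m s ρ g) : 1 / m ^ 3 ≤ ρ := by
  have h1 := hp.m_big
  have h2 := hp.hρm
  rw [div_le_iff₀ (by positivity)]
  have : m ≤ m ^ 3 := le_self_pow₀ (by linarith) (by norm_num)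
  nlinarith [hp.ρ_pos]

lemma inv_m' (hp : p.Full K m s ρ g) : 1000 * p.a * p.L / m ^ 3 ≤ 1 := by
  have h1 := hp.m_big
  have h2 := hp.K_le
  have h3 := hp.hLK
  have h4 := hp.haK
  have h5 := hp.hK
  rw [div_le_one (by positivity)]
  have : m ≤ m ^ 3 := le_self_pow₀ (by linarith) (by norm_num)
  have h6 : (p.a : ℝ) * p.L ≤ K * K := mul_le_mul h4 h3 (Nat.cast_nonneg _) (by linarith)
  nlinarith

lemma g_pos (hp : p.Full K m s ρ g) : 1 ≤ g := by
  have h1 := p.hW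
  rw [hp.hWg] at h1
  exact Nat.pos_of_ne_zero fun h => by simp [h] at h1

end Full

/-- decay rate of the horizontal profile -/
def thet (p : StripPar) : ℝ := (2 * p.a + 1) / (2 * p.a + 2)

lemma thet_mem (p : StripPar) : 0 < p.thet ∧ p.thet < 1 := by
  rw [thet]
  constructor
  · positivity
  · rw [div_lt_one (by positivity)]; linarith

/-- supersolution for the unperturbed walk -/
def baseF (p : StripPar) (j Y : ℕ) : ℝ := 2 * (1 + p.thet ^ Y + (p.L - j) / p.L)

/-- its gradient -/
def baseG (p : StripPar) (_j Y : ℕ) : ℝ := 2 * (p.thet ^ Y / (2 * p.a + 1) + 1 / p.L)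

lemma baseF_sub (p : StripPar) (j Y Y' : ℕ) :
    p.baseF j Y - p.baseF (j + 1) Y' = 2 * (p.thet ^ Y - p.thet ^ Y') + 2 / p.L := by
  have : (1:ℝ) ≤ p.L := by exact_mod_cast p.hL
  rw [baseF, baseF]; push_cast; field_simp; ring

lemma baseF_le (p : StripPar) (j Y : ℕ) : p.baseF j Y ≤ 6 := by
  have h1 : (1:ℝ) ≤ p.L := by exact_mod_cast p.hL
  have h2 : ((p.L:ℝ) - j) / p.L ≤ 1 := by
    rw [div_le_one (by linarith)]; linarith [(Nat.cast_nonneg j : (0:ℝ) ≤ j)]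
  have h3 := pow_le_one₀ (n := Y) p.thet_mem.1.le p.thet_mem.2.le
  rw [baseF]; linarith

lemma baseF_ge (p : StripPar) {j : ℕ} (hj : j ≤ p.L) (Y : ℕ) : 2 ≤ p.baseF j Y := by
  have h2 : 0 ≤ ((p.L:ℝ) - j) / p.L := by
    have : (j:ℝ) ≤ p.L := by exact_mod_cast hj
    exact div_nonneg (by linarith) (Nat.cast_nonneg _)
  have h3 := pow_pos p.thet_mem.1 Y
  rw [baseF]; linarith

set_option maxHeartbeats 1000000 in
lemma base_out (hp : p.Full K m s ρ g) {j : ℕ} (_hj : j < p.L) {Y : ℕ} (hY : Y ≤ p.W) :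
    8 * ρ * p.baseG j Y + p.baseF j Y / m ^ 3
        + (if Y = 0 then p.baseF j 0 * (1 / (50 * p.a ^ 2)) else 0)
      ≤ 1 * ((p.baseF j Y - p.baseF (j + 1) (stepTo p.W true Y)) / p.cl Y true)
        + 1 * ((p.baseF j Y - p.baseF (j + 1) (stepTo p.W false Y)) / p.cl Y false) := by
  have ha : (40:ℝ) ≤ p.a := by exact_mod_cast hp.ha40
  have hL : (1:ℝ) ≤ p.L := by exact_mod_cast p.hL
  have hρ := hp.ρ_pos
  have hm := hp.m_big
  have hF := p.baseF_le j Y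
  have hF0 := p.baseF_le j 0
  have hmL := hp.inv_m'
  have hρa := hp.hρa
  have hθ := p.thet_mem
  have hθY : 0 < p.thet ^ Y := pow_pos hθ.1 Y
  simp only [baseF_sub, one_mul]
  rw [baseG]
  have hLg : (p.L : ℝ) = (p.a * g) ^ 2 := by rw [hp.hLg]; push_cast; ring
  have hgθ : 2 * (g:ℝ) ^ 2 * p.thet ^ p.W ≤ 1 := hp.hgθ
  set A : ℝ := ((p.a : ℕ) : ℝ)
  set Λ : ℝ := ((p.L : ℕ) : ℝ)
  have hm3 : p.baseF j Y / m ^ 3 ≤ 1 / (100 * A * Λ) := by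
    have h1 : p.baseF j Y / m ^ 3 ≤ 6 / m ^ 3 := by gcongr
    have h2 : 6 / m ^ 3 = 6 / (1000 * A * Λ) * (1000 * A * Λ / m ^ 3) := by field_simp
    have h3 : 6 / (1000 * A * Λ) * (1000 * A * Λ / m ^ 3) ≤ 6 / (1000 * A * Λ) * 1 := by gcongr
    have h4 : 6 / (1000 * A * Λ) ≤ 10 / (1000 * A * Λ) := by gcongr; norm_num
    have h5 : 10 / (1000 * A * Λ) = 1 / (100 * A * Λ) := by field_simp; norm_num
    linarith
  have hρ1 : 16 * ρ ≤ 1 / (100 * A ^ 2) := by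
    rw [le_div_iff₀ (by positivity)]
    have : A ^ 2 * ρ ≤ A ^ 4 * ρ := by
      gcongr
      · linarith
      · norm_num
    linarith
  have hρL : 16 * ρ / Λ ≤ 1 / (100 * A * Λ) := by
    have e1 : 1 / (100 * A * Λ) = (1 / (100 * A)) / Λ := by rw [div_div]
    rw [e1]
    gcongr
    refine hρ1.trans (one_div_le_one_div_of_le (by positivity) ?_)
    nlinarith
  have e0 : 8 * ρ * (2 * (p.thet ^ Y / (2 * A + 1) + 1 / Λ))
    = 16 * ρ * (p.thet ^ Y / (2 * A + 1)) + 16 * ρ / Λ := by ring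
  rw [e0]
  have hAL : 0 < 1 / (A * Λ) := by positivity
  have e3 : 1 / (100 * A * Λ) = 1 / (A * Λ) / 100 := by rw [div_div]; ring
  rw [e3] at hm3 hρL
  have hc1 : p.cl Y true = A := by simp [cl, A]
  have eθ : p.thet = (2 * A + 1) / (2 * A + 2) := rfl
  rw [hc1]
  rcases Nat.eq_zero_or_pos Y with rfl | hY0
  · have hc2 : p.cl 0 false = A + 1 := by
      have := p.hW
      simp [cl, A, (by omega : 0 < p.W)]
    have h1 : stepTo p.W true 0 = 1 := by
      have := p.hW
      simp [stepTo, (by omega : 1 ≤ p.W)]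
    have h2 : stepTo p.W false 0 = 0 := rfl
    rw [hc2, h1, h2, if_pos rfl]
    have e2 : (2 * (p.thet ^ 0 - p.thet ^ 1) + 2 / Λ) / A + (2 * (p.thet ^ 0 - p.thet ^ 0) + 2 / Λ) / (A + 1)
      = 1 / (A * (A + 1)) + 2 * (1 / (A * Λ)) + 2 / (Λ * (A + 1)) := by
      rw [eθ]; field_simp; ring
    rw [e2, pow_zero]
    have h3 : 0 ≤ 2 / (Λ * (A + 1)) := by positivity
    have h4 : p.baseF j 0 * (1 / (50 * A ^ 2)) ≤ 6 * (1 / (50 * A ^ 2)) := by gcongr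
    have h5 : 16 * ρ * (1 / (2 * A + 1)) ≤ 1 / (100 * A ^ 2) * 1 := by
      gcongr
      rw [div_le_one (by positivity)]; linarith
    have h6 : 6 * (1 / (50 * A ^ 2)) + 1 / (100 * A ^ 2) * 1 ≤ 1 / (A * (A + 1)) := by
      have : 6 * (1 / (50 * A ^ 2)) + 1 / (100 * A ^ 2) * 1 = 13 / (100 * A ^ 2) := by
        field_simp; norm_num
      rw [this, div_le_div_iff₀ (by positivity) (by positivity)]
      nlinarith
    linarith
  · rw [if_neg (by omega)]
    obtain ⟨Z, rfl⟩ : ∃ Z, Y = Z + 1 := ⟨Y - 1, by omega⟩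
    have h2 : stepTo p.W false (Z + 1) = Z := rfl
    rw [h2]
    have hpow : p.thet ^ Z = p.thet ^ (Z + 1) * ((2 * A + 2) / (2 * A + 1)) := by
      rw [pow_succ, eθ]; field_simp
    rcases hY.lt_or_eq with hYW | hYW
    · have h1 : stepTo p.W true (Z + 1) = Z + 2 := by simp [stepTo]; omega
      have hc2 : p.cl (Z + 1) false = A + 1 := by
        simp [cl, A, hYW]
      have hpow2 : p.thet ^ (Z + 2) = p.thet ^ (Z + 1) * ((2 * A + 1) / (2 * A + 2)) := by
        rw [← eθ, ← pow_succ]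
      rw [h1, hc2, hpow, hpow2]
      set x := p.thet ^ (Z + 1)
      have e2 : (2 * (x - x * ((2 * A + 1) / (2 * A + 2))) + 2 / Λ) / A
          + (2 * (x - x * ((2 * A + 2) / (2 * A + 1))) + 2 / Λ) / (A + 1)
          = x / (2 * A + 1) * (1 / (A * (A + 1))) + 2 * (1 / (A * Λ)) + 2 / (Λ * (A + 1)) := by
        field_simp; ring
      rw [e2]
      have h3 : 0 ≤ 2 / (Λ * (A + 1)) := by positivity
      have h4 : 16 * ρ * (x / (2 * A + 1)) ≤ x / (2 * A + 1) * (1 / (A * (A + 1))) := by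
        rw [mul_comm]
        gcongr
        refine hρ1.trans (one_div_le_one_div_of_le (by positivity) ?_)
        nlinarith
      linarith
    · have h1 : stepTo p.W true (Z + 1) = Z + 1 := by simp [stepTo]; omega
      have hc2 : p.cl (Z + 1) false = A * (A + 1) := by
        simp [cl, A, hYW]
      rw [h1, hc2, hpow]
      rw [← hYW] at hgθ
      set x := p.thet ^ (Z + 1)
      have e2 : (2 * (x - x) + 2 / Λ) / A
          + (2 * (x - x * ((2 * A + 2) / (2 * A + 1))) + 2 / Λ) / (A * (A + 1))
          = 2 * (1 / (A * Λ)) + 2 / (Λ * (A * (A + 1))) - x * (2 / ((2 * A + 1) * (A * (A + 1)))) := by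
        field_simp; ring
      rw [e2]
      have h3 : 0 ≤ 2 / (Λ * (A * (A + 1))) := by positivity
      have h4 : 16 * ρ * (x / (2 * A + 1)) ≤ 1 / (100 * A ^ 2) * (x / (2 * A + 1)) := by gcongr
      have hg1 : (1:ℝ) ≤ g := by exact_mod_cast hp.g_pos
      have h5 : 1 / (100 * A ^ 2) * (x / (2 * A + 1)) + x * (2 / ((2 * A + 1) * (A * (A + 1))))
          ≤ 3 / 2 * (1 / (A * Λ)) := by
        have h6 : 1 / (100 * A ^ 2) * (x / (2 * A + 1)) ≤ x * (1 / A ^ 3) := by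
          have : 1 / (100 * A ^ 2) * (x / (2 * A + 1)) = x * (1 / (100 * A ^ 2 * (2 * A + 1))) := by
            field_simp
          rw [this]
          gcongr
          nlinarith
        have h7 : x * (2 / ((2 * A + 1) * (A * (A + 1)))) ≤ x * (1 / A ^ 3) := by
          gcongr ?_ * ?_
          rw [div_le_div_iff₀ (by positivity) (by positivity)]
          nlinarith
        have h8 : x * (1 / A ^ 3) ≤ 1 / 2 * (1 / (A * Λ)) := by
          rw [hLg, mul_one_div, ← one_div_mul_one_div, div_le_iff₀ (by positivity)]
          have : 1 / 2 * (1 / A * (1 / (A * g) ^ 2)) * A ^ 3 = 1 / (2 * g ^ 2) := by field_simp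
          rw [this, le_div_iff₀ (by positivity)]
          linarith
        linarith
      linarith

lemma strip_antitone {N : ℕ} (e : p.gad.Vert ≃ Fin N) {w : ℕ → Bool → ℝ}
    (hw : ∀ Y b, 1 ≤ w Y b ∧ w Y b ≤ 4) :
    Antitone (dTV (wMat ((p.gad.net.map e).ew (p.gad.wts (p.wt w))))
      (wSta ((p.gad.net.map e).ew (p.gad.wts (p.wt w))))) := by
  classical
  have : Nonempty (Fin N) := ⟨e (Sum.inl p.corner)⟩
  exact ((p.gad.net.map e).lazyRev
    (fun i => lt_of_lt_of_le one_pos (p.gad.wts_mem (p.wt_mem hw) i).1)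
    (p.gad.net.map_covers e p.gad.covers)).dTV_antitone

lemma base_upper {N : ℕ} (hp : p.Full K m s ρ g) (e : p.gad.Vert ≃ Fin N)
    (hoff : 12 * (p.gad.off p.blobs : ℝ) ≤ N) :
    dTV (walkMat (p.gad.net.map e).graph) (degSta (p.gad.net.map e).graph)
      (⌈(61500 * p.a ^ 2 * s : ℝ)⌉₊) ≤ 1 / 4 := by
  have ha : (40:ℝ) ≤ p.a := by exact_mod_cast hp.ha40
  have hs := hp.s_pos
  have hL : (1:ℝ) ≤ p.L := by exact_mod_cast p.hL
  have hθ := p.thet_mem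
  have ha2 : (0:ℝ) < p.a ^ 2 := by positivity
  set lam : ℝ := 1 / (100 * p.a ^ 2 * s) with hlam
  have hl0 : 0 < lam := by positivity
  have hls : lam * s = 1 / (100 * p.a ^ 2) := by rw [hlam]; field_simp
  have ha3 : (1600:ℝ) ≤ p.a ^ 2 := by nlinarith only [ha]
  have hls1 : lam * s ≤ 1 / 10000 := by
    rw [hls]; apply one_div_le_one_div_of_le (by norm_num); linarith
  have has : lam * p.a ^ 2 * s = 1 / 100 := by rw [hlam]; field_simp
  have hwt : p.wt (fun _ _ => 1) = fun _ => 1 := by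
    funext x; rcases x with ⟨j, Y, b⟩ | Y <;> rfl
  have key := fun t u hu => strip_upper hp.toStd e (F := p.baseF) (G := p.baseG)
    (w := fun _ _ => 1) (lam := lam) (κ := 2 * lam) (B := 6) (fun _ _ => by norm_num)
    (fun j hj Y _ => p.baseF_ge hj Y) (fun j Y _ => p.baseF_le j Y) (by nlinarith [hp.hK])
    (fun j hj Y _ b => ⟨by linarith [p.baseF_ge hj.le Y, p.baseF_le (j + 1) (stepTo p.W b Y)],
      by linarith [p.baseF_ge hj (stepTo p.W b Y), p.baseF_le j Y]⟩)
    (fun j hj Y hY b => by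
      rw [baseF_sub, baseG]
      have hσ : stepTo p.W b Y ≤ Y + 1 := by
        cases b <;> simp [stepTo]; omega
      have h1 := pow_le_pow_of_le_one hθ.1.le hθ.2.le hσ
      have h2 : p.thet ^ Y ≤ p.thet ^ stepTo p.W b Y * (1 + 1 / (2 * p.a + 1)) := by
        have : p.thet ^ Y = p.thet ^ (Y + 1) * (1 + 1 / (2 * p.a + 1)) := by
          rw [pow_succ, thet]; field_simp; ring
        rw [this]; gcongr
      have e1 : p.thet ^ stepTo p.W b Y * (1 + 1 / (2 * p.a + 1))
        = p.thet ^ stepTo p.W b Y + p.thet ^ stepTo p.W b Y / (2 * p.a + 1) := by ring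
      have e2 : 2 / (p.L : ℝ) = 2 * (1 / p.L) := by ring
      linarith)
    (fun j Y => by rw [baseG]; have := pow_pos hθ.1 Y; positivity) hp.ρ_pos.le hl0
    (by linarith) (by linarith) (by nlinarith)
    (by linarith) (by linarith)
    (fun j hj Y hY => by
      have := base_out hp hj hY
      have e1 : 2 * lam * s = 1 / (50 * p.a ^ 2) := by rw [hlam]; field_simp; norm_num
      rw [e1]; exact this)
    (by linarith) t (u := u) hu
  have hanti := strip_antitone (p := p) e (w := fun _ _ => 1) (fun _ _ => by norm_num)
  rw [hwt, Gad.wts_one, ← Net.walkMat_eq, ← Net.degSta_eq] at key hanti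
  have has0 : (1000:ℝ) ≤ p.a ^ 2 * s := by
    have : (1:ℝ) ≤ s := by
      have := hp.m_big
      have := hp.hms
      have : m ≤ m ^ 10 := le_self_pow₀ (by linarith) (by norm_num)
      linarith
    nlinarith
  have hinv : lam * (100 * (p.a ^ 2 * s)) = 1 := by rw [hlam]; field_simp
  set x : ℝ := p.a ^ 2 * s with hx
  have hxx : (61500 * p.a ^ 2 * s : ℝ) = 61500 * x := by rw [hx]; ring
  rw [hxx]
  have hu1 := Nat.le_ceil (60800 * x)
  have hu2 := Nat.ceil_lt_add_one (by positivity : 0 ≤ 60800 * x)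
  have ht1 := Nat.le_ceil (500 * x)
  have ht2 := Nat.ceil_lt_add_one (by positivity : 0 ≤ 500 * x)
  have hk := key ⌈500 * x⌉₊ ⌈60800 * x⌉₊ (Nat.ceil_pos.2 (by positivity))
  refine (hanti ?_).trans (hk.trans ?_)
  · have h3 : ((⌈500 * x⌉₊ + ⌈60800 * x⌉₊ : ℕ) : ℝ) ≤ 61500 * x := by push_cast; linarith
    exact_mod_cast h3.trans (Nat.le_ceil _)
  · have h4 : (1 - lam) ^ ⌈500 * x⌉₊ ≤ Real.exp (-5) := by
      have h5 : (1 - lam) ^ ⌈500 * x⌉₊ ≤ Real.exp (-lam) ^ ⌈500 * x⌉₊ :=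
        pow_le_pow_left₀ (by nlinarith) (Real.one_sub_le_exp_neg lam) _
      refine h5.trans ?_
      rw [← Real.exp_nat_mul, Real.exp_le_exp]
      nlinarith
    have h6 : Real.exp (-5) ≤ 1 / 100 := by
      rw [Real.exp_neg, ← one_div]
      apply one_div_le_one_div_of_le (by norm_num)
      have : Real.exp 5 = Real.exp 1 ^ 5 := by rw [← Real.exp_nat_mul]; norm_num
      rw [this]
      calc (100:ℝ) ≤ 2.7 ^ 5 := by norm_num
        _ ≤ _ := by gcongr; linarith [Real.exp_one_gt_d9]
    have h7 : √(38 / (lam * ⌈60800 * x⌉₊)) ≤ 1 / 4 := by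
      rw [Real.sqrt_le_left (by norm_num), div_le_iff₀ (by positivity)]
      nlinarith
    linarith

end StripPar

end StripBase


/-! ### The perturbed walk: upper bound -/

section StripPertUpper

lemma le_div_of_mul_eq {x A y : ℝ} (hA : 40 ≤ A) (hx : 0 < x) (h : x * A = y) : x ≤ y / 40 := by
  rw [← h, le_div_iff₀ (by norm_num)]
  exact mul_le_mul_of_nonneg_left hA hx.le

lemma le_sq_of_le {A : ℝ} (hA : 40 ≤ A) : 1600 ≤ A ^ 2 := by nlinarith

/-- standing numerical assumptions -/
structure PertNum (A ε ρ : ℝ) : Prop where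
  hA : 40 ≤ A
  hε0 : 0 < ε
  hε1 : ε ≤ 1 / 100
  hAε : 1 ≤ A * ε ^ 2
  hρ0 : 0 < ρ
  hρA : 10000 * A ^ 4 * ρ ≤ 1

namespace PertNum

variable {A ε ρ : ℝ}

lemma ρ_sq (h : PertNum A ε ρ) : ρ * A ^ 2 ≤ 1 / A ^ 2 / 10000 := by
  have := h.hA
  have := h.hρA
  rw [div_div, le_div_iff₀ (by positivity)]
  nlinarith

lemma inv_le (h : PertNum A ε ρ) : 1 / A ^ 2 ≤ ε ^ 2 / A := by
  have := h.hA
  have := h.hAε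
  rw [div_le_div_iff₀ (by positivity) (by positivity)]
  nlinarith

lemma up_interior (h : PertNum A ε ρ) {μ ν : ℝ} (hν : ν = ε / A) (hμ : μ = ν / A * (1 + ε)) :
    25 * ρ ≤ 1 * ((1 - 1 / ((1 + μ) * (1 + ν))) / A)
      + (1 + 3 / A) * ((1 - (1 + ν) / (1 + μ)) / (A + 1)) := by
  have hA := h.hA
  have h0 := h.hε0
  have h1 := h.hε1
  have hρ := h.hρ0
  have hν0 : 0 < ν := by rw [hν]; positivity
  have hμ0 : 0 < μ := by rw [hμ]; positivity
  have hνA : ν * A = ε := by rw [hν]; field_simp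
  have hμA : μ * A = ν * (1 + ε) := by rw [hμ]; field_simp
  have hν1 : ν ≤ 1 / 100 := by linarith [le_div_of_mul_eq hA hν0 hνA]
  have hμ1 : μ ≤ 1 / 100 := by
    linarith [le_div_of_mul_eq hA hμ0 hμA, mul_le_mul_of_nonneg_left h1 hν0.le]
  have e1 : 1 * ((1 - 1 / ((1 + μ) * (1 + ν))) / A)
      + (1 + 3 / A) * ((1 - (1 + ν) / (1 + μ)) / (A + 1))
      = ((2 * A + 4) * μ * (1 + ν) - 2 * ν - (A + 3) * ν ^ 2)
        / ((1 + μ) * (1 + ν) * (A * (A + 1))) := by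
    field_simp; ring
  rw [e1, le_div_iff₀ (by positivity)]
  have h2 : (1 + μ) * (1 + ν) * (A * (A + 1)) ≤ 2 * (A * (2 * A)) := by
    gcongr
    · nlinarith
    · linarith
  have h3 : 25 * ρ * ((1 + μ) * (1 + ν) * (A * (A + 1))) ≤ 25 * ρ * (2 * (A * (2 * A))) := by gcongr
  have h4 := h.ρ_sq
  have h5 := h.inv_le
  have h6 : ε ^ 2 / A = ε * ν := by rw [hν]; ring
  have h7 : 0 < μ * ν := by positivity
  have h8 : (A + 3) * ν ^ 2 ≤ 11 / 10 * (ε * ν) := by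
    have : (A + 3) * ν ^ 2 = (ν * A + 3 * ν) * ν := by ring
    rw [this, hνA]
    have : 3 * ν ≤ ε / 10 := by rw [← hνA]; nlinarith
    nlinarith
  have h9 : 0 < A * (μ * ν) := by positivity
  nlinarith

lemma up_right (h : PertNum A ε ρ) {μ ν : ℝ} (hν : ν = ε / A) (hμ : μ = ν / A * (1 + ε)) :
    25 * ρ ≤ 1 * ((1 - 1 / (1 + μ)) / A) + 1 * ((1 - (1 + ν) / (1 + μ)) / (A * (A + 1))) := by
  have hA := h.hA
  have h0 := h.hε0
  have h1 := h.hε1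
  have hρ := h.hρ0
  have hν0 : 0 < ν := by rw [hν]; positivity
  have hμ0 : 0 < μ := by rw [hμ]; positivity
  have hνA : ν * A = ε := by rw [hν]; field_simp
  have hμA : μ * A = ν * (1 + ε) := by rw [hμ]; field_simp
  have hν1 : ν ≤ 1 / 100 := by linarith [le_div_of_mul_eq hA hν0 hνA]
  have hμ1 : μ ≤ 1 / 100 := by
    linarith [le_div_of_mul_eq hA hμ0 hμA, mul_le_mul_of_nonneg_left h1 hν0.le]
  have e1 : 1 * ((1 - 1 / (1 + μ)) / A) + 1 * ((1 - (1 + ν) / (1 + μ)) / (A * (A + 1)))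
      = ((A + 2) * μ - ν) / ((1 + μ) * (A * (A + 1))) := by
    field_simp; ring
  rw [e1, le_div_iff₀ (by positivity)]
  have h2 : (1 + μ) * (A * (A + 1)) ≤ 2 * (A * (2 * A)) := by
    gcongr
    · linarith
    · linarith
  have h3 : 25 * ρ * ((1 + μ) * (A * (A + 1))) ≤ 25 * ρ * (2 * (A * (2 * A))) := by gcongr
  have h4 := h.ρ_sq
  have h5 := h.inv_le
  have h6 : ε ^ 2 / A = ε * ν := by rw [hν]; ring
  nlinarith

lemma up_left (h : PertNum A ε ρ) {μ ν : ℝ} (hν : ν = ε / A) (hμ : μ = ν / A * (1 + ε)) :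
    25 * ρ + ε * (1 - 3 * ε) * (1 + ε) / A ^ 2
      ≤ 1 * ((1 - 1 / ((1 + μ) * (1 + ν))) / A) + (1 + 3 / A) * ((1 - 1 / (1 + μ)) / (A + 1)) := by
  have hA := h.hA
  have h0 := h.hε0
  have h1 := h.hε1
  have hρ := h.hρ0
  have hν0 : 0 < ν := by rw [hν]; positivity
  have hμ0 : 0 < μ := by rw [hμ]; positivity
  have hνA : ν * A = ε := by rw [hν]; field_simp
  have h2 : 0 ≤ (1 + 3 / A) * ((1 - 1 / (1 + μ)) / (A + 1)) := by
    have : 1 / (1 + μ) ≤ 1 := by rw [div_le_one (by positivity)]; linarith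
    have : 0 ≤ 1 - 1 / (1 + μ) := by linarith
    positivity
  have h3 : ν * (1 - ν) ≤ 1 - 1 / ((1 + μ) * (1 + ν)) := by
    have e : 1 / ((1 + μ) * (1 + ν)) ≤ 1 / (1 + ν) := by
      apply one_div_le_one_div_of_le (by positivity); nlinarith
    have e2 : 1 / (1 + ν) ≤ 1 - ν * (1 - ν) := by
      rw [div_le_iff₀ (by positivity)]; nlinarith [pow_pos hν0 3]
    linarith
  have h4 : ν * (1 - ν) / A ≤ (1 - 1 / ((1 + μ) * (1 + ν))) / A := by gcongr
  have h5 : ν * (1 - ν) / A = (ε - ε * ν) / A ^ 2 := by rw [hν]; field_simp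
  have h6 : 25 * ρ ≤ (ε ^ 2 / 2) / A ^ 2 := by
    rw [le_div_iff₀ (by positivity)]
    have := h.ρ_sq
    have := h.inv_le
    have : ε ^ 2 / A ≤ ε ^ 2 / 1 := by gcongr; linarith
    nlinarith
  have h7 : (ε ^ 2 / 2) / A ^ 2 + ε * (1 - 3 * ε) * (1 + ε) / A ^ 2 ≤ (ε - ε * ν) / A ^ 2 := by
    rw [← add_div]
    gcongr
    have : ν ≤ ε := by nlinarith
    nlinarith [pow_pos h0 3]
  linarith

end PertNum

namespace StripPar

/-- the perturbed weights -/
def pert (p : StripPar) (Y : ℕ) (b : Bool) : ℝ := if b then 1 else if Y < p.W then 1 + 3 / p.a else 1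

variable {p : StripPar} {K m s ρ : ℝ} {g : ℕ}

lemma Full.pert_mem (hp : p.Full K m s ρ g) (Y : ℕ) (b : Bool) : 1 ≤ p.pert Y b ∧ p.pert Y b ≤ 4 := by
  have ha : (40:ℝ) ≤ p.a := by exact_mod_cast hp.ha40
  have h1 : 0 ≤ 3 / (p.a : ℝ) := by positivity
  have h2 : 3 / (p.a : ℝ) ≤ 3 := by rw [div_le_iff₀ (by positivity)]; linarith
  rw [pert]
  split_ifs <;> constructor <;> linarith

lemma Full.pertNum (hp : p.Full K m s ρ g) {ε : ℝ} (hε0 : 0 < ε) (hε1 : ε ≤ 1 / 100)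
    (hAε : 1 ≤ p.a * ε ^ 2) : PertNum p.a ε ρ :=
  ⟨by exact_mod_cast hp.ha40, hε0, hε1, hAε, hp.ρ_pos, hp.hρa⟩

/-- supersolution for the perturbed walk -/
def pertF (p : StripPar) (μ ν : ℝ) (j Y : ℕ) : ℝ := 2 * ((1 + μ) ^ (p.L - j) * (1 + ν) ^ (p.W - Y))

section

variable {μ ν : ℝ}

lemma pertF_true (hμ : 0 < μ) (hν : 0 < ν) {j Y : ℕ} (hj : j < p.L) (hY : Y < p.W) :
    p.pertF μ ν (j + 1) (stepTo p.W true Y) = p.pertF μ ν j Y * (1 / ((1 + μ) * (1 + ν))) := by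
  have h1 : stepTo p.W true Y = Y + 1 := by simp [stepTo]; omega
  have e1 : p.L - j = p.L - (j + 1) + 1 := by omega
  have e2 : p.W - Y = p.W - (Y + 1) + 1 := by omega
  rw [h1, pertF, pertF, e1, e2, pow_succ, pow_succ]
  field_simp

lemma pertF_same (hμ : 0 < μ) {j Y : ℕ} (hj : j < p.L) :
    p.pertF μ ν (j + 1) Y = p.pertF μ ν j Y * (1 / (1 + μ)) := by
  have e1 : p.L - j = p.L - (j + 1) + 1 := by omega
  rw [pertF, pertF, e1, pow_succ]
  field_simp

lemma pertF_false (hμ : 0 < μ) {j Y : ℕ} (hj : j < p.L) (hY : Y + 1 ≤ p.W) :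
    p.pertF μ ν (j + 1) Y = p.pertF μ ν j (Y + 1) * ((1 + ν) / (1 + μ)) := by
  have e1 : p.L - j = p.L - (j + 1) + 1 := by omega
  have e2 : p.W - Y = p.W - (Y + 1) + 1 := by omega
  rw [pertF, pertF, e1, e2, pow_succ, pow_succ]
  field_simp

lemma pertF_le (hμ : 0 < μ) (hν : 0 < ν) (j Y : ℕ) : p.pertF μ ν j Y ≤ p.pertF μ ν 0 0 := by
  rw [pertF, pertF]
  gcongr <;> linarith

lemma pertF_ge (hμ : 0 < μ) (hν : 0 < ν) (j Y : ℕ) : 2 ≤ p.pertF μ ν j Y := by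
  have h1 : 1 ≤ (1 + μ) ^ (p.L - j) := one_le_pow₀ (by linarith)
  have h2 : 1 ≤ (1 + ν) ^ (p.W - Y) := one_le_pow₀ (by linarith)
  rw [pertF]; nlinarith

lemma pertF_ratio (hμ : 0 < μ) (hν : 0 < ν) (hμ1 : μ ≤ 1 / 100) (hν1 : ν ≤ 1 / 100) {j Y : ℕ}
    (hj : j < p.L) (hY : Y ≤ p.W) (b : Bool) :
    p.pertF μ ν (j + 1) (stepTo p.W b Y) ≤ 4 * p.pertF μ ν j Y ∧
      p.pertF μ ν j Y ≤ 4 * p.pertF μ ν (j + 1) (stepTo p.W b Y) := by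
  obtain ⟨r, hr, h1, h2⟩ : ∃ r, p.pertF μ ν (j + 1) (stepTo p.W b Y) = p.pertF μ ν j Y * r ∧
      1 / 4 ≤ r ∧ r ≤ 4 := by
    have hX : 1 / 4 ≤ 1 / (1 + μ) ∧ 1 / (1 + μ) ≤ 4 := by
      constructor
      · apply one_div_le_one_div_of_le <;> linarith
      · rw [div_le_iff₀ (by linarith)]; linarith
    cases b
    · rcases Y with _ | Y
      · exact ⟨_, pertF_same hμ hj, hX⟩
      · refine ⟨_, pertF_false hμ hj hY, ?_, ?_⟩
        · rw [le_div_iff₀ (by linarith)]; linarith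
        · rw [div_le_iff₀ (by linarith)]; linarith
    · rcases hY.lt_or_eq with hY | hY
      · refine ⟨_, pertF_true hμ hν hj hY, ?_, ?_⟩
        · apply one_div_le_one_div_of_le <;> nlinarith
        · rw [div_le_iff₀ (by positivity)]; nlinarith
      · have h1 : stepTo p.W true Y = Y := by simp [stepTo]; omega
        rw [h1]
        exact ⟨_, pertF_same hμ hj, hX⟩
  have := p.pertF_ge hμ hν j Y
  rw [hr]
  constructor <;> nlinarith

lemma pertF_out (hp : p.Full K m s ρ g) {ε : ℝ} (hn : PertNum p.a ε ρ) (hν : ν = ε / p.a)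
    (hμ : μ = ν / p.a * (1 + ε)) {j : ℕ} (hj : j < p.L) {Y : ℕ} (hY : Y ≤ p.W) :
    8 * ρ * (3 * p.pertF μ ν j Y) + p.pertF μ ν j Y / m ^ 3
        + (if Y = 0 then p.pertF μ ν j 0 * (ε * (1 - 3 * ε) * (1 + ε) / p.a ^ 2) else 0)
      ≤ p.pert Y true
          * ((p.pertF μ ν j Y - p.pertF μ ν (j + 1) (stepTo p.W true Y)) / p.cl Y true)
        + p.pert Y false
          * ((p.pertF μ ν j Y - p.pertF μ ν (j + 1) (stepTo p.W false Y)) / p.cl Y false) := by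
  have hA := hn.hA
  have h0 := hn.hε0
  have hν0 : 0 < ν := by rw [hν]; positivity
  have hμ0 : 0 < μ := by rw [hμ]; positivity
  have hF := p.pertF_ge hμ0 hν0 j Y
  have hm : p.pertF μ ν j Y / m ^ 3 ≤ p.pertF μ ν j Y * ρ := by
    rw [div_eq_mul_one_div]
    have := hp.inv_m
    gcongr
  have hc1 : p.cl Y true = p.a := by simp [cl]
  have hw1 : p.pert Y true = 1 := by simp [pert]
  rw [hc1, hw1]
  set f := p.pertF μ ν j Y with hf
  rcases Nat.eq_zero_or_pos Y with rfl | hY0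
  · have hW := p.hW
    have hc2 : p.cl 0 false = p.a + 1 := by simp [cl, (by omega : 0 < p.W)]
    have hw2 : p.pert 0 false = 1 + 3 / p.a := by simp [pert, (by omega : 0 < p.W)]
    have h2 : stepTo p.W false 0 = 0 := rfl
    rw [hc2, hw2, h2, if_pos rfl, pertF_true hμ0 hν0 hj (by omega), pertF_same hμ0 hj, ← hf]
    have := mul_le_mul_of_nonneg_left (hn.up_left hν hμ) (by linarith : 0 ≤ f)
    refine le_trans (le_trans ?_ this) (le_of_eq ?_)
    · linarith
    · ring
  · rw [if_neg (by omega)]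
    obtain ⟨Z, rfl⟩ : ∃ Z, Y = Z + 1 := ⟨Y - 1, by omega⟩
    have h2 : stepTo p.W false (Z + 1) = Z := rfl
    rw [h2, pertF_false hμ0 hj hY, ← hf]
    rcases hY.lt_or_eq with hYW | hYW
    · have hc2 : p.cl (Z + 1) false = p.a + 1 := by simp [cl, hYW]
      have hw2 : p.pert (Z + 1) false = 1 + 3 / p.a := by simp [pert, hYW]
      rw [hc2, hw2, pertF_true hμ0 hν0 hj hYW, ← hf]
      have := mul_le_mul_of_nonneg_left (hn.up_interior hν hμ) (by linarith : 0 ≤ f)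
      refine le_trans (le_trans ?_ this) (le_of_eq ?_)
      · linarith
      · ring
    · have h1 : stepTo p.W true (Z + 1) = Z + 1 := by simp [stepTo]; omega
      have hc2 : p.cl (Z + 1) false = p.a * (p.a + 1) := by simp [cl, hYW]
      have hw2 : p.pert (Z + 1) false = 1 := by simp [pert, hYW]
      rw [hc2, hw2, h1, pertF_same hμ0 hj, ← hf]
      have := mul_le_mul_of_nonneg_left (hn.up_right hν hμ) (by linarith : 0 ≤ f)
      refine le_trans (le_trans ?_ this) (le_of_eq ?_)
      · linarith
      · ring

end

set_option maxHeartbeats 1600000 in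
lemma pert_upper {N : ℕ} (hp : p.Full K m s ρ g) (hKL : (2:ℝ) ^ p.L ≤ K) (e : p.gad.Vert ≃ Fin N)
    {ε : ℝ} (hε0 : 0 < ε) (hε1 : ε ≤ 1 / 100) (hAε : 1 ≤ p.a * ε ^ 2) (hgε : 1 ≤ ε * g)
    (hoff : 4 * K ^ 2 * (p.gad.off p.blobs : ℝ) ≤ N) {t : ℕ}
    (ht : (1 + 12 * ε) * (p.a ^ 2 * s * g ^ 2) ≤ t) :
    dTV (wMat ((p.gad.net.map e).ew (p.gad.wts (p.wt p.pert))))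
        (wSta ((p.gad.net.map e).ew (p.gad.wts (p.wt p.pert)))) t ≤ 6 / (ε * g) := by
  have hn := hp.pertNum hε0 hε1 hAε
  have hA := hn.hA
  have hs := hp.s_pos
  obtain ⟨ν, hν⟩ : ∃ ν, ν = ε / p.a := ⟨_, rfl⟩
  obtain ⟨μ, hμ⟩ : ∃ μ, μ = ν / p.a * (1 + ε) := ⟨_, rfl⟩
  have hν0 : 0 < ν := by rw [hν]; positivity
  have hμ0 : 0 < μ := by rw [hμ]; positivity
  have hνA : ν * p.a = ε := by rw [hν]; field_simp
  have hμA : μ * p.a = ν * (1 + ε) := by rw [hμ]; field_simp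
  have hν1 : ν ≤ 1 / 100 := by linarith [le_div_of_mul_eq hA hν0 hνA]
  have hμ1 : μ ≤ 1 / 100 := by
    linarith [le_div_of_mul_eq hA hμ0 hμA, mul_le_mul_of_nonneg_left hε1 hν0.le]
  have hg0 : (0:ℝ) < g := by exact_mod_cast hp.g_pos
  have hWL : p.W ≤ p.L := by rw [hp.hLg, hp.hWg]; exact Nat.le_self_pow (by norm_num) _
  have hB : p.pertF μ ν 0 0 ≤ 2 * K ^ 2 := by
    have h1 : (1 + μ) ^ (p.L - 0) ≤ 2 ^ p.L := by
      rw [Nat.sub_zero]; gcongr; linarith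
    have h2 : (1 + ν) ^ (p.W - 0) ≤ 2 ^ p.L := by
      rw [Nat.sub_zero]
      calc (1 + ν) ^ p.W ≤ 2 ^ p.W := by gcongr; linarith
        _ ≤ 2 ^ p.L := pow_le_pow_right₀ (by norm_num) hWL
    rw [pertF, sq]
    have hK0 : 0 ≤ K := by linarith [hp.hK]
    exact mul_le_mul_of_nonneg_left (mul_le_mul (h1.trans hKL) (h2.trans hKL) (by positivity) hK0)
      zero_le_two
  have hA2 : (1600:ℝ) ≤ p.a ^ 2 := le_sq_of_le hA
  set lam : ℝ := ε * (1 - 3 * ε) / (p.a ^ 2 * s) with hlam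
  have hl0 : 0 < lam := by
    rw [hlam]; have : 0 < 1 - 3 * ε := by linarith
    positivity
  have has : lam * (p.a ^ 2 * s) = ε * (1 - 3 * ε) := by rw [hlam]; field_simp
  have has1 : lam * (p.a ^ 2 * s) ≤ ε := by rw [has]; linarith [mul_pos hε0 hε0]
  have hls : lam * s * 1600 ≤ ε := by
    have : 0 < lam * s := by positivity
    linarith [mul_le_mul_of_nonneg_left hA2 this.le]
  have hs1 : 1 ≤ s := by
    have := hp.m_big
    have := hp.hms
    have : m ≤ m ^ 10 := le_self_pow₀ (by linarith) (by norm_num)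
    linarith
  have hlam1 : 0 ≤ 1 - lam := by linarith [le_mul_of_one_le_right hl0.le hs1]
  have hκs : 4 * (lam * (1 + ε)) * s ≤ ε := by
    linarith [mul_le_mul_of_nonneg_left hε1 (by positivity : 0 ≤ lam * s)]
  have hoff' : 2 * p.pertF μ ν 0 0 * p.gad.off p.blobs ≤ N := by
    refine le_trans ?_ hoff
    have := mul_le_mul_of_nonneg_right hB (Nat.cast_nonneg (p.gad.off p.blobs) : (0:ℝ) ≤ _)
    linarith
  have key := fun t u hu => strip_upper hp.toStd e (F := p.pertF μ ν)
    (G := fun j Y => 3 * p.pertF μ ν j Y) (w := p.pert) (lam := lam) (κ := lam * (1 + ε))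
    (B := p.pertF μ ν 0 0) hp.pert_mem
    (fun j _ Y _ => p.pertF_ge hμ0 hν0 j Y) (fun j Y _ => p.pertF_le hμ0 hν0 j Y) hB
    (fun j hj Y hY b => pertF_ratio hμ0 hν0 hμ1 hν1 hj hY b)
    (fun j hj Y hY b => by linarith [(p.pertF_ratio hμ0 hν0 hμ1 hν1 hj hY b).2])
    (fun j Y => by linarith [p.pertF_ge hμ0 hν0 j Y]) hp.ρ_pos.le hl0 (by linarith)
    (by linarith) (mul_le_mul_of_nonneg_left (by linarith) hl0.le) (by linarith) (by positivity)
    (fun j hj Y hY => by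
      have h1 := pertF_out hp hn hν hμ hj hY
      have e1 : lam * (1 + ε) * s = ε * (1 - 3 * ε) * (1 + ε) / p.a ^ 2 := by
        rw [hlam]; field_simp
      rw [e1]; exact h1) hoff' t (u := u) hu
  have hanti := strip_antitone (p := p) e hp.pert_mem
  set τ : ℝ := p.a ^ 2 * s * g ^ 2 with hτ
  have hετ : 10 ≤ ε * τ := by
    have hg1 : (1:ℝ) ≤ g := by exact_mod_cast hp.g_pos
    have h1 : 1 * 40 * 1 * 1 ≤ (ε * g) * p.a * s * g := by gcongr
    have h2 : (ε * g) * p.a * s * g ≤ (ε * g) * p.a * s * g * p.a := by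
      apply le_mul_of_one_le_right (by positivity); linarith
    have h3 : ε * τ = (ε * g) * p.a * s * g * p.a := by rw [hτ]; ring
    linarith
  have hτ0 : 0 < τ := by rw [hτ]; positivity
  have ht1 := Nat.le_ceil ((1 + 10 * ε) * τ)
  have ht2 := Nat.ceil_lt_add_one (by positivity : 0 ≤ (1 + 10 * ε) * τ)
  have hu1 := Nat.le_ceil (ε * τ)
  have hu2 := Nat.ceil_lt_add_one (by positivity : 0 ≤ ε * τ)
  have hk := key ⌈(1 + 10 * ε) * τ⌉₊ ⌈ε * τ⌉₊ (Nat.ceil_pos.2 (by positivity))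
  refine (hanti ?_).trans (hk.trans ?_)
  · have h3 : ((⌈(1 + 10 * ε) * τ⌉₊ + ⌈ε * τ⌉₊ : ℕ) : ℝ) ≤ t := by push_cast; linarith
    exact_mod_cast h3
  set x : ℝ := ε * g with hx
  have hlτ : lam * τ = (1 - 3 * ε) * (ε * g ^ 2) := by
    rw [hτ, ← mul_assoc, has]; ring
  have hLr : (p.L : ℝ) = (p.a * g) ^ 2 := by rw [hp.hLg]; push_cast; ring
  have hWr : (p.W : ℝ) = p.a * g := by rw [hp.hWg]; push_cast; ring
  have hmain : p.pertF μ ν 0 0 * (1 - lam) ^ ⌈(1 + 10 * ε) * τ⌉₊ ≤ 2 * Real.exp (- (4 * x ^ 2)) := by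
    have h1 : (1 - lam) ^ ⌈(1 + 10 * ε) * τ⌉₊ ≤ Real.exp (-((1 + 10 * ε) * (lam * τ))) := by
      have h5 : (1 - lam) ^ ⌈(1 + 10 * ε) * τ⌉₊ ≤ Real.exp (-lam) ^ ⌈(1 + 10 * ε) * τ⌉₊ :=
        pow_le_pow_left₀ hlam1 (Real.one_sub_le_exp_neg lam) _
      refine h5.trans ?_
      rw [← Real.exp_nat_mul, Real.exp_le_exp]
      linarith [mul_le_mul_of_nonneg_left ht1 hl0.le]
    have h2 : (1 + μ) ^ p.L ≤ Real.exp (ε * (1 + ε) * g ^ 2) := by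
      have h5 : (1 + μ) ^ p.L ≤ Real.exp μ ^ p.L :=
        pow_le_pow_left₀ (by linarith) (by linarith [Real.add_one_le_exp μ]) _
      refine h5.trans ?_
      rw [← Real.exp_nat_mul, Real.exp_le_exp, hLr, hμ, hν]
      apply le_of_eq; field_simp
    have h3 : (1 + ν) ^ p.W ≤ Real.exp (ε * g) := by
      have h5 : (1 + ν) ^ p.W ≤ Real.exp ν ^ p.W :=
        pow_le_pow_left₀ (by linarith) (by linarith [Real.add_one_le_exp ν]) _
      refine h5.trans ?_
      rw [← Real.exp_nat_mul, Real.exp_le_exp, hWr, hν]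
      apply le_of_eq; field_simp
    rw [pertF, Nat.sub_zero, Nat.sub_zero]
    calc 2 * ((1 + μ) ^ p.L * (1 + ν) ^ p.W) * (1 - lam) ^ ⌈(1 + 10 * ε) * τ⌉₊
        ≤ 2 * (Real.exp (ε * (1 + ε) * g ^ 2) * Real.exp (ε * g))
            * Real.exp (-((1 + 10 * ε) * (lam * τ))) := by
          gcongr
      _ = 2 * Real.exp (ε * (1 + ε) * g ^ 2 + ε * g + -((1 + 10 * ε) * (lam * τ))) := by
          rw [Real.exp_add, Real.exp_add]; ring
      _ ≤ _ := by
          gcongr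
          rw [hlτ]
          have h6 : ε * g ≤ ε ^ 2 * g ^ 2 := by
            rw [← mul_pow]
            exact le_self_pow₀ hgε (by norm_num)
          have h7 : 0 < ε ^ 2 * g ^ 2 := by positivity
          have h8 : ε * (ε ^ 2 * g ^ 2) ≤ 1 / 100 * (ε ^ 2 * g ^ 2) := by gcongr
          rw [hx]
          linarith
  have hx0 : 0 < x := by linarith
  have hexp : Real.exp (-(4 * x ^ 2)) ≤ 1 / (4 * x) := by
    rw [Real.exp_neg, ← one_div]
    apply one_div_le_one_div_of_le (by positivity)
    have := Real.add_one_le_exp (4 * x ^ 2)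
    linarith [sq_nonneg (2 * x - 1)]
  have hsq : √(38 / (lam * ⌈ε * τ⌉₊)) ≤ 10 / x := by
    rw [Real.sqrt_le_left (by positivity), div_pow]
    have h1 : x ^ 2 / 2 ≤ lam * ⌈ε * τ⌉₊ := by
      have h2 : lam * (ε * τ) ≤ lam * ⌈ε * τ⌉₊ := by gcongr
      have h3 : lam * (ε * τ) = (1 - 3 * ε) * x ^ 2 := by
        rw [hx, show lam * (ε * τ) = ε * (lam * τ) by ring, hlτ]; ring
      linarith [mul_le_mul_of_nonneg_right hε1 (sq_nonneg x), sq_nonneg x]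
    calc 38 / (lam * ⌈ε * τ⌉₊) ≤ 38 / (x ^ 2 / 2) := by gcongr
      _ = 76 / x ^ 2 := by field_simp; norm_num
      _ ≤ _ := by gcongr; norm_num
  have e6 : 6 / x = 4 * (1 / (4 * x)) + 10 / x / 2 := by field_simp; norm_num
  rw [e6]
  linarith

end StripPar

end StripPertUpper


/-! ### The perturbed walk: lower bound -/

section StripPertLower

namespace PertNum

variable {A ε ρ : ℝ}

lemma inv_A (h : PertNum A ε ρ) : 1 ≤ A * ε / 100 := by
  have := h.hA
  have := h.hAε
  have := h.hε1
  have := h.hε0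
  nlinarith

lemma low_interior (h : PertNum A ε ρ) {μ ν : ℝ} (hν : ν = ε / A) (hμ : μ = ν / A * (1 - 4 * ε)) :
    1 * (((1 + μ) * (1 + ν) - 1) / A) + (1 + 3 / A) * (((1 + μ) / (1 + ν) - 1) / (A + 1)) + 8 * ρ
      ≤ 0 := by
  have hA := h.hA
  have h0 := h.hε0
  have h1 := h.hε1
  have hρ := h.hρ0
  have hν0 : 0 < ν := by rw [hν]; positivity
  have h4ε : 0 < 1 - 4 * ε := by linarith
  have hμ0 : 0 < μ := by rw [hμ]; positivity
  have hνA : ν * A = ε := by rw [hν]; field_simp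
  have hμA : μ * A = ν * (1 - 4 * ε) := by rw [hμ]; field_simp
  have hνε : ν ≤ ε / 40 := le_div_of_mul_eq hA hν0 hνA
  have hμε : μ ≤ ε * ν / 100 := by
    have h2 := h.inv_A
    have : μ * 1 ≤ μ * (A * ε / 100) := by gcongr
    have e : μ * (A * ε / 100) = ν * (1 - 4 * ε) * (ε / 100) := by rw [← hμA]; ring
    have : ν * (1 - 4 * ε) * (ε / 100) ≤ ν * 1 * (ε / 100) := by gcongr; linarith
    linarith
  have e1 : 1 * (((1 + μ) * (1 + ν) - 1) / A) + (1 + 3 / A) * (((1 + μ) / (1 + ν) - 1) / (A + 1))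
        + 8 * ρ
      = ((A + 1) * (1 + ν) * (μ + ν + μ * ν) + (A + 3) * (μ - ν) + 8 * ρ * (A * (A + 1) * (1 + ν)))
        / (A * (A + 1) * (1 + ν)) := by
    field_simp; ring
  rw [e1]
  apply div_nonpos_of_nonpos_of_nonneg _ (by positivity)
  have h3 : 8 * ρ * (A * (A + 1) * (1 + ν)) ≤ 8 * ρ * (A * (2 * A) * 2) := by
    gcongr
    · linarith
    · linarith
  have h4 := h.ρ_sq
  have h5 := h.inv_le
  have h6 : ε ^ 2 / A = ε * ν := by rw [hν]; ring
  have e2 : (A + 1) * (1 + ν) * (μ + ν + μ * ν) + (A + 3) * (μ - ν)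
      = 2 * (μ * A) + 4 * μ - 2 * ν + (ν * A) * ν + ν ^ 2 + (μ * A + μ) * (2 * ν + ν ^ 2) := by ring
  rw [e2, hμA, hνA]
  have hεν : 0 < ε * ν := by positivity
  have h7 : (ν * (1 - 4 * ε) + μ) * (2 * ν + ν ^ 2) ≤ (ν * 1 + ν) * (2 * ν + 1 * ν) := by
    gcongr
    · linarith
    · nlinarith
    · nlinarith
  have h8 : ν ^ 2 ≤ ε * ν / 40 := by linarith [mul_le_mul_of_nonneg_left hνε hν0.le]
  nlinarith

lemma low_right (h : PertNum A ε ρ) {μ ν : ℝ} (hν : ν = ε / A) (hμ : μ = ν / A * (1 - 4 * ε)) :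
    1 * (((1 + μ) - 1) / A) + 1 * (((1 + μ) / (1 + ν) - 1) / (A * (A + 1))) + 8 * ρ ≤ 0 := by
  have hA := h.hA
  have h0 := h.hε0
  have h1 := h.hε1
  have hρ := h.hρ0
  have hν0 : 0 < ν := by rw [hν]; positivity
  have h4ε : 0 < 1 - 4 * ε := by linarith
  have hμ0 : 0 < μ := by rw [hμ]; positivity
  have hνA : ν * A = ε := by rw [hν]; field_simp
  have hμA : μ * A = ν * (1 - 4 * ε) := by rw [hμ]; field_simp
  have hνε : ν ≤ ε / 40 := le_div_of_mul_eq hA hν0 hνA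
  have hμε : μ ≤ ε * ν / 100 := by
    have h2 := h.inv_A
    have : μ * 1 ≤ μ * (A * ε / 100) := by gcongr
    have e : μ * (A * ε / 100) = ν * (1 - 4 * ε) * (ε / 100) := by rw [← hμA]; ring
    have : ν * (1 - 4 * ε) * (ε / 100) ≤ ν * 1 * (ε / 100) := by gcongr; linarith
    linarith
  have e1 : 1 * (((1 + μ) - 1) / A) + 1 * (((1 + μ) / (1 + ν) - 1) / (A * (A + 1))) + 8 * ρ
      = ((A + 1) * μ * (1 + ν) + (μ - ν) + 8 * ρ * (A * (A + 1) * (1 + ν)))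
        / (A * (A + 1) * (1 + ν)) := by
    field_simp; ring
  rw [e1]
  apply div_nonpos_of_nonpos_of_nonneg _ (by positivity)
  have h3 : 8 * ρ * (A * (A + 1) * (1 + ν)) ≤ 8 * ρ * (A * (2 * A) * 2) := by
    gcongr
    · linarith
    · linarith
  have h4 := h.ρ_sq
  have h5 := h.inv_le
  have h6 : ε ^ 2 / A = ε * ν := by rw [hν]; ring
  have e2 : (A + 1) * μ * (1 + ν) + (μ - ν) = (μ * A + μ) * (1 + ν) + μ - ν := by ring
  rw [e2, hμA]
  have hεν : 0 < ε * ν := by positivity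
  have h8 : ν ^ 2 ≤ ε * ν / 40 := by linarith [mul_le_mul_of_nonneg_left hνε hν0.le]
  have h9 : μ * ν ≤ μ * 1 := by gcongr; linarith
  have h10 : 0 < ε * ν ^ 2 := by positivity
  nlinarith

lemma low_left (h : PertNum A ε ρ) {μ ν : ℝ} (hν : ν = ε / A) (hμ : μ = ν / A * (1 - 4 * ε)) :
    1 * (((1 + μ) * (1 + ν) - 1) / A) + (1 + 3 / A) * (((1 + μ) - 1) / (A + 1)) + 8 * ρ
      ≤ ε * (1 + ε) / A ^ 2 := by
  have hA := h.hA
  have h0 := h.hε0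
  have h1 := h.hε1
  have hρ := h.hρ0
  have hν0 : 0 < ν := by rw [hν]; positivity
  have h4ε : 0 < 1 - 4 * ε := by linarith
  have hμ0 : 0 < μ := by rw [hμ]; positivity
  have hνA : ν * A = ε := by rw [hν]; field_simp
  have hμA : μ * A = ν * (1 - 4 * ε) := by rw [hμ]; field_simp
  have hinv := h.inv_A
  have hνε : ν ≤ ε ^ 2 / 100 := by
    have : ν * 1 ≤ ν * (A * ε / 100) := by gcongr
    have e : ν * (A * ε / 100) = (ν * A) * ε / 100 := by ring
    rw [e, hνA] at this
    nlinarith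
  have e1 : 1 * (((1 + μ) * (1 + ν) - 1) / A) + (1 + 3 / A) * (((1 + μ) - 1) / (A + 1)) + 8 * ρ
      = ((μ * A) * (1 + ν) + ν * A + (A + 3) / (A + 1) * (μ * A) + 8 * (ρ * A ^ 2)) / A ^ 2 := by
    field_simp; ring
  rw [e1, hνA, hμA]
  gcongr
  have h4 := h.ρ_sq
  have h5 := h.inv_le
  have h6 : ε ^ 2 / A = ε * ν := by rw [hν]; ring
  have h7 : (A + 3) / (A + 1) * (ν * (1 - 4 * ε)) ≤ 2 * (ν * 1) := by
    gcongr
    · rw [div_le_iff₀ (by positivity)]; linarith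
    · linarith
  have h8 : ν * (1 - 4 * ε) * (1 + ν) ≤ ν * 1 * 2 := by
    gcongr
    · linarith
    · nlinarith
  nlinarith

end PertNum

namespace StripPar

variable {p : StripPar} {K m s ρ : ℝ} {g : ℕ}

/-- subsolution for the perturbed walk -/
def pertS (p : StripPar) (μ ν : ℝ) (j Y : ℕ) : ℝ := ((1 + μ) ^ (p.L - j))⁻¹ * (1 + ν) ^ Y

section

variable {μ ν : ℝ}

lemma pertS_true (hμ : 0 < μ) {j Y : ℕ} (hj : j < p.L) (hY : Y < p.W) :
    p.pertS μ ν (j + 1) (stepTo p.W true Y) = p.pertS μ ν j Y * ((1 + μ) * (1 + ν)) := by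
  have h1 : stepTo p.W true Y = Y + 1 := by simp [stepTo]; omega
  have e1 : p.L - j = p.L - (j + 1) + 1 := by omega
  rw [h1, pertS, pertS, e1, pow_succ, pow_succ]
  field_simp

lemma pertS_same (hμ : 0 < μ) {j Y : ℕ} (hj : j < p.L) :
    p.pertS μ ν (j + 1) Y = p.pertS μ ν j Y * (1 + μ) := by
  have e1 : p.L - j = p.L - (j + 1) + 1 := by omega
  rw [pertS, pertS, e1, pow_succ]
  field_simp

lemma pertS_false (hμ : 0 < μ) (hν : 0 < ν) {j Y : ℕ} (hj : j < p.L) :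
    p.pertS μ ν (j + 1) Y = p.pertS μ ν j (Y + 1) * ((1 + μ) / (1 + ν)) := by
  have e1 : p.L - j = p.L - (j + 1) + 1 := by omega
  rw [pertS, pertS, e1, pow_succ, pow_succ]
  field_simp

lemma pertS_pos (hμ : 0 < μ) (hν : 0 < ν) (j Y : ℕ) : 0 < p.pertS μ ν j Y := by
  rw [pertS]; positivity

lemma pertS_ratio (hμ : 0 < μ) (hν : 0 < ν) (hν1 : ν ≤ 1 / 100) {j Y : ℕ}
    (hj : j < p.L) (hY : Y ≤ p.W) (b : Bool) :
    p.pertS μ ν j Y ≤ 2 * p.pertS μ ν (j + 1) (stepTo p.W b Y) := by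
  obtain ⟨r, hr, h1⟩ : ∃ r, p.pertS μ ν (j + 1) (stepTo p.W b Y) = p.pertS μ ν j Y * r ∧
      1 / 2 ≤ r := by
    cases b
    · rcases Y with _ | Y
      · exact ⟨_, pertS_same hμ hj, by linarith⟩
      · refine ⟨_, pertS_false hμ hν hj, ?_⟩
        rw [le_div_iff₀ (by linarith)]; linarith
    · rcases hY.lt_or_eq with hY | hY
      · exact ⟨_, pertS_true hμ hj hY, by nlinarith⟩
      · have h1 : stepTo p.W true Y = Y := by simp [stepTo]; omega
        rw [h1]
        exact ⟨_, pertS_same hμ hj, by linarith⟩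
  have := p.pertS_pos hμ hν j Y
  rw [hr]
  nlinarith

lemma pertS_out {ε : ℝ} (hn : PertNum p.a ε ρ) (hν : ν = ε / p.a)
    (hμ : μ = ν / p.a * (1 - 4 * ε)) {c : ℝ} (hc : ε * (1 + ε) / p.a ^ 2 ≤ c)
    {j : ℕ} (hj : j < p.L) {Y : ℕ} (hY : Y ≤ p.W) :
    p.pert Y true * ((p.pertS μ ν (j + 1) (stepTo p.W true Y) - p.pertS μ ν j Y) / p.cl Y true)
        + p.pert Y false
          * ((p.pertS μ ν (j + 1) (stepTo p.W false Y) - p.pertS μ ν j Y) / p.cl Y false)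
        + 8 * ρ * p.pertS μ ν j Y
      ≤ (if Y = 0 then p.pertS μ ν j 0 * c else 0) := by
  have hA := hn.hA
  have h0 := hn.hε0
  have hν0 : 0 < ν := by rw [hν]; positivity
  have hμ0 : 0 < μ := by
    have : 0 < 1 - 4 * ε := by linarith [hn.hε1]
    rw [hμ]; positivity
  have hF := p.pertS_pos hμ0 hν0 j Y
  have hc1 : p.cl Y true = p.a := by simp [cl]
  have hw1 : p.pert Y true = 1 := by simp [pert]
  rw [hc1, hw1]
  set f := p.pertS μ ν j Y with hf
  rcases Nat.eq_zero_or_pos Y with rfl | hY0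
  · have hW := p.hW
    have hc2 : p.cl 0 false = p.a + 1 := by simp [cl, (by omega : 0 < p.W)]
    have hw2 : p.pert 0 false = 1 + 3 / p.a := by simp [pert, (by omega : 0 < p.W)]
    have h2 : stepTo p.W false 0 = 0 := rfl
    rw [hc2, hw2, h2, if_pos rfl, pertS_true hμ0 hj (by omega), pertS_same hμ0 hj, ← hf]
    have := mul_le_mul_of_nonneg_left ((hn.low_left hν hμ).trans hc) hF.le
    refine le_trans (le_of_eq ?_) this
    ring
  · rw [if_neg (by omega)]
    obtain ⟨Z, rfl⟩ : ∃ Z, Y = Z + 1 := ⟨Y - 1, by omega⟩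
    have h2 : stepTo p.W false (Z + 1) = Z := rfl
    rw [h2, pertS_false (Y := Z) hμ0 hν0 hj, ← hf]
    rcases hY.lt_or_eq with hYW | hYW
    · have hc2 : p.cl (Z + 1) false = p.a + 1 := by simp [cl, hYW]
      have hw2 : p.pert (Z + 1) false = 1 + 3 / p.a := by simp [pert, hYW]
      rw [hc2, hw2, pertS_true hμ0 hj hYW, ← hf]
      have := mul_nonpos_of_nonneg_of_nonpos hF.le (hn.low_interior hν hμ)
      refine le_trans (le_of_eq ?_) this
      ring
    · have h1 : stepTo p.W true (Z + 1) = Z + 1 := by simp [stepTo]; omega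
      have hc2 : p.cl (Z + 1) false = p.a * (p.a + 1) := by simp [cl, hYW]
      have hw2 : p.pert (Z + 1) false = 1 := by simp [pert, hYW]
      rw [hc2, hw2, h1, pertS_same hμ0 hj, ← hf]
      have := mul_nonpos_of_nonneg_of_nonpos hF.le (hn.low_right hν hμ)
      refine le_trans (le_of_eq ?_) this
      ring

end

set_option maxHeartbeats 1600000 in
lemma pert_lower {N : ℕ} (hp : p.Full K m s ρ g) (e : p.gad.Vert ≃ Fin N)
    {ε : ℝ} (hε0 : 0 < ε) (hε1 : ε ≤ 1 / 100) (hAε : 1 ≤ p.a * ε ^ 2) (hgε : 1 ≤ ε * g)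
    (hoff : 2 * p.gad.off p.blobs ≤ N) {t : ℕ}
    (ht : t ≤ (1 - 12 * ε) * (p.a ^ 2 * s * g ^ 2)) :
    1 - 36 * p.gad.off p.blobs / N - 1 / (ε * g)
      ≤ dTV (wMat ((p.gad.net.map e).ew (p.gad.wts (p.wt p.pert))))
        (wSta ((p.gad.net.map e).ew (p.gad.wts (p.wt p.pert)))) t := by
  have hn := hp.pertNum hε0 hε1 hAε
  have hA := hn.hA
  have hs := hp.s_pos
  have hm := hp.m_big
  obtain ⟨ν, hν⟩ : ∃ ν, ν = ε / p.a := ⟨_, rfl⟩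
  obtain ⟨μ, hμ⟩ : ∃ μ, μ = ν / p.a * (1 - 4 * ε) := ⟨_, rfl⟩
  have h4ε : 0 < 1 - 4 * ε := by linarith
  have hν0 : 0 < ν := by rw [hν]; positivity
  have hμ0 : 0 < μ := by rw [hμ]; positivity
  have hνA : ν * p.a = ε := by rw [hν]; field_simp
  have hμA : μ * p.a = ν * (1 - 4 * ε) := by rw [hμ]; field_simp
  have hνε' : ν ≤ ε / 40 := le_div_of_mul_eq hA hν0 hνA
  have hν1 : ν ≤ 1 / 100 := by linarith
  have hνε : ν ≤ ε := by linarith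
  have hμε : μ ≤ ε := by linarith [le_div_of_mul_eq hA hμ0 hμA, mul_pos hν0 hε0]
  have hA2 : (1600:ℝ) ≤ p.a ^ 2 := le_sq_of_le hA
  set lam : ℝ := ε * (1 + 4 * ε) / (p.a ^ 2 * s) with hlam
  have hl0 : 0 < lam := by rw [hlam]; positivity
  have has : lam * (p.a ^ 2 * s) = ε * (1 + 4 * ε) := by rw [hlam]; field_simp
  set κ : ℝ := lam / (1 + ε) with hκ
  have hκ0 : 0 < κ := by rw [hκ]; positivity
  have hκl : κ * (1 + ε) = lam := by rw [hκ]; field_simp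
  have hκl' : κ ≤ lam := by linarith [mul_pos hκ0 hε0]
  have hls : lam * s * 1600 ≤ 2 * ε := by
    have : 0 < lam * s := by positivity
    linarith [mul_le_mul_of_nonneg_left hA2 this.le, mul_le_mul_of_nonneg_left hε1 hε0.le]
  have hκs : 4 * κ * s ≤ ε / 100 := by
    have : κ * s ≤ lam * s := by gcongr
    linarith
  have hout : ε * (1 + ε) / p.a ^ 2 ≤ κ * s - 6 * κ * m ^ 2 := by
    have e1 : κ * s = ε * (1 + 4 * ε) / (1 + ε) / p.a ^ 2 := by rw [hκ, hlam]; field_simp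
    have h1 : ε * (1 + 2 * ε) / p.a ^ 2 ≤ κ * s := by
      rw [e1]
      gcongr
      rw [le_div_iff₀ (by positivity)]
      nlinarith [pow_pos hε0 3]
    have h2 : 6 * m ^ 2 * m ≤ s := by
      have : m ^ 3 ≤ m ^ 10 := pow_le_pow_right₀ (by linarith) (by norm_num)
      have := hp.hms
      have : 0 < m ^ 10 := by positivity
      linarith [(by ring : 6 * m ^ 2 * m = 6 * m ^ 3)]
    have h3 : 6 * κ * m ^ 2 ≤ κ * s * ρ := by
      have : 6 * κ * m ^ 2 * 1 ≤ 6 * κ * m ^ 2 * (ρ * m) := by gcongr; exact hp.hρm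
      have : κ * ρ * (6 * m ^ 2 * m) ≤ κ * ρ * s := by
        have := hp.ρ_pos
        gcongr
      linarith
    have h4 : κ * s ≤ 1 := by linarith
    have h5 : κ * s * ρ ≤ 1 * ρ := by
      have := hp.ρ_pos
      gcongr
    have h6 : ρ ≤ ε * ε / p.a ^ 2 := by
      rw [le_div_iff₀ (by positivity)]
      have := hn.ρ_sq
      have := hn.inv_le
      have : ε ^ 2 / p.a ≤ ε ^ 2 / 1 := by gcongr; linarith
      nlinarith
    have e2 : ε * (1 + 2 * ε) / p.a ^ 2 = ε * (1 + ε) / p.a ^ 2 + ε * ε / p.a ^ 2 := by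
      rw [← add_div]; ring
    linarith
  have key := strip_lower hp.toStd e (f := p.pertS μ ν) (w := p.pert) (lam := lam) (κ := κ)
    hp.pert_mem (p.pertS_pos hμ0 hν0)
    (fun Y _ => by
      rw [pertS, Nat.sub_self, pow_zero, inv_one, one_mul]
      exact one_le_pow₀ (by linarith))
    (fun j hj Y hY b => pertS_ratio hμ0 hν0 hν1 hj hY b) hp.ρ_pos.le hl0.le hκ0.le
    (by
      have h1 := mul_le_mul_of_nonneg_left (by linarith : 1 - ε / 100 ≤ 1 - 4 * κ * s)
        (by linarith : 0 ≤ 1 + ε)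
      rw [← hκl, mul_assoc]
      exact le_mul_of_one_le_right hκ0.le
        (by linarith [mul_le_mul_of_nonneg_left hε1 hε0.le])) (by linarith)
    (fun j hj Y hY => pertS_out hn hν hμ hout hj hY) hoff t
  refine le_trans ?_ key
  have hg0 : (0:ℝ) < g := by exact_mod_cast hp.g_pos
  set x : ℝ := ε * g with hx
  have hx0 : 0 < x := by linarith
  have hLr : (p.L : ℝ) = (p.a * g) ^ 2 := by rw [hp.hLg]; push_cast; ring
  have hμL : μ * p.L = (1 - 4 * ε) * (ε * g ^ 2) := by
    rw [hLr, hμ, hν]; field_simp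
  have h1 : (1 + lam) ^ t ≤ Real.exp (ε * (1 + 4 * ε) * (1 - 12 * ε) * g ^ 2) := by
    have h5 : (1 + lam) ^ t ≤ Real.exp lam ^ t :=
      pow_le_pow_left₀ (by linarith) (by linarith [Real.add_one_le_exp lam]) _
    refine h5.trans ?_
    rw [← Real.exp_nat_mul, Real.exp_le_exp]
    calc t * lam ≤ (1 - 12 * ε) * (p.a ^ 2 * s * g ^ 2) * lam := by gcongr
      _ = (1 - 12 * ε) * g ^ 2 * (lam * (p.a ^ 2 * s)) := by ring
      _ = _ := by rw [has]; ring
  have h2 : Real.exp (μ * p.L * (1 - ε)) ≤ (1 + μ) ^ p.L := by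
    have h5 : Real.exp (μ * (1 - ε)) ≤ 1 + μ := by
      rw [← Real.le_log_iff_exp_le (by linarith)]
      have h6 := Real.one_sub_inv_le_log_of_pos (by linarith : 0 < 1 + μ)
      refine le_trans ?_ h6
      have : (1 + μ)⁻¹ ≤ 1 - μ * (1 - μ) := by
        rw [inv_le_iff_one_le_mul₀ (by linarith)]
        nlinarith [pow_pos hμ0 3]
      nlinarith
    have h7 : Real.exp (μ * p.L * (1 - ε)) = Real.exp (μ * (1 - ε)) ^ p.L := by
      rw [← Real.exp_nat_mul]; congr 1; ring
    rw [h7]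
    exact pow_le_pow_left₀ (Real.exp_pos _).le h5 _
  have h3 : (1 + lam) ^ t * p.pertS μ ν 0 0 ≤ 1 / x := by
    rw [pertS, Nat.sub_zero, pow_zero, mul_one, ← div_eq_mul_inv]
    calc (1 + lam) ^ t / (1 + μ) ^ p.L
        ≤ Real.exp (ε * (1 + 4 * ε) * (1 - 12 * ε) * g ^ 2) / Real.exp (μ * p.L * (1 - ε)) := by
          gcongr
      _ = Real.exp (ε * (1 + 4 * ε) * (1 - 12 * ε) * g ^ 2 - μ * p.L * (1 - ε)) := by
          rw [Real.exp_sub]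
      _ ≤ Real.exp (-(2 * x ^ 2)) := by
          rw [hμL]
          gcongr
          have h7 : 0 < ε ^ 2 * g ^ 2 := by positivity
          have h8 : 0 < ε * (ε ^ 2 * g ^ 2) := by positivity
          rw [hx]
          linarith [mul_le_mul_of_nonneg_right hε1 h7.le, mul_pos hε0 h8]
      _ ≤ 1 / (2 * x ^ 2) := by
          rw [Real.exp_neg, ← one_div]
          apply one_div_le_one_div_of_le (by positivity)
          linarith [Real.add_one_le_exp (2 * x ^ 2)]
      _ ≤ 1 / x := by
          apply one_div_le_one_div_of_le hx0
          nlinarith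
  linarith

end StripPar

end StripPertLower


/-! ### Choice of the strip -/

section Choice

namespace StripPar

lemma off_eq (p : StripPar) : p.gad.off p.blobs = (p.L + 1) * (p.W + 1)
    + ∑ e, (p.gad.len e - 1) + ∑ j : Fin p.L, (2 ^ (p.ht j + 1) - 1) := by
  rw [Gad.off]
  congr 1
  · simp
  · have h : p.blobsᶜ = Finset.univ.map ⟨Sum.inl, Sum.inl_injective⟩ := by
      ext k; rcases k with j | b
      · simp [blobs]
      · cases b <;> simp [blobs]
    rw [h, Finset.sum_map]
    rfl

lemma off_le (p : StripPar) {K A B : ℕ} (hL : p.L ≤ K) (hW : p.W ≤ K) (hK : 1 ≤ K)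
    (hA : ∀ j Y b, p.plen j Y b ≤ A) (hA1 : 2 ≤ A) (hB : ∀ j < p.L, 2 ^ (p.ht j + 1) ≤ B) :
    p.gad.off p.blobs ≤ 7 * K ^ 2 * A + K * B := by
  rw [off_eq]
  have h1 : (p.L + 1) * (p.W + 1) ≤ (2 * K) * (2 * K) := Nat.mul_le_mul (by omega) (by omega)
  have h2 : ∑ e, (p.gad.len e - 1) ≤ ∑ _e : p.SEdge, A := by
    refine Finset.sum_le_sum fun e _ => (Nat.sub_le _ _).trans ?_
    rcases e with ⟨j, Y, b⟩ | Y
    · exact hA _ _ _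
    · exact hA1
  have h3 : ∑ j : Fin p.L, (2 ^ (p.ht j + 1) - 1) ≤ ∑ _j : Fin p.L, B :=
    Finset.sum_le_sum fun j _ => (Nat.sub_le _ _).trans (hB j j.2)
  have h4 : Fintype.card p.SEdge = p.L * ((p.W + 1) * 2) + p.W := by simp
  simp only [Finset.sum_const, Finset.card_univ, smul_eq_mul, Fintype.card_fin] at h2 h3
  rw [h4] at h2
  have h5 : p.L * ((p.W + 1) * 2) + p.W ≤ K * (2 * K * 2) + K * K := by
    gcongr
    · omega
    · nlinarith
  have h6 : (p.L * ((p.W + 1) * 2) + p.W) * A ≤ (K * (2 * K * 2) + K * K) * A := by gcongr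
  have h7 : p.L * B ≤ K * B := by gcongr
  have h8 : (2 * K) * (2 * K) * 2 ≤ (2 * K) * (2 * K) * A := by gcongr
  nlinarith

/-- the strip of length `(a g)²` and width `a g` with exponentially decreasing edge lengths and
exponentially increasing heaps -/
def geo (a g H : ℕ) (ha : 2 ≤ a) (hg : 1 ≤ g) (bs : Bool → ℕ) (hbs : ∀ i, 1 ≤ bs i) : StripPar where
  L := (a * g) ^ 2
  W := a * g
  a := a
  U j := 2 ^ (a * (2 * (a * g) ^ 2 - j))
  ht j := H + a * j
  bs := bs
  hL := Nat.pos_of_ne_zero (by positivity)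
  hW := Nat.pos_of_ne_zero (by positivity)
  ha := ha
  hU _ := Nat.one_le_two_pow
  hbs := hbs

lemma geo_off_eq {a g H : ℕ} (ha : 2 ≤ a) (hg : 1 ≤ g) (bs bs' : Bool → ℕ) (hbs : ∀ i, 1 ≤ bs i)
    (hbs' : ∀ i, 1 ≤ bs' i) :
    (geo a g H ha hg bs hbs).gad.off (geo a g H ha hg bs hbs).blobs
      = (geo a g H ha hg bs' hbs').gad.off (geo a g H ha hg bs' hbs').blobs := by
  have h : ∀ e : (geo a g H ha hg bs hbs).SEdge,
      (geo a g H ha hg bs hbs).gad.len e = (geo a g H ha hg bs' hbs').gad.len e := by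
    rintro (⟨j, Y, b⟩ | Y) <;> rfl
  rw [off_eq, off_eq]
  simp only [h]
  rfl

lemma geo_off {a g H : ℕ} (ha : 2 ≤ a) (hg : 1 ≤ g) (bs : Bool → ℕ) (hbs : ∀ i, 1 ≤ bs i) :
    (geo a g H ha hg bs hbs).gad.off (geo a g H ha hg bs hbs).blobs
      ≤ 14 * (2 ^ (a * g) ^ 2) ^ 4 * (2 ^ (a * (a * g) ^ 2)) ^ 2
        + 2 ^ (a * g) ^ 2 * (2 ^ H * 2 ^ (a * (a * g) ^ 2)) := by
  set L := (a * g) ^ 2 with hLdef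
  have hag : 1 ≤ a * g := Nat.mul_pos (by omega) hg
  have hWL : a * g ≤ L := Nat.le_self_pow (by norm_num) _
  have haL : a ≤ L := le_trans (Nat.le_mul_of_pos_right _ hg) hWL
  have hLK : L ≤ 2 ^ L := Nat.lt_two_pow_self.le
  have hK1 : 1 ≤ 2 ^ L := Nat.one_le_two_pow
  refine ((geo a g H ha hg bs hbs).off_le (K := 2 ^ L) (A := 2 * (2 ^ L) ^ 2 * (2 ^ (a * L)) ^ 2)
    (B := 2 ^ H * 2 ^ (a * L)) hLK (hWL.trans hLK) hK1 ?_ ?_ ?_).trans (le_of_eq (by ring))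
  · intro j Y b
    have h1 : (geo a g H ha hg bs hbs).U j ≤ (2 ^ (a * L)) ^ 2 := by
      rw [← pow_mul]
      refine Nat.pow_le_pow_right (by norm_num) ?_
      calc a * (2 * L - j) ≤ a * (2 * L) := Nat.mul_le_mul_left _ (Nat.sub_le _ _)
        _ = _ := by ring
    rw [plen]
    refine Nat.mul_le_mul ?_ h1
    have ha' : a ≤ 2 ^ L := haL.trans hLK
    have h2 : a * (a + 1) ≤ 2 * (2 ^ L) ^ 2 := by nlinarith
    show (if b = true then a else if Y < a * g then a + 1 else a * (a + 1)) ≤ _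
    split_ifs <;> nlinarith
  · have : 1 ≤ (2 ^ L) ^ 2 * (2 ^ (a * L)) ^ 2 := Nat.one_le_iff_ne_zero.2 (by positivity)
    nlinarith
  · intro j hj
    rw [← pow_add]
    refine Nat.pow_le_pow_right (by norm_num) ?_
    have hj' : j + 1 ≤ L := hj
    show H + a * j + 1 ≤ H + a * L
    nlinarith

end StripPar

lemma two_pow_ge {a : ℕ} (ha : 40 ≤ a) : 10000 * a ^ 4 ≤ 2 ^ a := by
  induction a, ha using Nat.le_induction with
  | base => norm_num
  | succ n hn ih =>
    rw [pow_succ 2 n]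
    have : (n + 1) ^ 4 ≤ 2 * n ^ 4 := by
      zify at hn ⊢
      nlinarith [sq_nonneg (n : ℤ), mul_nonneg (sq_nonneg (n:ℤ)) (sq_nonneg (n : ℤ)), pow_pos (by linarith : (0:ℤ) < n) 3]
    omega

lemma thet_pow_le {a g : ℕ} (ha : 1 ≤ a) (hg : 200 ≤ g) :
    2 * (g:ℝ) ^ 2 * ((2 * a + 1) / (2 * a + 2) : ℝ) ^ (a * g) ≤ 1 := by
  have ha' : (1:ℝ) ≤ a := by exact_mod_cast ha
  have hg' : (200:ℝ) ≤ g := by exact_mod_cast hg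
  have h1 : ((2 * a + 1) / (2 * a + 2) : ℝ) ^ (a * g) ≤ Real.exp (-(g / 4)) := by
    have e : ((2 * a + 1) / (2 * a + 2) : ℝ) = 1 - 1 / (2 * a + 2) := by field_simp; ring
    have h2 : ((2 * a + 1) / (2 * a + 2) : ℝ) ^ (a * g) ≤ Real.exp (-(1 / (2 * a + 2))) ^ (a * g) := by
      refine pow_le_pow_left₀ (by positivity) ?_ _
      rw [e]; exact Real.one_sub_le_exp_neg _
    refine h2.trans ?_
    rw [← Real.exp_nat_mul, Real.exp_le_exp, mul_neg, neg_le_neg_iff]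
    push_cast
    rw [mul_one_div, div_le_div_iff₀ (by norm_num) (by positivity)]
    nlinarith
  have h2 : 2 * (g:ℝ) ^ 2 ≤ Real.exp (g / 4) := by
    have h3 := Real.pow_div_factorial_le_exp (g / 4 : ℝ) (by positivity) 4
    refine le_trans ?_ h3
    rw [show ((Nat.factorial 4 : ℕ) : ℝ) = 24 by norm_num [Nat.factorial], le_div_iff₀ (by norm_num)]
    have : (200:ℝ) ^ 2 ≤ g ^ 2 := by gcongr
    nlinarith [sq_nonneg (g:ℝ)]
  calc 2 * (g:ℝ) ^ 2 * ((2 * a + 1) / (2 * a + 2) : ℝ) ^ (a * g)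
      ≤ Real.exp (g / 4) * Real.exp (-(g / 4)) := by gcongr
    _ = 1 := by rw [← Real.exp_add]; simp

/-- admissible parameters -/
structure Good (N a g : ℕ) : Prop where
  ha : 40 ≤ a
  hg : 200 ≤ g
  hN : 8 * a ^ 2 * 2 ^ (10 * a * (a * g) ^ 2) ≤ N

lemma Good.exists_strip {N a g : ℕ} (h : Good N a g) : ∃ (p : StripPar) (m s : ℝ),
    p.Full (2 ^ p.L) m s ((2:ℝ) ^ a)⁻¹ g ∧ p.a = a ∧ Nonempty (p.gad.Vert ≃ Fin N) ∧
    4 * ((2:ℝ) ^ p.L) ^ 3 * p.gad.off p.blobs ≤ N ∧ (∀ b, N ≤ 4 * p.bs b) ∧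
    (p.a:ℝ) ^ 2 * s ≤ N ∧ N ≤ 2 * ((p.a:ℝ) ^ 2 * s) := by
  have ha := h.ha
  have hg := h.hg
  have ha2 : 2 ≤ a := by omega
  have hg1 : 1 ≤ g := by omega
  set L := (a * g) ^ 2 with hL
  have hag : 1 ≤ a * g := Nat.mul_pos (by omega) hg1
  have hWL : a * g ≤ L := Nat.le_self_pow (by norm_num) _
  have haL : a ≤ L := le_trans (Nat.le_mul_of_pos_right _ hg1) hWL
  have hLK : L ≤ 2 ^ L := Nat.lt_two_pow_self.le
  -- the scale of the heaps
  set M := 8 * a ^ 2 * 2 ^ (2 * a * L) with hM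
  have hM0 : 0 < M := by positivity
  have hMN : M * 2 ^ (8 * a * L) ≤ N := by
    refine le_trans (le_of_eq ?_) h.hN
    rw [hM, mul_assoc, ← pow_add]; congr 2; ring
  have hNM : 2 ^ (8 * a * L) ≤ N / M := by rw [Nat.le_div_iff_mul_le hM0, mul_comm]; exact hMN
  set H := Nat.log 2 (N / M) with hH
  have hNM0 : N / M ≠ 0 := fun h0 => by
    rw [h0] at hNM
    exact absurd hNM (by simp)
  have hH1 : M * 2 ^ H ≤ N := by
    have := Nat.pow_log_le_self 2 hNM0
    rw [Nat.le_div_iff_mul_le hM0, mul_comm] at this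
    exact this
  have hH2 : N ≤ 2 * (M * 2 ^ H) := by
    have := Nat.lt_pow_succ_log_self (by norm_num : 1 < 2) (N / M)
    rw [Nat.div_lt_iff_lt_mul hM0, ← hH] at this
    refine this.le.trans (le_of_eq ?_)
    rw [pow_succ]; ring
  have hH3 : 8 * a * L ≤ H := Nat.le_log_of_pow_le (by norm_num) hNM
  -- the vertices off the two large heaps
  obtain ⟨o, ho⟩ : ∃ o, o = (StripPar.geo a g H ha2 hg1 (fun _ => 1) fun _ => le_rfl).gad.off
    (StripPar.geo a g H ha2 hg1 (fun _ => 1) fun _ => le_rfl).blobs := ⟨_, rfl⟩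
  have ho1 := StripPar.geo_off (H := H) ha2 hg1 (fun _ => 1) fun _ => le_rfl
  rw [← ho, ← hL] at ho1
  set K := 2 ^ L with hK
  set m := 2 ^ (a * L) with hm
  have hK256 : 256 ≤ K := by
    have : 2 ^ 8 ≤ 2 ^ L := Nat.pow_le_pow_right (by norm_num) (by omega)
    exact this
  have hKm : K ^ 12 ≤ m := by
    rw [hK, hm, ← pow_mul]
    exact Nat.pow_le_pow_right (by norm_num) (by nlinarith)
  have hmH : m ^ 8 ≤ 2 ^ H := by
    rw [hm, ← pow_mul]
    exact Nat.pow_le_pow_right (by norm_num) (by nlinarith)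
  have hMm : M = 8 * a ^ 2 * m ^ 2 := by
    rw [hM, hm, ← pow_mul]; congr 2; ring
  have hm1 : 1 ≤ m := Nat.one_le_two_pow
  have hoff : 4 * K ^ 3 * o ≤ N := by
    have h1 : 4 * K ^ 3 * o ≤ 4 * K ^ 3 * (14 * K ^ 4 * m ^ 2 + K * (2 ^ H * m)) := by gcongr
    have h2 : 56 * K ^ 7 * m ^ 2 ≤ 2 ^ H * m ^ 2 := by
      gcongr
      calc 56 * K ^ 7 ≤ K * K ^ 7 := by gcongr; omega
        _ = K ^ 8 := by ring
        _ ≤ K ^ 12 := Nat.pow_le_pow_right (by omega) (by norm_num)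
        _ ≤ m := hKm
        _ ≤ m ^ 8 := Nat.le_self_pow (by norm_num) _
        _ ≤ _ := hmH
    have h3 : 4 * K ^ 4 * (2 ^ H * m) ≤ m * (2 ^ H * m) := by
      gcongr
      calc 4 * K ^ 4 ≤ K * K ^ 4 := by gcongr; omega
        _ = K ^ 5 := by ring
        _ ≤ K ^ 12 := Nat.pow_le_pow_right (by omega) (by norm_num)
        _ ≤ m := hKm
    have h4 : 2 * (2 ^ H * m ^ 2) ≤ M * 2 ^ H := by
      rw [hMm]
      have : 2 ≤ 8 * a ^ 2 := by nlinarith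
      calc 2 * (2 ^ H * m ^ 2) ≤ 8 * a ^ 2 * (2 ^ H * m ^ 2) := by gcongr
        _ = _ := by ring
    calc 4 * K ^ 3 * o ≤ _ := h1
      _ = 56 * K ^ 7 * m ^ 2 + 4 * K ^ 4 * (2 ^ H * m) := by ring
      _ ≤ 2 ^ H * m ^ 2 + m * (2 ^ H * m) := add_le_add h2 h3
      _ = 2 * (2 ^ H * m ^ 2) := by ring
      _ ≤ M * 2 ^ H := h4
      _ ≤ N := hH1
  have hoN : 1000 * o ≤ N := by
    refine le_trans ?_ hoff
    gcongr
    have : 256 ^ 3 ≤ K ^ 3 := by gcongr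
    omega
  have hN1000 : 1000 ≤ N := by
    refine le_trans ?_ hH1
    have h5 : 1 ≤ m ^ 2 * 2 ^ H := Nat.one_le_iff_ne_zero.2 (by positivity)
    have h6 : 8 * 40 ^ 2 * 1 ≤ 8 * a ^ 2 * (m ^ 2 * 2 ^ H) := by gcongr
    rw [hMm, mul_assoc]; omega
  set bs : Bool → ℕ := fun b => if b then N - o - N / 3 else N / 3 with hbs
  have hbs4 : ∀ b, N ≤ 4 * bs b := by
    intro b; cases b <;> simp only [hbs] <;> simp <;> omega
  have hbsN : ∀ b, bs b ≤ N := by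
    intro b; cases b <;> simp only [hbs] <;> simp <;> omega
  set p := StripPar.geo a g H ha2 hg1 bs (fun b => by have := hbs4 b; omega) with hp
  have hpo : p.gad.off p.blobs = o := by
    rw [ho]; exact StripPar.geo_off_eq ha2 hg1 _ _ _ _
  have hpL : p.L = L := rfl
  have hpa : p.a = a := rfl
  have hcard : Fintype.card p.gad.Vert = N := by
    rw [p.gad.card_eq p.blobs, hpo]
    have : ∑ k ∈ p.blobs, p.gad.hs k = bs true + bs false := by
      rw [StripPar.blobs, Finset.sum_pair (by simp)]; rfl
    rw [this]
    simp only [hbs]; simp; omega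
  have hKr : ((2:ℝ) ^ p.L) = (K : ℝ) := by rw [hpL, hK]; push_cast; rfl
  have hmr0 : (0:ℝ) < m := by exact_mod_cast hm1
  have hs1 : (a:ℝ) ^ 2 * (8 * 2 ^ H * m ^ 2) = ((M * 2 ^ H : ℕ) : ℝ) := by
    rw [hMm]; push_cast; ring
  have hs2 : (a:ℝ) ^ 2 * (8 * 2 ^ H * m ^ 2) ≤ N := by rw [hs1]; exact_mod_cast hH1
  have hs3 : (N:ℝ) ≤ 2 * ((a:ℝ) ^ 2 * (8 * 2 ^ H * m ^ 2)) := by rw [hs1]; exact_mod_cast hH2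
  refine ⟨p, m, 8 * 2 ^ H * m ^ 2, ?_, rfl, ⟨Fintype.equivFinOfCardEq hcard⟩, ?_, hbs4, hs2, hs3⟩
  · rw [hKr]
    have hmr : (m:ℝ) = 2 ^ (a * L) := by rw [hm]; push_cast; rfl
    refine { hρ := ?_, hs := ?_, hU2 := ?_, hU1 := ?_, hK := ?_, haK := ?_, hWK := ?_, hKm := ?_,
             hms := ?_, hbl := ?_, hLg := rfl, hWg := rfl, hLK := ?_, hρm := ?_, ha40 := ha,
             hρa := ?_, hgθ := thet_pow_le (by omega) hg }
    · intro j hj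
      have hj' : j < L := hj
      have e : a * (2 * L - j) = a + a * (2 * L - (j + 1)) := by
        rw [show 2 * L - j = 2 * L - (j + 1) + 1 by omega]; ring
      show ((2 ^ (a * (2 * L - (j + 1))) : ℕ) : ℝ) = _ * ((2 ^ (a * (2 * L - j)) : ℕ) : ℝ)
      rw [e, pow_add]; push_cast; field_simp
    · intro j hj
      have hj' : j < L := hj
      show 8 * (2:ℝ) ^ (H + a * j) * ((2 ^ (a * (2 * L - j)) : ℕ) : ℝ) = _
      push_cast
      rw [hmr, ← pow_mul, mul_assoc, mul_assoc, ← pow_add, ← pow_add]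
      congr 2
      rw [add_assoc, ← mul_add, show j + (2 * L - j) = 2 * L by omega]; ring
    · intro j
      have h1 : 2 ^ (a * (2 * L - j)) ≤ m ^ 2 := by
        rw [hm, ← pow_mul]
        refine Nat.pow_le_pow_right (by norm_num) ?_
        calc a * (2 * L - j) ≤ a * (2 * L) := Nat.mul_le_mul_left _ (Nat.sub_le _ _)
          _ = _ := by ring
      exact_mod_cast h1
    · intro j hj
      have hj' : j ≤ L := hj
      have h1 : m ≤ 2 ^ (a * (2 * L - j)) := by
        refine Nat.pow_le_pow_right (by norm_num) ?_
        exact Nat.mul_le_mul_left _ (by omega)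
      exact_mod_cast h1
    · exact_mod_cast (by omega : 16 ≤ K)
    · exact_mod_cast haL.trans hLK
    · exact_mod_cast hWL.trans hLK
    · exact_mod_cast hKm
    · have h1 : m ^ 8 * m ^ 2 ≤ 2 ^ H * m ^ 2 := by gcongr
      have h2 : ((m ^ 8 * m ^ 2 : ℕ) : ℝ) ≤ ((2 ^ H * m ^ 2 : ℕ) : ℝ) := by exact_mod_cast h1
      push_cast at h2
      linarith
    · intro b
      have h1 : (bs b : ℝ) ≤ N := by exact_mod_cast hbsN b
      have h2 := h1.trans hs3
      show (bs b : ℝ) ≤ 2 * (a:ℝ) ^ 2 * _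
      linarith
    · exact_mod_cast hLK
    · rw [inv_mul_eq_div, one_le_div (by positivity), hmr]
      exact pow_le_pow_right₀ (by norm_num) (Nat.le_mul_of_pos_right _ (by omega))
    · rw [← div_eq_mul_inv, div_le_one (by positivity), hpa]
      exact_mod_cast two_pow_ge ha
  · rw [hKr, hpo]
    exact_mod_cast hoff

end Choice


/-! ### Existence of the graphs -/

section Package

variable {N : ℕ}

/-- the properties of a graph on `Fin N` and of its perturbation -/
structure Pack (N a g : ℕ) (G : SimpleGraph (Fin N)) (w : Fin N → Fin N → ℝ) (S : ℝ) : Prop where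
  le_S : (N:ℝ) ≤ 2 * S
  S_le : S ≤ N
  connected : G.Connected
  deg_le : ∀ v, deg G v ≤ 9
  base : dTV (walkMat G) (degSta G) ⌈61500 * S⌉₊ ≤ 1 / 4
  rel : ∀ t : ℕ, dTV (walkMat G) (degSta G) t ≤ 1 / 4 → (N:ℝ) / 648 ≤ trelG G ∧ trelG G ≤ 2 * t
  good : GoodWeights G w
  mem : ∀ u v, G.Adj u v → 1 ≤ w u v ∧ w u v ≤ 1 + 3 / a
  anti : Antitone (dTV (wMat w) (wSta w))
  upper : ∀ ε : ℝ, 0 < ε → ε ≤ 1 / 100 → 1 ≤ a * ε ^ 2 → 1 ≤ ε * g → ∀ t : ℕ,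
    (1 + 12 * ε) * (S * g ^ 2) ≤ t → dTV (wMat w) (wSta w) t ≤ 6 / (ε * g)
  lower : ∀ ε : ℝ, 0 < ε → ε ≤ 1 / 100 → 1 ≤ a * ε ^ 2 → 1 ≤ ε * g → ∀ t : ℕ,
    t ≤ (1 - 12 * ε) * (S * g ^ 2) → 1 - 10 / (ε * g) ≤ dTV (wMat w) (wSta w) t

lemma Good.exists_pack {a g : ℕ} (h : Good N a g) : ∃ G w S, Pack N a g G w S := by
  obtain ⟨p, m, s, hp, hpa, ⟨e⟩, hoff, hbs, hS1, hS2⟩ := h.exists_strip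
  have ha := h.ha
  have hg := h.hg
  have hN0 : 0 < N := by
    by_contra h0
    have h0 : N = 0 := by omega
    have := h.hN
    rw [h0] at this
    have h2 : 0 < 8 * a ^ 2 * 2 ^ (10 * a * (a * g) ^ 2) := by positivity
    omega
  have hNr : (0:ℝ) < N := by exact_mod_cast hN0
  have hK16 := hp.hK
  set K : ℝ := 2 ^ p.L with hK
  have ho0 : (0:ℝ) ≤ p.gad.off p.blobs := Nat.cast_nonneg _
  have hK1 : (1:ℝ) ≤ K := by linarith
  have hK12 : K ≤ K ^ 2 := by nlinarith
  have hK23 : K ^ 2 ≤ K ^ 3 := by nlinarith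
  have hoff2 : 4 * K ^ 2 * (p.gad.off p.blobs : ℝ) ≤ N := by
    refine le_trans ?_ hoff; gcongr
  have hoff12 : 12 * (p.gad.off p.blobs : ℝ) ≤ N := by
    refine le_trans ?_ hoff2
    gcongr; nlinarith
  have hoffN : 2 * p.gad.off p.blobs ≤ N := by
    have : ((2 * p.gad.off p.blobs : ℕ) : ℝ) ≤ N := by push_cast; linarith
    exact_mod_cast this
  have hgK : (g:ℝ) ≤ K := by
    have h1 : g ≤ p.L := by
      have h2 := hp.hLg
      rw [h2, hpa]
      calc g ≤ a * g := Nat.le_mul_of_pos_left _ (by omega)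
        _ ≤ (a * g) ^ 2 := Nat.le_self_pow (by norm_num) _
    have h2 : (g:ℝ) ≤ p.L := by exact_mod_cast h1
    have h3 : (p.L:ℝ) ≤ K := by rw [hK]; exact_mod_cast Nat.lt_two_pow_self.le
    linarith
  have hgr : (0:ℝ) < g := by exact_mod_cast (by omega : 0 < g)
  have hap : (0:ℝ) < a := by exact_mod_cast (by omega : 0 < a)
  have hpm := hp.pert_mem
  have hwm : ∀ i, 1 ≤ p.gad.wts (p.wt p.pert) i ∧ p.gad.wts (p.wt p.pert) i ≤ 1 + 3 / a := by
    have h3 : (0:ℝ) ≤ 3 / a := by positivity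
    rintro (⟨i | i, k⟩ | i)
    · obtain ⟨j, Y, b⟩ := i
      refine ⟨(hpm Y b).1, ?_⟩
      show p.pert Y b ≤ _
      rw [StripPar.pert, hpa]
      split_ifs <;> linarith
    · exact ⟨le_rfl, by show (1:ℝ) ≤ _; linarith⟩
    · exact ⟨le_rfl, by show (1:ℝ) ≤ _; linarith⟩
  refine ⟨(p.gad.net.map e).graph, (p.gad.net.map e).ew (p.gad.wts (p.wt p.pert)), p.a ^ 2 * s,
    hS2, hS1, by classical exact p.gad.net.map_connected e p.connected,
    p.gad.deg_le e (by norm_num) p.degBound, ?_, fun t ht => ?_,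
    (p.gad.net.map e).goodWeights fun i => by linarith [(hwm i).1], ?_,
    p.strip_antitone e fun Y b => hpm Y b, fun ε h0 h1 h2 h3 t ht => ?_,
    fun ε h0 h1 h2 h3 t ht => ?_⟩
  · have := StripPar.base_upper hp e hoff12
    rwa [mul_assoc] at this
  · have hb : ∀ b, (1 / 36 : ℝ) * (((9:ℕ):ℝ) * N) ≤ p.gad.hs (Sum.inr b) := by
      intro b
      have : (N:ℝ) ≤ 4 * p.bs b := by exact_mod_cast hbs b
      show _ ≤ ((p.bs b : ℕ) : ℝ)
      push_cast; linarith
    have := p.gad.trel_bounds e (by norm_num) p.degBound hoffN p.connected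
      (k₁ := Sum.inr false) (k₂ := Sum.inr true) (by simp) (p := 1 / 36) (by norm_num)
      (hb false) (hb true) ht
    refine ⟨le_trans (le_of_eq ?_) this.1, this.2⟩
    ring
  · rintro u v ⟨i, hi⟩
    rw [Net.ew_eq _ _ hi]
    exact hwm i
  · exact StripPar.pert_upper hp le_rfl e h0 h1 (by rwa [hpa]) h3 hoff2 ht
  · have h4 := StripPar.pert_lower hp e h0 h1 (by rwa [hpa]) h3 hoffN ht
    refine le_trans ?_ h4
    have h5 : 36 * (p.gad.off p.blobs : ℝ) / N ≤ 9 / (ε * g) := by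
      rw [div_le_div_iff₀ hNr (by positivity)]
      have h6 : ε * g ≤ K ^ 3 := by nlinarith
      calc 36 * (p.gad.off p.blobs : ℝ) * (ε * g) ≤ 36 * (p.gad.off p.blobs : ℝ) * K ^ 3 := by gcongr
        _ = 9 * (4 * K ^ 3 * p.gad.off p.blobs) := by ring
        _ ≤ 9 * N := by gcongr
    have h7 : 10 / (ε * g) = 9 / (ε * g) + 1 / (ε * g) := by ring
    linarith

end Package


/-! ### Mixing times -/

section MixTime

variable {P : Matrix V V ℝ} {π : V → ℝ} {x : ℝ} {t : ℕ}

lemma mixTime_le (h : dTV P π t ≤ x) : mixTime P π x ≤ t := Nat.sInf_le h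

lemma dTV_mixTime_le (h : dTV P π t ≤ x) : dTV P π (mixTime P π x) ≤ x :=
  Nat.sInf_mem (s := {t | dTV P π t ≤ x}) ⟨t, h⟩

lemma lt_mixTime (hP : Antitone (dTV P π)) {t' : ℕ} (h' : dTV P π t' ≤ x) (h : x < dTV P π t) :
    t < mixTime P π x := by
  by_contra hlt
  exact absurd ((hP (not_lt.1 hlt)).trans (dTV_mixTime_le h')) (not_le.2 h)

end MixTime

namespace Pack

variable {N a g : ℕ} {G : SimpleGraph (Fin N)} {w : Fin N → Fin N → ℝ} {S : ℝ}

lemma tmixW_mem (h : Pack N a g G w S) (hN : 2 ≤ N) {ε x : ℝ} (h0 : 0 < ε) (h1 : ε ≤ 1 / 100)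
    (h2 : 1 ≤ a * ε ^ 2) (h3 : 1 ≤ ε * g) (hx : 6 / (ε * g) ≤ x) (hx' : x < 1 - 10 / (ε * g)) :
    (1 - 12 * ε) * (S * g ^ 2) ≤ tmixW w x ∧ tmixW w x ≤ (1 + 13 * ε) * (S * g ^ 2) := by
  have hN' : (2:ℝ) ≤ N := by exact_mod_cast hN
  have hS : 1 ≤ S := by linarith [h.le_S]
  have hg : (1:ℝ) ≤ g := by nlinarith [Nat.cast_nonneg (α := ℝ) g]
  have hτ : 0 ≤ S * (g:ℝ) ^ 2 := by positivity
  have hτ1 : 1 ≤ ε * (S * g ^ 2) := by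
    calc (1:ℝ) ≤ (ε * g) * (S * g) := by
          have := mul_le_mul hS hg zero_le_one (by linarith)
          nlinarith
      _ = _ := by ring
  have hu := (h.upper ε h0 h1 h2 h3 _ (Nat.le_ceil _)).trans hx
  constructor
  · have hl := h.lower ε h0 h1 h2 h3 _ (Nat.floor_le (mul_nonneg (by linarith) hτ))
    have h4 := lt_mixTime h.anti hu (hx'.trans_le hl)
    have h5 : ((⌊(1 - 12 * ε) * (S * g ^ 2)⌋₊ : ℕ) : ℝ) + 1 ≤ tmixW w x := by
      exact_mod_cast h4
    linarith [Nat.lt_floor_add_one ((1 - 12 * ε) * (S * (g:ℝ) ^ 2))]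
  · have h4 : (tmixW w x : ℝ) ≤ (⌈(1 + 12 * ε) * (S * g ^ 2)⌉₊ : ℕ) := by
      exact_mod_cast mixTime_le hu
    have h5 := Nat.ceil_lt_add_one (a := (1 + 12 * ε) * (S * (g:ℝ) ^ 2))
      (mul_nonneg (by linarith) hτ)
    linarith

lemma tmixG_mem (h : Pack N a g G w S) :
    (N:ℝ) / 1296 ≤ tmixG G (1 / 4) ∧ (tmixG G (1 / 4) : ℝ) ≤ 61500 * N + 1 := by
  have hS0 : 0 ≤ S := by linarith [h.le_S, Nat.cast_nonneg (α := ℝ) N]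
  constructor
  · have := h.rel _ (dTV_mixTime_le h.base)
    have h2 : (N:ℝ) / 648 ≤ 2 * (tmixG G (1 / 4) : ℕ) := this.1.trans this.2
    linarith
  · have h1 : (tmixG G (1 / 4) : ℝ) ≤ (⌈61500 * S⌉₊ : ℕ) := by exact_mod_cast mixTime_le h.base
    have h2 := Nat.ceil_lt_add_one (a := 61500 * S) (by positivity)
    linarith [h.S_le]

lemma trelG_mem (h : Pack N a g G w S) (hN : 2 ≤ N) :
    1 / 40000000 * (tmixG G (1 / 4) : ℝ) ≤ trelG G ∧ trelG G ≤ 2 * (tmixG G (1 / 4) : ℝ) := by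
  have h1 := h.rel _ (dTV_mixTime_le h.base)
  have hN' : (2:ℝ) ≤ N := by exact_mod_cast hN
  refine ⟨?_, h1.2⟩
  linarith [h.tmixG_mem.2, h1.1]

lemma ratio_mem (h : Pack N a g G w S) (hN : 2 ≤ N) (ha : 10000 ≤ a) (hg : 10000 ≤ g) :
    1 / 200000 * (g:ℝ) ^ 2 ≤ (tmixW w (1 / 4) : ℝ) / tmixG G (1 / 4) ∧
      (tmixW w (1 / 4) : ℝ) / tmixG G (1 / 4) ≤ 1500 * (g:ℝ) ^ 2 := by
  have ha' : (10000:ℝ) ≤ a := by exact_mod_cast ha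
  have hg' : (10000:ℝ) ≤ g := by exact_mod_cast hg
  have hN' : (2:ℝ) ≤ N := by exact_mod_cast hN
  obtain ⟨h1, h2⟩ := h.tmixW_mem hN (ε := 1 / 100) (x := 1 / 4) (by norm_num) le_rfl
    (by linarith) (by linarith)
    (by rw [div_le_iff₀ (by positivity)]; linarith)
    (by
      have : 10 / (1 / 100 * (g:ℝ)) ≤ 1 / 2 := by rw [div_le_iff₀ (by positivity)]; linarith
      linarith)
  obtain ⟨h3, h4⟩ := h.tmixG_mem
  have hT : (0:ℝ) < tmixG G (1 / 4) := lt_of_lt_of_le (by positivity) h3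
  have h5 := mul_le_mul_of_nonneg_right h.le_S (sq_nonneg (g:ℝ))
  have h6 := mul_le_mul_of_nonneg_right h.S_le (sq_nonneg (g:ℝ))
  have hg2 : (0:ℝ) ≤ (g:ℝ) ^ 2 := sq_nonneg _
  constructor
  · rw [le_div_iff₀ hT]
    have h7 := mul_le_mul_of_nonneg_left h4 hg2
    have h8 := mul_le_mul_of_nonneg_left hN' hg2
    nlinarith
  · rw [div_le_iff₀ hT]
    have h7 := mul_le_mul_of_nonneg_left h3 hg2
    nlinarith

lemma sup_mem (h : Pack N a g G w S) (hN : 2 ≤ N) :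
    1 ≤ ⨆ p : {p : Fin N × Fin N // G.Adj p.1 p.2}, w p.1.1 p.1.2 ∧
      ⨆ p : {p : Fin N × Fin N // G.Adj p.1 p.2}, w p.1.1 p.1.2 ≤ 1 + 3 / a := by
  have : Nontrivial (Fin N) := Fin.nontrivial_iff_two_le.2 hN
  obtain ⟨v, hv⟩ := h.connected.preconnected.exists_adj_of_nontrivial ⟨0, by omega⟩
  have : Nonempty {p : Fin N × Fin N // G.Adj p.1 p.2} := ⟨⟨(_, v), hv⟩⟩
  refine ⟨?_, ciSup_le fun p => (h.mem _ _ p.2).2⟩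
  exact (h.mem _ _ hv).1.trans
    (le_ciSup (f := fun p : {p : Fin N × Fin N // G.Adj p.1 p.2} => w p.1.1 p.1.2)
      (Set.finite_range _).bddAbove ⟨(_, v), hv⟩)

lemma cutoff_ratio (h : Pack N a g G w S) (hN : 2 ≤ N) {ε δ : ℝ} (h0 : 0 < ε) (h1 : ε ≤ 1 / 100)
    (h2 : 1 ≤ a * ε ^ 2) (h3 : 1 ≤ ε * g) (hδ : δ ≤ 1 / 2) (h4 : 10 / (ε * g) < δ) :
    |(tmixW w δ : ℝ) / tmixW w (1 - δ) - 1| ≤ 30 * ε := by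
  have h5 : 6 / (ε * g) ≤ 10 / (ε * g) := by gcongr; norm_num
  obtain ⟨h6, h7⟩ := h.tmixW_mem hN h0 h1 h2 h3 (x := δ) (by linarith) (by linarith)
  obtain ⟨h8, h9⟩ := h.tmixW_mem hN h0 h1 h2 h3 (x := 1 - δ) (by linarith) (by linarith)
  have hN' : (2:ℝ) ≤ N := by exact_mod_cast hN
  have hS : 1 ≤ S := by linarith [h.le_S]
  have hg : (0:ℝ) < g := by
    by_contra hg
    nlinarith
  have hτ : 0 < S * (g:ℝ) ^ 2 := by positivity
  set τ := S * (g:ℝ) ^ 2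
  have hd : 0 < (tmixW w (1 - δ) : ℝ) := lt_of_lt_of_le (by nlinarith) h8
  rw [abs_le, div_sub_one hd.ne', le_div_iff₀ hd, div_le_iff₀ hd]
  have hετ : 0 < ε * τ := by positivity
  constructor <;> nlinarith

end Pack

/-! ### The scales -/

section Scales

variable {f : ℕ → ℝ}

lemma good_of_le {N a g : ℕ} (ha : 40 ≤ a) (hg : 200 ≤ g) (hN : 1 ≤ N)
    (h : (a:ℝ) ^ 4 * g ^ 2 ≤ Real.log N) : Good N a g := by
  refine ⟨ha, hg, ?_⟩
  have hpos : 0 < a ^ 3 * g ^ 2 := by positivity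
  have h1 : 8 * a ^ 2 ≤ 2 ^ (a ^ 3 * g ^ 2) := by
    calc 8 * a ^ 2 ≤ 10000 * a ^ 4 := by
          have : a ^ 2 ≤ a ^ 4 := Nat.pow_le_pow_right (by omega) (by norm_num)
          omega
      _ ≤ 2 ^ a := two_pow_ge ha
      _ ≤ _ := Nat.pow_le_pow_right (by norm_num) (by
          have h2 : a ≤ a ^ 3 := Nat.le_self_pow (by norm_num) _
          exact h2.trans (Nat.le_mul_of_pos_right _ (by positivity)))
  have h2 : 8 * a ^ 2 * 2 ^ (10 * a * (a * g) ^ 2) ≤ 2 ^ (a ^ 4 * g ^ 2) := by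
    calc 8 * a ^ 2 * 2 ^ (10 * a * (a * g) ^ 2)
        ≤ 2 ^ (a ^ 3 * g ^ 2) * 2 ^ (10 * a * (a * g) ^ 2) := by gcongr
      _ = 2 ^ (11 * (a ^ 3 * g ^ 2)) := by rw [← pow_add]; congr 1; ring
      _ ≤ 2 ^ (a * (a ^ 3 * g ^ 2)) :=
          Nat.pow_le_pow_right (by norm_num) (Nat.mul_le_mul_right _ (by omega))
      _ = _ := by congr 1; ring
  refine h2.trans ?_
  have hNr : (0:ℝ) < N := by exact_mod_cast hN
  have h3 : ((2 ^ (a ^ 4 * g ^ 2) : ℕ) : ℝ) ≤ N := by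
    rw [← Real.exp_log hNr]
    refine le_trans ?_ (Real.exp_le_exp.2 h)
    have h4 : (2:ℝ) ≤ Real.exp 1 := by linarith [Real.add_one_le_exp (1:ℝ)]
    calc ((2 ^ (a ^ 4 * g ^ 2) : ℕ) : ℝ) = 2 ^ (a ^ 4 * g ^ 2) := by push_cast; rfl
      _ ≤ Real.exp 1 ^ (a ^ 4 * g ^ 2) := pow_le_pow_left₀ (by norm_num) h4 _
      _ = Real.exp ((a:ℝ) ^ 4 * g ^ 2) := by rw [← Real.exp_nat_mul]; push_cast; ring_nf
  exact_mod_cast h3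

lemma exists_scales (hfpos : ∀ n, 0 < f n) (hfinf : Tendsto f atTop atTop)
    (hfo : Tendsto (fun n => f n / Real.log n) atTop (nhds 0)) :
    ∃ a g : ℕ → ℕ, Tendsto a atTop atTop ∧ Tendsto g atTop atTop ∧
      ∀ᶠ N in atTop, Good N (a N) (g N) ∧ 10000 ≤ a N ∧ 10000 ≤ g N ∧
        ((g N : ℕ) : ℝ) ^ 2 ≤ f N ∧ f N ≤ 4 * ((g N : ℕ) : ℝ) ^ 2 := by
  have hlog : ∀ᶠ N : ℕ in atTop, 0 < Real.log N := by
    filter_upwards [eventually_ge_atTop 2] with N hN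
    exact Real.log_pos (by exact_mod_cast hN)
  have hh : Tendsto (fun N : ℕ => Real.log N / f N) atTop atTop := by
    have h1 : Tendsto (fun n : ℕ => f n / Real.log n) atTop (nhdsWithin 0 (Set.Ioi 0)) := by
      refine tendsto_nhdsWithin_iff.2 ⟨hfo, ?_⟩
      filter_upwards [hlog] with N hN
      exact div_pos (hfpos N) hN
    refine h1.inv_tendsto_nhdsGT_zero.congr fun N => ?_
    simp
  have hsq : Tendsto (fun N => ⌊√(f N)⌋₊) atTop atTop :=
    tendsto_nat_floor_atTop.comp (Real.tendsto_sqrt_atTop.comp hfinf)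
  have hsa : Tendsto (fun N : ℕ => ⌊√√(Real.log N / f N)⌋₊) atTop atTop :=
    tendsto_nat_floor_atTop.comp (Real.tendsto_sqrt_atTop.comp (Real.tendsto_sqrt_atTop.comp hh))
  refine ⟨_, _, hsa, hsq, ?_⟩
  filter_upwards [hlog, eventually_ge_atTop 1, hsq.eventually_ge_atTop 10000,
    hsa.eventually_ge_atTop 10000] with N h1 hN1 h2 h3
  have hf0 := hfpos N
  have hfl : ((⌊√(f N)⌋₊ : ℕ) : ℝ) ≤ √(f N) := Nat.floor_le (Real.sqrt_nonneg _)
  have hg2 : ((⌊√(f N)⌋₊ : ℕ) : ℝ) ^ 2 ≤ f N := by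
    calc ((⌊√(f N)⌋₊ : ℕ) : ℝ) ^ 2 ≤ √(f N) ^ 2 := by gcongr
      _ = f N := Real.sq_sqrt hf0.le
  have ha4 : ((⌊√√(Real.log N / f N)⌋₊ : ℕ) : ℝ) ^ 4 ≤ Real.log N / f N := by
    have h5 : ((⌊√√(Real.log N / f N)⌋₊ : ℕ) : ℝ) ≤ √√(Real.log N / f N) :=
      Nat.floor_le (Real.sqrt_nonneg _)
    calc ((⌊√√(Real.log N / f N)⌋₊ : ℕ) : ℝ) ^ 4 ≤ √√(Real.log N / f N) ^ 4 := by gcongr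
      _ = (√√(Real.log N / f N) ^ 2) ^ 2 := by ring
      _ = Real.log N / f N := by
        rw [Real.sq_sqrt (Real.sqrt_nonneg _), Real.sq_sqrt (by positivity)]
  refine ⟨good_of_le (by omega) (by omega) hN1 ?_, h3, h2, hg2, ?_⟩
  · calc _ ≤ Real.log N / f N * f N := by gcongr
      _ = _ := by field_simp
  · have h4 : √(f N) < ((⌊√(f N)⌋₊ : ℕ) : ℝ) + 1 := Nat.lt_floor_add_one _
    have h5 : (10000:ℝ) ≤ ((⌊√(f N)⌋₊ : ℕ) : ℝ) := by exact_mod_cast h2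
    calc f N = √(f N) ^ 2 := (Real.sq_sqrt hf0.le).symm
      _ ≤ (2 * ((⌊√(f N)⌋₊ : ℕ) : ℝ)) ^ 2 := by gcongr; linarith
      _ = _ := by ring

end Scales

/-- **Theorem 3(b).** For every `f(n) = o(log n)` with `f(n) → ∞` there is a sequence of
graphs with `t_rel = Θ(t_mix)` and an `o(1)`-perturbation of the edge weights which increases
the mixing time by a factor of `Θ(f(|V_n|))`; moreover the perturbed walks exhibit cutoff. -/
theorem o1_perturbation_increases_mixing_by_f_factor
    (f : ℕ → ℝ) (hfpos : ∀ n, 0 < f n)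
    (hfinf : Tendsto f atTop atTop)
    (hfo : Tendsto (fun n => f n / Real.log n) atTop (nhds 0)) :
    ∃ (D : ℕ) (N : ℕ → ℕ) (G : ∀ n, SimpleGraph (Fin (N n))),
      (∀ n, (G n).Connected) ∧
      (∀ n v, deg (G n) v ≤ D) ∧
      Tendsto N atTop atTop ∧
      -- t_rel(G_n) = Θ(t_mix(G_n))
      (∃ c C : ℝ, 0 < c ∧ 0 < C ∧ ∀ n,
        c * (tmixG (G n) (1/4) : ℝ) ≤ trelG (G n) ∧
        trelG (G n) ≤ C * (tmixG (G n) (1/4) : ℝ)) ∧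
      -- an o(1)-perturbation increasing the mixing time by a factor Θ(f(|V_n|))
      (∃ w : ∀ n, Fin (N n) → Fin (N n) → ℝ,
        (∀ n, GoodWeights (G n) (w n)) ∧
        (∀ n u v, (G n).Adj u v → 1 ≤ w n u v) ∧
        Tendsto
          (fun n => ⨆ p : {p : Fin (N n) × Fin (N n) // (G n).Adj p.1 p.2}, w n p.1.1 p.1.2)
          atTop (nhds 1) ∧
        (∃ c' C' : ℝ, 0 < c' ∧ 0 < C' ∧ ∀ n,
          c' * f (N n) ≤ (tmixW (w n) (1/4) : ℝ) / (tmixG (G n) (1/4) : ℝ) ∧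
          (tmixW (w n) (1/4) : ℝ) / (tmixG (G n) (1/4) : ℝ) ≤ C' * f (N n)) ∧
        -- the walks on the perturbed networks exhibit total variation cutoff
        (∀ ε : ℝ, 0 < ε → ε ≤ 1/2 →
          Tendsto (fun n => (tmixW (w n) ε : ℝ) / (tmixW (w n) (1 - ε) : ℝ))
            atTop (nhds 1))) := by
  obtain ⟨a, g, ha, hg, hev⟩ := exists_scales hfpos hfinf hfo
  obtain ⟨N₀, hN₀⟩ := eventually_atTop.1 (hev.and (eventually_ge_atTop 2))
  have hN : ∀ n, 2 ≤ N₀ + n := fun n => (hN₀ (N₀ + n) (by omega)).2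
  have hs := fun n => (hN₀ (N₀ + n) (by omega)).1
  choose G w S hP using fun n => (hs n).1.exists_pack
  have hNt : Tendsto (fun n => N₀ + n) atTop atTop := tendsto_atTop_mono (fun n => Nat.le_add_left n N₀) tendsto_id
  have haN : Tendsto (fun n => (a (N₀ + n) : ℝ)) atTop atTop :=
    tendsto_natCast_atTop_atTop.comp (ha.comp hNt)
  have hgN : Tendsto (fun n => (g (N₀ + n) : ℝ)) atTop atTop :=
    tendsto_natCast_atTop_atTop.comp (hg.comp hNt)
  refine ⟨9, fun n => N₀ + n, G, fun n => (hP n).connected, fun n => (hP n).deg_le, hNt,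
    ⟨1 / 40000000, 2, by norm_num, by norm_num, fun n => (hP n).trelG_mem (hN n)⟩, w,
    fun n => (hP n).good, fun n u v h => ((hP n).mem u v h).1, ?_,
    ⟨1 / 800000, 1500, by norm_num, by norm_num, fun n => ?_⟩, fun ε hε0 hε1 => ?_⟩
  · have h1 : Tendsto (fun n => 1 + 3 / (a (N₀ + n) : ℝ)) atTop (nhds 1) := by
      simpa using (haN.const_div_atTop 3).const_add 1
    exact tendsto_of_tendsto_of_tendsto_of_le_of_le tendsto_const_nhds h1
      (fun n => ((hP n).sup_mem (hN n)).1) fun n => ((hP n).sup_mem (hN n)).2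
  · obtain ⟨-, h1, h2, h3, h4⟩ := hs n
    obtain ⟨h5, h6⟩ := (hP n).ratio_mem (hN n) h1 h2
    constructor <;> linarith
  · rw [Metric.tendsto_nhds]
    intro η hη
    obtain ⟨δ, hδ0, hδ1, hδη⟩ : ∃ δ : ℝ, 0 < δ ∧ δ ≤ 1 / 100 ∧ 30 * δ < η :=
      ⟨min (1 / 100) (η / 60), by positivity, min_le_left _ _, by
        linarith [min_le_right (1 / 100) (η / 60)]⟩
    filter_upwards [haN.eventually_ge_atTop (1 / δ ^ 2), hgN.eventually_ge_atTop (1 / δ),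
      hgN.eventually_gt_atTop (10 / (δ * ε))] with n h1 h2 h3
    rw [div_le_iff₀ (by positivity)] at h1 h2
    have hg0 : (0:ℝ) < g (N₀ + n) := lt_of_le_of_lt (by positivity) h3
    rw [div_lt_iff₀ (by positivity)] at h3
    rw [Real.dist_eq]
    refine lt_of_le_of_lt ((hP n).cutoff_ratio (hN n) hδ0 hδ1 h1 (by linarith) hε1 ?_) hδη
    rw [div_lt_iff₀ (by positivity)]
    linarith

end
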